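/- Every bridgeless cubic graph G has a proper 5-edge-coloring in which at least |E(G)| − μ_3(G) edges are normal, where μ_3(G) is the minimum number of edges left uncovered by a triple of perfect matchings of G. -/

import Mathlib

open Finset

def IsPerfectMatchingFinset {V : Type*} [Fintype V] [DecidableEq V]
    (G : SimpleGraph V) (M : Finset (Sym2 V)) : Prop :=
  (∀ e ∈ M, e ∈ G.edgeSet) ∧ ∀ v : V, (M.filter (fun e => v ∈ e)).card = 1

def edgeMult {V : Type*} [DecidableEq V] (M : Fin 3 → Finset (Sym2 V)) (e : Sym2 V) : ℕ :=
  (Finset.univ.filter fun i => e ∈ M i).card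

/-- The set of edges of `G` contained in exactly `i` of the three matchings. -/
def matchClass {V : Type*} [Fintype V] [DecidableEq V]
    (G : SimpleGraph V) [DecidableRel G.Adj] (M : Fin 3 → Finset (Sym2 V)) (i : ℕ) :
    Finset (Sym2 V) :=
  G.edgeFinset.filter fun e => edgeMult M e = i

/-- A proper edge coloring with `n` colors: distinct adjacent edges get
distinct colors. -/
def IsProperEdgeColoring {V : Type*} (G : SimpleGraph V) {n : ℕ} (c : Sym2 V → Fin n) : Prop :=
  ∀ e ∈ G.edgeSet, ∀ f ∈ G.edgeSet, e ≠ f → (∃ v, v ∈ e ∧ v ∈ f) → c e ≠ c f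

/-- The closed neighbourhood of an edge: the edge together with all edges
adjacent to it. -/
def edgeNbhd {V : Type*} [Fintype V] [DecidableEq V]
    (G : SimpleGraph V) [DecidableRel G.Adj] (e : Sym2 V) : Finset (Sym2 V) :=
  G.edgeFinset.filter fun f => ∃ v, v ∈ e ∧ v ∈ f

/-- An edge is poor if it and its adjacent edges use exactly 3 colors. -/
def IsPoorEdge {V : Type*} [Fintype V] [DecidableEq V]
    (G : SimpleGraph V) [DecidableRel G.Adj] {n : ℕ} (c : Sym2 V → Fin n) (e : Sym2 V) : Prop :=
  ((edgeNbhd G e).image c).card = 3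

/-- An edge is rich if it and its adjacent edges use exactly 5 colors. -/
def IsRichEdge {V : Type*} [Fintype V] [DecidableEq V]
    (G : SimpleGraph V) [DecidableRel G.Adj] {n : ℕ} (c : Sym2 V → Fin n) (e : Sym2 V) : Prop :=
  ((edgeNbhd G e).image c).card = 5

/-- An edge is normal if it is poor or rich. -/
def IsNormalEdge {V : Type*} [Fintype V] [DecidableEq V]
    (G : SimpleGraph V) [DecidableRel G.Adj] {n : ℕ} (c : Sym2 V → Fin n) (e : Sym2 V) : Prop :=
  IsPoorEdge G c e ∨ IsRichEdge G c e

/-- The set of colors appearing on the edges incident with a vertex. -/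
def vertexColors {V : Type*} [Fintype V] [DecidableEq V]
    (G : SimpleGraph V) [DecidableRel G.Adj] {n : ℕ} (c : Sym2 V → Fin n) (u : V) :
    Finset (Fin n) :=
  (G.incidenceFinset u).image c


/-! ### Colour sequences on cycles -/

/-- third label colour -/
def thirdC (a b : Fin 5) : Fin 5 :=
  if a ≠ 0 ∧ b ≠ 0 then 0 else if a ≠ 1 ∧ b ≠ 1 then 1 else 2

def mixedAt (c : ℕ → Fin 5) (j : ℕ) : Prop := ¬ (c j < 3 ↔ c (j+1) < 3)

def normal5 (a b c d e : Fin 5) : Prop :=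
  ({a, b, c, d, e} : Finset (Fin 5)).card = 3 ∨ ({a, b, c, d, e} : Finset (Fin 5)).card = 5

instance (a b c d e : Fin 5) : Decidable (normal5 a b c d e) := by unfold normal5; infer_instance
instance (c : ℕ → Fin 5) (j : ℕ) : Decidable (mixedAt c j) := by unfold mixedAt; infer_instance

/-- edge `j+1` is normal -/
def normAt (l c : ℕ → Fin 5) (j : ℕ) : Prop :=
  normal5 (c (j+1)) (c j) (l (j+1)) (c (j+2)) (l (j+2))

instance (l c : ℕ → Fin 5) (j : ℕ) : Decidable (normAt l c j) := by unfold normAt; infer_instance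

def properAt (l c : ℕ → Fin 5) (j : ℕ) : Prop :=
  c j ≠ c (j+1) ∧ c j ≠ l (j+1) ∧ c (j+1) ≠ l (j+1)

def seqCost (n : ℕ) (l c : ℕ → Fin 5) : ℕ :=
  ((range n).filter (fun j => mixedAt c j)).card + ((range n).filter (fun j => ¬ normAt l c j)).card

def SeqCol (n : ℕ) (l : ℕ → Fin 5) (B : ℕ) : Prop :=
  ∃ c : ℕ → Fin 5, (∀ j, c (j + n) = c j) ∧ (∀ j, properAt l c j) ∧ seqCost n l c ≤ B

theorem SeqCol.mono {n l B B'} (h : SeqCol n l B) (hB : B ≤ B') : SeqCol n l B' := by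
  obtain ⟨c, h1, h2, h3⟩ := h
  exact ⟨c, h1, h2, h3.trans hB⟩

theorem per_mul {α} {n : ℕ} {c : ℕ → α} (h : ∀ j, c (j + n) = c j) (k j : ℕ) : c (j + k * n) = c j := by
  induction k with
  | zero => simp
  | succ k ih => rw [Nat.succ_mul, ← add_assoc, h, ih]

theorem per_mod {α} {n : ℕ} {c : ℕ → α} (h : ∀ j, c (j + n) = c j) (j : ℕ) : c (j % n) = c j := by
  have := per_mul h (j / n) (j % n)
  rw [← this]; congr 1; rw [mul_comm]; exact (Nat.mod_add_div j n)

theorem card_filter_shift (n a : ℕ) (p : ℕ → Prop) [DecidablePred p] (hp : ∀ j, p (j + n) ↔ p j) :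
    ((range n).filter (fun j => p (j + a))).card = ((range n).filter p).card := by
  have h1 : ((range n).filter p).card = n.count p := by
    rw [Nat.count_eq_card_filter_range]
  have h2 := Nat.filter_Ico_card_eq_of_periodic a n p (fun j => propext (hp j))
  rw [h1, ← h2]
  refine card_bij (fun j _ => j + a) ?_ ?_ ?_
  · intro j hj; simp only [mem_filter, mem_range, mem_Ico] at hj ⊢; exact ⟨by omega, hj.2⟩
  · intro i _ j _ h; simpa using h
  · intro b hb
    simp only [mem_filter, mem_Ico] at hb
    refine ⟨b - a, ?_, by omega⟩
    simp only [mem_filter, mem_range]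
    rw [Nat.sub_add_cancel hb.1.1]
    exact ⟨by omega, hb.2⟩

theorem SeqCol.rot {n : ℕ} (hn : 0 < n) {l : ℕ → Fin 5} {B a : ℕ} (hl : ∀ j, l (j + n) = l j)
    (h : SeqCol n (fun j => l (j + a)) B) : SeqCol n l B := by
  obtain ⟨c, h1, h2, h3⟩ := h
  obtain ⟨b, k, hb⟩ : ∃ b k, a + b = k * n := by
    refine ⟨a * (n - 1), a, ?_⟩
    obtain ⟨m, rfl⟩ : ∃ m, n = m + 1 := ⟨n - 1, by omega⟩
    simp; ring
  have hc' : ∀ j, c (j + a + b) = c j := fun j => by rw [add_assoc, hb]; exact per_mul h1 k j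
  have hl' : ∀ j, l (j + b + a) = l j := fun j => by
    rw [add_assoc, add_comm b a, hb]; exact per_mul hl k j
  have key : ∀ j, normAt l (fun j => c (j + b)) j ↔ normAt (fun j => l (j + a)) c (j + b) := by
    intro j
    unfold normAt
    have e1 : l (j + b + 1 + a) = l (j + 1) := by
      rw [show j + b + 1 + a = (j + 1) + b + a by omega, hl']
    have e2 : l (j + b + 2 + a) = l (j + 2) := by
      rw [show j + b + 2 + a = (j + 2) + b + a by omega, hl']
    simp only [e1, e2]
    rw [show j + 1 + b = j + b + 1 by omega, show j + 2 + b = j + b + 2 by omega]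
  refine ⟨fun j => c (j + b), ?_, ?_, ?_⟩
  · intro j
    show c (j + n + b) = c (j + b)
    rw [show j + n + b = j + b + n by omega, h1]
  · intro j
    have := h2 (j + b)
    unfold properAt at this ⊢
    have e1 : l (j + b + 1 + a) = l (j + 1) := by
      rw [show j + b + 1 + a = (j + 1) + b + a by omega, hl']
    simp only [e1] at this
    show c (j + b) ≠ c (j + 1 + b) ∧ c (j + b) ≠ l (j+1) ∧ c (j + 1 + b) ≠ l (j+1)
    rw [show j + 1 + b = j + b + 1 by omega]
    exact this
  · unfold seqCost at h3 ⊢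
    have e1 := card_filter_shift n b (fun j => mixedAt c j) (by
      intro j; unfold mixedAt
      rw [show j + n + 1 = j + 1 + n by omega, h1, h1])
    have e2 := card_filter_shift n b (fun j => ¬ normAt (fun j => l (j + a)) c j) (by
      intro j; unfold normAt
      have : ∀ i, l (i + n + a) = l (i + a) := fun i => by
        rw [show i + n + a = i + a + n by omega, hl]
      simp only [show j + n + 1 = j + 1 + n by omega, show j + n + 2 = j + 2 + n by omega, h1, this])
    simp only [key]
    have e3 : ∀ j, mixedAt (fun j => c (j + b)) j ↔ mixedAt c (j + b) := by
      intro j; unfold mixedAt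
      simp only [show j + 1 + b = j + b + 1 by omega]
    simp only [e3]
    rw [e1, e2]; exact h3

theorem SeqCol.of_fun {n : ℕ} (hn : 2 ≤ n) {l f : ℕ → Fin 5} {B : ℕ} (hl : ∀ j, l (j + n) = l j)
    (h0 : f n = f 0) (h1 : f (n + 1) = f 1) (hp : ∀ j < n, properAt l f j)
    (hc : seqCost n l f ≤ B) : SeqCol n l B := by
  have hf : ∀ j < n + 2, f (j % n) = f j := by
    intro j hj
    rcases lt_or_ge j n with h | h
    · rw [Nat.mod_eq_of_lt h]
    · obtain ⟨k, rfl⟩ := Nat.exists_eq_add_of_le h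
      have : k = 0 ∨ k = 1 := by omega
      rcases this with rfl | rfl
      · simp [h0]
      · rw [h1, Nat.add_mod_left, Nat.mod_eq_of_lt (by omega)]
  have hper : ∀ j, (fun j => f (j % n)) (j + n) = (fun j => f (j % n)) j := by intro j; simp
  have hcl : ∀ j, properAt l (fun j => f (j % n)) j := by
    intro j
    have hj := Nat.mod_lt j (show 0 < n by omega)
    have := hp (j % n) hj
    unfold properAt at this ⊢
    have e1 : l (j % n + 1) = l (j + 1) := by
      rw [← per_mod hl (j % n + 1), ← per_mod hl (j + 1)]; simp
    have e2 : f (j % n + 1) = f ((j + 1) % n) := by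
      rw [← hf _ (by omega)]; simp
    rw [e1, e2] at this
    exact this
  refine ⟨fun j => f (j % n), hper, hcl, ?_⟩
  refine le_trans (le_of_eq ?_) hc
  unfold seqCost
  congr 2
  · apply filter_congr
    intro j hj; rw [mem_range] at hj
    unfold mixedAt
    simp only [hf j (by omega), hf (j+1) (by omega)]
  · apply filter_congr
    intro j hj; rw [mem_range] at hj
    unfold normAt
    simp only [hf j (by omega), hf (j+1) (by omega), hf (j+2) (by omega)]

set_option synthInstance.maxSize 2000 in
set_option synthInstance.maxHeartbeats 400000 in
set_option maxRecDepth 100000 in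
theorem norm_in : ∀ a b c d e : Fin 5, a < 3 → b < 3 → c < 3 → d < 3 → e < 3 →
    a ≠ b → a ≠ c → b ≠ c → a ≠ d → a ≠ e → d ≠ e → normal5 a b c d e := by decide +kernel

set_option synthInstance.maxSize 2000 in
set_option synthInstance.maxHeartbeats 400000 in
set_option maxRecDepth 100000 in
theorem norm_rich : ∀ a b c d e : Fin 5, a ≠ b → a ≠ c → a ≠ d → a ≠ e → b ≠ c → b ≠ d → b ≠ e →
    c ≠ d → c ≠ e → d ≠ e → normal5 a b c d e := by decide +kernel

theorem norm_eq : ∀ a b c : Fin 5, a ≠ b → a ≠ c → b ≠ c → normal5 a b c b c := by decide +kernel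

theorem lt3_ne {a b : Fin 5} (ha : a < 3) (hb : ¬ b < 3) : a ≠ b := by
  rintro rfl; exact hb ha

/-- The 3/4 alternating colours. -/
def alt (i : ℕ) : Fin 5 := if i % 2 = 0 then 3 else 4

theorem alt_nlt (i : ℕ) : ¬ alt i < 3 := by unfold alt; split_ifs <;> decide
theorem alt_ne (i : ℕ) : alt i ≠ alt (i+1) := by
  unfold alt
  rcases Nat.mod_two_eq_zero_or_one i with h | h
  · have : (i+1) % 2 = 1 := by omega
    simp [h, this]
  · have : (i+1) % 2 = 0 := by omega
    simp [h, this]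
theorem alt_add_two (i : ℕ) : alt (i+2) = alt i := by unfold alt; simp

theorem run_col {n q : ℕ} {l r : ℕ → Fin 5} {t : ℕ → Prop}
    (hl : ∀ j, l (j + n) = l j) (hl3 : ∀ j, l j < 3)
    (ht : ∀ j, t j → l j = l (j+1)) (hq : q + 2 ≤ n)
    (hr3 : ∀ j ≤ q, r j < 3) (hr1 : ∀ j ≤ q, r j ≠ l j) (hr2 : ∀ j ≤ q, r j ≠ l (j+1))
    (hr4 : ∀ j < q, r j ≠ r (j+1)) (ht1 : ¬ t (q+1)) (ht2 : ¬ t (n-1)) (S : Finset ℕ)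
    (hS : ∀ i, q < i → i < n → ¬ t i →
      ¬ (i = q + 1 ∧ i + 1 < n ∧ l (q+2) ≠ r q ∧ l (q+2) ≠ l (q+1)) →
      ¬ (i + 1 = n ∧ q + 1 < i ∧ l i ≠ r 0 ∧ l i ≠ l 0) → i ∈ S) :
    SeqCol n l (4 + S.card) := by
  set f0 : ℕ → Fin 5 := fun i => if i ≤ q then r i else alt i with hf0
  set f : ℕ → Fin 5 := fun i => if i < n then f0 i else f0 (i - n) with hf
  have fin : ∀ i ≤ q, f i = r i := fun i hi => by
    simp [hf, hf0, hi, show i < n by omega]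
  have fout : ∀ i, q < i → i < n → f i = alt i := fun i h1 h2 => by
    simp [hf, hf0, not_le.mpr h1, h2]
  have fn : f n = r 0 := by simp [hf, hf0]
  have ln : l n = l 0 := by have := hl 0; simpa using this
  have h0 : f n = f 0 := by rw [fn, fin 0 (by omega)]
  have h1 : f (n+1) = f 1 := by
    simp [hf, show 1 < n by omega]
  have hp : ∀ j < n, properAt l f j := by
    intro j hj
    unfold properAt
    rcases lt_or_ge j q with h | h
    · rw [fin j h.le, fin (j+1) h]
      exact ⟨hr4 j h, hr2 j h.le, hr1 (j+1) h⟩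
    · rcases eq_or_lt_of_le h with h | h
      · subst h
        rw [fin q le_rfl, fout (q+1) (by omega) (by omega)]
        exact ⟨lt3_ne (hr3 q le_rfl) (alt_nlt _), hr2 q le_rfl, (lt3_ne (hl3 _) (alt_nlt _)).symm⟩
      · rw [fout j h hj]
        rcases Nat.lt_or_ge (j+1) n with h' | h'
        · rw [fout (j+1) (by omega) h']
          exact ⟨alt_ne j, (lt3_ne (hl3 _) (alt_nlt _)).symm, (lt3_ne (hl3 _) (alt_nlt _)).symm⟩
        · have : j + 1 = n := by omega
          rw [this, fn, ln]
          exact ⟨(lt3_ne (hr3 0 (by omega)) (alt_nlt _)).symm, (lt3_ne (hl3 _) (alt_nlt _)).symm,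
            hr1 0 (by omega)⟩
  refine SeqCol.of_fun (by omega) hl h0 h1 hp ?_
  unfold seqCost
  have hm : ((range n).filter (fun j => mixedAt f j)) ⊆ {q, n-1} := by
    intro j hj
    simp only [mem_filter, mem_range] at hj
    obtain ⟨hj, hm⟩ := hj
    by_contra hne
    simp only [mem_insert, mem_singleton, not_or] at hne
    apply hm
    rcases lt_or_ge j q with h | h
    · rw [fin j h.le, fin (j+1) h]
      simp [hr3 j h.le, hr3 (j+1) h]
    · rw [fout j (by omega) hj, fout (j+1) (by omega) (by omega)]
      simp [alt_nlt]
  have hab : ((range n).filter (fun j => ¬ normAt l f j)) ⊆ {q-1, n-1} ∪ S.image (fun i => i - 1) := by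
    intro j hj
    simp only [mem_filter, mem_range] at hj
    obtain ⟨hj, hm⟩ := hj
    by_contra hne
    simp only [mem_union, mem_insert, mem_singleton, not_or, mem_image, not_exists, not_and] at hne
    obtain ⟨⟨hne1, hne2⟩, hne3⟩ := hne
    apply hm
    unfold normAt
    rcases lt_or_ge (j+1) q with h | h
    · rw [fin j (by omega), fin (j+1) (by omega), fin (j+2) (by omega)]
      exact norm_in _ _ _ _ _ (hr3 _ (by omega)) (hr3 _ (by omega)) (hl3 _) (hr3 _ (by omega)) (hl3 _)
        (hr4 j (by omega)).symm (hr1 _ (by omega)) (hr2 j (by omega)) (hr4 (j+1) (by omega))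
        (hr2 _ (by omega)) (hr1 _ (by omega))
    · have hq' : q < j + 1 := by omega
      have hjn : j + 1 < n := by omega
      rw [fout (j+1) hq' hjn]
      by_cases htj : t (j+1)
      · have a1 : j + 1 ≠ q + 1 := fun h => ht1 (h ▸ htj)
        have a2 : j + 1 ≠ n - 1 := fun h => ht2 (h ▸ htj)
        rw [fout j (by omega) hj, fout (j+2) (by omega) (by omega), ← ht _ htj, alt_add_two]
        exact norm_eq _ _ _ (alt_ne j).symm (lt3_ne (hl3 _) (alt_nlt _)).symm
          (lt3_ne (hl3 _) (alt_nlt _)).symm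
      · have hnS : j + 1 ∉ S := fun h => hne3 (j+1) h (by omega)
        have := mt (hS (j+1) hq' hjn htj)
        by_cases c1 : j + 1 = q + 1 ∧ j + 1 + 1 < n ∧ l (q+2) ≠ r q ∧ l (q+2) ≠ l (q+1)
        · obtain ⟨b1, b2, b3, b4⟩ := c1
          have : j = q := by omega
          subst this
          rw [fin j le_rfl, fout (j+2) (by omega) (by omega)]
          exact norm_rich _ _ _ _ _ (lt3_ne (hr3 _ le_rfl) (alt_nlt _)).symm
            (lt3_ne (hl3 _) (alt_nlt _)).symm (alt_ne _) (lt3_ne (hl3 _) (alt_nlt _)).symm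
            (hr2 _ le_rfl) (lt3_ne (hr3 _ le_rfl) (alt_nlt _)) b3.symm
            (lt3_ne (hl3 _) (alt_nlt _)) b4.symm (lt3_ne (hl3 _) (alt_nlt _)).symm
        · by_cases c2 : j + 1 + 1 = n ∧ q + 1 < j + 1 ∧ l (j+1) ≠ r 0 ∧ l (j+1) ≠ l 0
          · obtain ⟨b1, b2, b3, b4⟩ := c2
            have e : j + 2 = n := b1
            rw [e, fn, ln, fout j (by omega) hj]
            have h3 := hr3 0 (by omega)
            exact norm_rich _ _ _ _ _ (alt_ne j).symm
              (lt3_ne (hl3 _) (alt_nlt _)).symm (lt3_ne h3 (alt_nlt _)).symm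
              (lt3_ne (hl3 _) (alt_nlt _)).symm (lt3_ne (hl3 _) (alt_nlt _)).symm
              (lt3_ne h3 (alt_nlt _)).symm (lt3_ne (hl3 _) (alt_nlt _)).symm
              b3 b4 (hr1 0 (by omega))
          · exact absurd (hS (j+1) hq' hjn htj c1 c2) hnS
  have k1 := card_le_card hm
  have k2 := card_le_card hab
  have k3 := card_union_le ({q-1, n-1} : Finset ℕ) (S.image (fun i => i - 1))
  have k4 : (S.image (fun i => i - 1)).card ≤ S.card := card_image_le
  have k5 : ({q, n-1} : Finset ℕ).card ≤ 2 := card_le_two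
  have k6 : ({q-1, n-1} : Finset ℕ).card ≤ 2 := card_le_two
  omega

theorem thirdC_spec : ∀ a b : Fin 5, a < 3 → b < 3 →
    thirdC a b < 3 ∧ thirdC a b ≠ a ∧ thirdC a b ≠ b := by decide +kernel

theorem thirdC_uniq : ∀ a b c : Fin 5, a < 3 → b < 3 → c < 3 → a ≠ b → c ≠ a → c ≠ b →
    c = thirdC a b := by decide +kernel

def e0 (t : ℕ → Bool) (i : ℕ) : ℕ := if t i then 0 else 1
def cnt (t : ℕ → Bool) (a b : ℕ) : ℕ := ∑ i ∈ Ico a b, e0 t i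

theorem cnt_add (t : ℕ → Bool) {a b c : ℕ} (h1 : a ≤ b) (h2 : b ≤ c) :
    cnt t a b + cnt t b c = cnt t a c := sum_Ico_consecutive _ h1 h2

theorem cnt_succ (t : ℕ → Bool) {a b : ℕ} (h : a ≤ b) : cnt t a (b+1) = cnt t a b + e0 t b :=
  sum_Ico_succ_top h _

theorem cnt_bot (t : ℕ → Bool) {a b : ℕ} (h : a < b) : cnt t a b = e0 t a + cnt t (a+1) b :=
  sum_eq_sum_Ico_succ_bot h _

theorem cnt_card (t : ℕ → Bool) (a b : ℕ) :
    cnt t a b = ((Ico a b).filter (fun i => t i = false)).card := by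
  unfold cnt e0
  rw [card_filter]
  apply sum_congr rfl
  intro i _
  cases t i <;> simp

structure CS (n : ℕ) (t : ℕ → Bool) : Prop where
  n3 : 3 ≤ n
  per : ∀ j, t (j + n) = t j
  nc : ∀ j, t j = true → t (j+1) = false

structure LS (n : ℕ) (l : ℕ → Fin 5) : Prop where
  per : ∀ j, l (j + n) = l j
  lt : ∀ j, l j < 3

theorem CS.cnt_per {n t} (h : CS n t) (p : ℕ) : cnt t p (p + n) = cnt t 0 n := by
  induction p with
  | zero => simp
  | succ p ih =>
    rw [← ih]
    have h1 := cnt_bot t (show p < p + n by have := h.n3; omega)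
    have h2 := cnt_succ t (show p + 1 ≤ p + n by have := h.n3; omega)
    have : e0 t (p + n) = e0 t p := by unfold e0; rw [h.per]
    rw [show p + 1 + n = p + n + 1 by omega]
    omega

structure IsRun (l r : ℕ → Fin 5) (p q : ℕ) : Prop where
  lt : ∀ j, p ≤ j → j ≤ q → r j < 3
  n1 : ∀ j, p ≤ j → j ≤ q → r j ≠ l j
  n2 : ∀ j, p ≤ j → j ≤ q → r j ≠ l (j+1)
  n3 : ∀ j, p ≤ j → j < q → r j ≠ r (j+1)

theorem run_abs {n p q : ℕ} {t : ℕ → Bool} {l r : ℕ → Fin 5} (ht : CS n t) (hl : LS n l)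
    (teq : ∀ j, t j = true → l j = l (j+1)) (hr : IsRun l r p q) (hpq : p ≤ q) (hq : q + 2 ≤ p + n)
    (t1 : t (q+1) = false) (t2 : t (p + n - 1) = false) (S : Finset ℕ)
    (hS : ∀ i, q < i → i < p + n → t i = false →
      ¬ (i = q + 1 ∧ i + 1 < p + n ∧ l (q+2) ≠ r q ∧ l (q+2) ≠ l (q+1)) →
      ¬ (i + 1 = p + n ∧ q + 1 < i ∧ l i ≠ r p ∧ l i ≠ l p) → i ∈ S) :
    SeqCol n l (4 + S.card) := by
  obtain ⟨d, rfl⟩ := Nat.exists_eq_add_of_le hpq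
  have h3 := ht.n3
  apply SeqCol.rot (a := p) (by omega) hl.per
  have := run_col (n := n) (q := d) (l := fun j => l (j + p)) (r := fun j => r (j + p))
    (t := fun j => t (j + p) = true)
    (by intro j; show l (j + n + p) = l (j + p); rw [show j + n + p = j + p + n by omega, hl.per])
    (fun j => hl.lt _)
    (by intro j hj; show l (j + p) = l (j + 1 + p); rw [show j + 1 + p = j + p + 1 by omega]; exact teq _ hj)
    (by omega)
    (fun j hj => hr.lt _ (by omega) (by omega))
    (fun j hj => hr.n1 _ (by omega) (by omega))
    (fun j hj => by
      show r (j + p) ≠ l (j + 1 + p); rw [show j + 1 + p = j + p + 1 by omega]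
      exact hr.n2 _ (by omega) (by omega))
    (fun j hj => by
      show r (j + p) ≠ r (j + 1 + p); rw [show j + 1 + p = j + p + 1 by omega]
      exact hr.n3 _ (by omega) (by omega))
    (by rw [show d + 1 + p = p + d + 1 by omega, t1]; simp)
    (by rw [show n - 1 + p = p + n - 1 by omega, t2]; simp)
    (S.image (fun i => i - p))
    (by
      intro i h1 h2 h4 h5 h6
      rw [mem_image]
      refine ⟨i + p, hS (i + p) (by omega) (by omega) (by simpa using h4) ?_ ?_, by omega⟩
      · rintro ⟨a1, a2, a3, a4⟩
        apply h5
        refine ⟨by omega, by omega, ?_, ?_⟩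
        · rw [show d + 2 + p = p + d + 2 by omega, show d + p = p + d by omega]; exact a3
        · rw [show d + 2 + p = p + d + 2 by omega, show d + 1 + p = p + d + 1 by omega]; exact a4
      · rintro ⟨a1, a2, a3, a4⟩
        apply h6
        refine ⟨by omega, by omega, ?_, ?_⟩
        · simpa using a3
        · simpa using a4)
  refine this.mono ?_
  have : (S.image (fun i => i - p)).card ≤ S.card := card_image_le
  omega

/-- A closed run with `N` edges of type `E₀`. -/
structure CRun (t : ℕ → Bool) (l r : ℕ → Fin 5) (p q N : ℕ) : Prop extends IsRun l r p q where
  pq : p ≤ q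
  tr : t (q+1) = false
  tl : t (p-1) = false
  cn : cnt t p (q+1) = N

theorem IsRun.extR {n p q : ℕ} {l r : ℕ → Fin 5} (hl : LS n l)
    (h : IsRun l r p q) (hpq : p ≤ q)
    (hb : thirdC (l (q+1)) (r q) ≠ l (q+2)) :
    ∃ r', IsRun l r' p (q+1) := by
  have hs := thirdC_spec (l (q+1)) (r q) (hl.lt _) (h.lt q hpq le_rfl)
  refine ⟨Function.update r (q+1) (thirdC (l (q+1)) (r q)), ?_⟩
  have h1 : ∀ j, j ≤ q → Function.update r (q+1) (thirdC (l (q+1)) (r q)) j = r j := by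
    intro j hj; exact Function.update_of_ne (by omega) _ _
  constructor
  · intro j a b
    rcases Nat.lt_or_ge q j with c | c
    · have : j = q + 1 := by omega
      subst this; rw [Function.update_self]; exact hs.1
    · rw [h1 j c]; exact h.lt j a c
  · intro j a b
    rcases Nat.lt_or_ge q j with c | c
    · have : j = q + 1 := by omega
      subst this; rw [Function.update_self]; exact hs.2.1
    · rw [h1 j c]; exact h.n1 j a c
  · intro j a b
    rcases Nat.lt_or_ge q j with c | c
    · have : j = q + 1 := by omega
      subst this; rw [Function.update_self]; exact hb
    · rw [h1 j c]; exact h.n2 j a c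
  · intro j a b
    rcases Nat.lt_or_ge j q with c | c
    · rw [h1 j c.le, h1 (j+1) c]; exact h.n3 j a c
    · have : j = q := by omega
      subst this; rw [Function.update_self, h1 j le_rfl]; exact hs.2.2.symm

theorem IsRun.extL {n p q : ℕ} {l r : ℕ → Fin 5} (hl : LS n l)
    (h : IsRun l r (p+1) q) (hpq : p + 1 ≤ q)
    (hb : thirdC (l (p+1)) (r (p+1)) ≠ l p) :
    ∃ r', IsRun l r' p q := by
  have hs := thirdC_spec (l (p+1)) (r (p+1)) (hl.lt _) (h.lt _ le_rfl hpq)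
  refine ⟨Function.update r p (thirdC (l (p+1)) (r (p+1))), ?_⟩
  have h1 : ∀ j, p + 1 ≤ j → Function.update r p (thirdC (l (p+1)) (r (p+1))) j = r j := by
    intro j hj; exact Function.update_of_ne (by omega) _ _
  constructor
  · intro j a b
    rcases Nat.eq_or_lt_of_le a with c | c
    · subst c; rw [Function.update_self]; exact hs.1
    · rw [h1 j c]; exact h.lt j c b
  · intro j a b
    rcases Nat.eq_or_lt_of_le a with c | c
    · subst c; rw [Function.update_self]; exact hb
    · rw [h1 j c]; exact h.n1 j c b
  · intro j a b
    rcases Nat.eq_or_lt_of_le a with c | c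
    · subst c; rw [Function.update_self]; exact hs.2.1
    · rw [h1 j c]; exact h.n2 j c b
  · intro j a b
    rcases Nat.eq_or_lt_of_le a with c | c
    · subst c; rw [Function.update_self, h1 _ le_rfl]; exact hs.2.2
    · rw [h1 j c, h1 (j+1) (by omega)]; exact h.n3 j c b

theorem closeR {n p q : ℕ} {t : ℕ → Bool} {l r : ℕ → Fin 5} (ht : CS n t) (hl : LS n l)
    (teq : ∀ j, t j = true → l j = l (j+1)) (h : IsRun l r p q) (hpq : p ≤ q) :
    ∃ q' r', q ≤ q' ∧ IsRun l r' p q' ∧ t (q'+1) = false ∧ cnt t p (q'+1) = cnt t p (q+1) := by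
  by_cases c : t (q+1) = true
  · have hs := thirdC_spec (l (q+1)) (r q) (hl.lt _) (h.lt q hpq le_rfl)
    obtain ⟨r', hr'⟩ := h.extR hl hpq (by rw [← teq _ c]; exact hs.2.1)
    refine ⟨q+1, r', by omega, hr', ht.nc _ c, ?_⟩
    rw [cnt_succ t (show p ≤ q + 1 by omega)]
    simp [e0, c]
  · exact ⟨q, r, le_rfl, h, by simpa using c, rfl⟩

theorem closeL {n p q : ℕ} {t : ℕ → Bool} {l r : ℕ → Fin 5} (ht : CS n t) (hl : LS n l)
    (teq : ∀ j, t j = true → l j = l (j+1)) (h : IsRun l r p q) (hpq : p ≤ q) (hp : 2 ≤ p) :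
    ∃ p' r', p ≤ p' + 1 ∧ p' ≤ p ∧ IsRun l r' p' q ∧ t (p'-1) = false ∧ cnt t p' (q+1) = cnt t p (q+1) := by
  by_cases c : t (p-1) = true
  · obtain ⟨k, rfl⟩ : ∃ k, p = k + 1 := ⟨p - 1, by omega⟩
    have c' : t k = true := c
    have hs := thirdC_spec (l (k+1)) (r (k+1)) (hl.lt _) (h.lt _ le_rfl hpq)
    obtain ⟨r', hr'⟩ := h.extL hl hpq (by rw [teq _ c']; exact hs.2.1)
    refine ⟨k, r', by omega, by omega, hr', ?_, ?_⟩
    · by_contra hk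
      have := ht.nc (k-1) (by simpa using hk)
      rw [show k - 1 + 1 = k by omega] at this
      simp [c'] at this
    · rw [cnt_bot t (show k < q + 1 by omega)]
      simp [e0, c']
  · exact ⟨p, r, by omega, le_rfl, h, by simpa using c, rfl⟩

theorem third_of_unblocked : ∀ a b c : Fin 5, a < 3 → b < 3 → c < 3 → ¬ (c ≠ b ∧ c ≠ a) →
    thirdC a b ≠ c := by decide +kernel

theorem CRun.extR {n p q N : ℕ} {t : ℕ → Bool} {l r : ℕ → Fin 5} (ht : CS n t) (hl : LS n l)
    (teq : ∀ j, t j = true → l j = l (j+1)) (h : CRun t l r p q N)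
    (hb : ¬ (l (q+2) ≠ r q ∧ l (q+2) ≠ l (q+1))) : ∃ q' r', CRun t l r' p q' (N+1) := by
  have hr := h.toIsRun
  obtain ⟨r1, h1⟩ := hr.extR hl h.pq
    (third_of_unblocked _ _ _ (hl.lt _) (hr.lt q h.pq le_rfl) (hl.lt _) hb)
  obtain ⟨q', r', a, b, c, d⟩ := closeR ht hl teq h1 (by have := h.pq; omega)
  refine ⟨q', r', b, by have := h.pq; omega, c, h.tl, ?_⟩
  rw [d, cnt_succ t (by have := h.pq; omega), h.cn]
  simp [e0, h.tr]

theorem CRun.extL {n p q N : ℕ} {t : ℕ → Bool} {l r : ℕ → Fin 5} (ht : CS n t) (hl : LS n l)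
    (teq : ∀ j, t j = true → l j = l (j+1)) (h : CRun t l r p q N) (hp : 3 ≤ p)
    (hb : ¬ (l (p-1) ≠ r p ∧ l (p-1) ≠ l p)) :
    ∃ p' r', p ≤ p' + 2 ∧ CRun t l r' p' q (N+1) := by
  have hr := h.toIsRun
  have hpq := h.pq
  obtain ⟨k, rfl⟩ : ∃ k, p = k + 1 := ⟨p - 1, by omega⟩
  obtain ⟨r1, h1⟩ := hr.extL hl h.pq
    (third_of_unblocked _ _ _ (hl.lt _) (hr.lt _ le_rfl h.pq) (hl.lt _) hb)
  obtain ⟨p', r', a, a', b, c, d⟩ := closeL ht hl teq h1 (by omega) (by omega)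
  refine ⟨p', r', by omega, b, by omega, h.tr, c, ?_⟩
  have htk : t k = false := h.tl
  rw [d, cnt_bot t (by omega), h.cn]
  simp [e0, htk]; omega

theorem CRun.bound {n p q N : ℕ} {t : ℕ → Bool} {l r : ℕ → Fin 5} (ht : CS n t) (hl : LS n l)
    (teq : ∀ j, t j = true → l j = l (j+1)) (h : CRun t l r p q N) (hp : 1 ≤ p)
    (hN : N < cnt t 0 n) :
    SeqCol n l (4 + (cnt t 0 n - N)) ∧
    (N + 2 ≤ cnt t 0 n → (l (q+2) ≠ r q ∧ l (q+2) ≠ l (q+1)) →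
      SeqCol n l (4 + (cnt t 0 n - N - 1)) ∧ ((l (p-1) ≠ r p ∧ l (p-1) ≠ l p) →
      SeqCol n l (4 + (cnt t 0 n - N - 2)))) := by
  have hpq := h.pq
  have h3 := ht.n3
  have hq : q + 1 < p + n := by
    by_contra hc
    have a1 := cnt_add t (show p ≤ p + n by omega) (show p + n ≤ q + 1 by omega)
    rw [ht.cnt_per, h.cn] at a1
    omega
  have t2 : t (p + n - 1) = false := by
    rw [show p + n - 1 = p - 1 + n by omega, ht.per]; exact h.tl
  set S0 := (Ico (q+1) (p+n)).filter (fun i => t i = false) with hS0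
  have hc : S0.card = cnt t 0 n - N := by
    rw [hS0, ← cnt_card]
    have a1 := cnt_add t (show p ≤ q + 1 by omega) (show q + 1 ≤ p + n by omega)
    rw [ht.cnt_per, h.cn] at a1
    omega
  have m1 : q + 1 ∈ S0 := by simp [hS0, h.tr, hq]
  have m2 : p + n - 1 ∈ S0 := by simp [hS0, t2]; omega
  have base := run_abs ht hl teq h.toIsRun hpq (by omega) h.tr t2
  refine ⟨?_, ?_⟩
  · rw [← hc]
    refine base S0 ?_
    intro i b1 b2 b3 _ _
    simp [hS0, b3]; omega
  · intro hN2 hbR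
    have hne : q + 1 ≠ p + n - 1 := by
      intro he
      have : S0 ⊆ {q+1} := by
        intro i hi
        simp only [hS0, mem_filter, mem_Ico] at hi
        simp; omega
      have := card_le_card this
      simp at this
      omega
    refine ⟨?_, ?_⟩
    · have : cnt t 0 n - N - 1 = (S0.erase (q+1)).card := by rw [card_erase_of_mem m1, hc]
      rw [this]
      refine base _ ?_
      intro i b1 b2 b3 b4 _
      have : i ∈ S0 := by simp [hS0, b3]; omega
      refine mem_erase.mpr ⟨?_, this⟩
      rintro rfl
      exact b4 ⟨rfl, by omega, hbR⟩
    · intro hbL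
      have : cnt t 0 n - N - 2 = ((S0.erase (q+1)).erase (p+n-1)).card := by
        rw [card_erase_of_mem (mem_erase.mpr ⟨hne.symm, m2⟩), card_erase_of_mem m1, hc]
        omega
      rw [this]
      refine base _ ?_
      intro i b1 b2 b3 b4 b5
      have : i ∈ S0 := by simp [hS0, b3]; omega
      refine mem_erase.mpr ⟨?_, mem_erase.mpr ⟨?_, this⟩⟩
      · rintro rfl
        apply b5
        have e : l (p + n - 1) = l (p - 1) := by
          rw [show p + n - 1 = p - 1 + n by omega, hl.per]
        rw [e]
        exact ⟨by omega, by omega, hbL⟩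
      · rintro rfl
        exact b4 ⟨rfl, by omega, hbR⟩

theorem CRun.good {n p q : ℕ} {t : ℕ → Bool} {l r : ℕ → Fin 5} (ht : CS n t) (hl : LS n l)
    (teq : ∀ j, t j = true → l j = l (j+1)) (h : CRun t l r p q 2) (hp : 5 ≤ p)
    (hN : 5 ≤ cnt t 0 n) : SeqCol n l (cnt t 0 n) := by
  have fin3 : ∀ p' q' r', 1 ≤ p' → CRun t l r' p' q' 3 → SeqCol n l (cnt t 0 n) := by
    intro p' q' r' hp' h'
    by_cases hb : l (q'+2) ≠ r' q' ∧ l (q'+2) ≠ l (q'+1)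
    · exact (((h'.bound ht hl teq hp' (by omega)).2 (by omega) hb).1).mono (by omega)
    · obtain ⟨q2, r2, h2⟩ := h'.extR ht hl teq hb
      exact ((h2.bound ht hl teq hp' (by omega)).1).mono (by omega)
  by_cases hbR : l (q+2) ≠ r q ∧ l (q+2) ≠ l (q+1)
  · by_cases hbL : l (p-1) ≠ r p ∧ l (p-1) ≠ l p
    · exact (((h.bound ht hl teq (by omega) (by omega)).2 (by omega) hbR).2 hbL).mono (by omega)
    · obtain ⟨p', r', a, h'⟩ := h.extL ht hl teq (by omega) hbL
      exact fin3 p' q r' (by omega) h'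
  · obtain ⟨q', r', h'⟩ := h.extR ht hl teq hbR
    exact fin3 p q' r' (by omega) h'

theorem IsRun.close {n p q : ℕ} {t : ℕ → Bool} {l r : ℕ → Fin 5} (ht : CS n t) (hl : LS n l)
    (teq : ∀ j, t j = true → l j = l (j+1)) (h : IsRun l r p q) (hpq : p ≤ q) (hp : 6 ≤ p)
    (hc : cnt t p (q+1) = 2) : ∃ p' q' r', 5 ≤ p' ∧ CRun t l r' p' q' 2 := by
  obtain ⟨q', r1, a1, a2, a3, a4⟩ := closeR ht hl teq h hpq
  obtain ⟨p', r2, b1, b2, b3, b4, b5⟩ := closeL ht hl teq a2 (by omega) (by omega)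
  exact ⟨p', q', r2, by omega, b3, by omega, a3, b4, by omega⟩

/-- successor relation mod 3 on label colours -/
def suc3 (a b : Fin 5) : Bool := (a = 0 ∧ b = 1) ∨ (a = 1 ∧ b = 2) ∨ (a = 2 ∧ b = 0)

theorem vcentre : ∀ a d b : Fin 5, a < 3 → d < 3 → b < 3 →
    (∃ s0 s2 : Fin 5, s0 < 3 ∧ s2 < 3 ∧ s0 ≠ a ∧ s0 ≠ d ∧ s2 ≠ d ∧ s2 ≠ b ∧ s0 ≠ s2) ∨
    (a ≠ d ∧ d ≠ b ∧ suc3 d b = !(suc3 a d)) := by decide +kernel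

theorem ecentre : ∀ a d b : Fin 5, a < 3 → d < 3 → b < 3 →
    (∃ s m : Fin 5, s < 3 ∧ m < 3 ∧ s ≠ a ∧ s ≠ d ∧ s ≠ b ∧ m ≠ s ∧ m ≠ d) ∨
    (a ≠ d ∧ d ≠ b ∧ suc3 d b = (suc3 a d)) := by decide +kernel

theorem exists_crun {n : ℕ} {t : ℕ → Bool} {l : ℕ → Fin 5} (ht : CS n t) (hl : LS n l)
    (teq : ∀ j, t j = true → l j = l (j+1)) (hodd : n % 2 = 1) :
    ∃ p q r, 5 ≤ p ∧ CRun t l r p q 2 := by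
  by_contra hcon
  have n3 := ht.n3
  -- V centre
  have hV : ∀ j, 10 ≤ j → t j = false → t (j+1) = false →
      suc3 (l (j+1)) (l (j+2)) = !(suc3 (l j) (l (j+1))) := by
    intro j hj h1 h2
    rcases vcentre (l j) (l (j+1)) (l (j+2)) (hl.lt _) (hl.lt _) (hl.lt _) with h | h
    · exfalso; apply hcon
      obtain ⟨s0, s2, c1, c2, c3, c4, c5, c6, c7⟩ := h
      have hr : IsRun l (fun i => if i = j then s0 else s2) j (j+1) := by
        constructor
        · intro i _ _; split_ifs <;> assumption
        · intro i a b
          split_ifs with h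
          · subst h; exact c3
          · have : i = j + 1 := by omega
            subst this; exact c5
        · intro i a b
          split_ifs with h
          · subst h; exact c4
          · have : i = j + 1 := by omega
            subst this; exact c6
        · intro i a b
          have : i = j := by omega
          subst this; simp [c7]
      refine hr.close ht hl teq (by omega) (by omega) ?_
      rw [cnt_succ t (by omega), cnt_succ t (by omega)]
      simp [cnt, e0, h1, h2]
    · exact h.2.2
  have hE : ∀ j, 10 ≤ j → t (j+1) = true →
      suc3 (l (j+2)) (l (j+3)) = (suc3 (l j) (l (j+1))) := by
    intro j hj h1
    have e1 : l (j+2) = l (j+1) := (teq _ h1).symm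
    have t0 : t j = false := by
      by_contra hk
      have := ht.nc j (by simpa using hk)
      simp [h1] at this
    have t2 : t (j+2) = false := ht.nc _ h1
    rw [e1]
    rcases ecentre (l j) (l (j+1)) (l (j+3)) (hl.lt _) (hl.lt _) (hl.lt _) with h | h
    · exfalso; apply hcon
      obtain ⟨s, m, c1, c2, c3, c4, c5, c6, c7⟩ := h
      have hr : IsRun l (fun i => if i = j + 1 then m else s) j (j+2) := by
        constructor
        · intro i _ _; split_ifs <;> assumption
        · intro i a b
          split_ifs with h
          · subst h; exact c7
          · have : i = j ∨ i = j + 2 := by omega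
            rcases this with rfl | rfl
            · exact c3
            · rw [e1]; exact c4
        · intro i a b
          split_ifs with h
          · subst h; show m ≠ l (j+2); rw [e1]; exact c7
          · have : i = j ∨ i = j + 2 := by omega
            rcases this with rfl | rfl
            · exact c4
            · exact c5
        · intro i a b
          have : i = j ∨ i = j + 1 := by omega
          rcases this with rfl | rfl
          · simp [c6.symm]
          · simp [c6]
      refine hr.close ht hl teq (by omega) (by omega) ?_
      rw [cnt_succ t (by omega), cnt_succ t (by omega), cnt_succ t (by omega)]
      simp [cnt, e0, h1, t0, t2]
    · exact h.2.2
  -- sign function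
  let s : ℕ → Bool := fun j => xor (suc3 (l j) (l (j+1))) (j % 2 = 1)
  obtain ⟨j0, hj0, htj0⟩ : ∃ j, 10 ≤ j ∧ t j = false := by
    by_cases h : t 10 = true
    · exact ⟨11, by omega, ht.nc _ h⟩
    · exact ⟨10, le_rfl, by simpa using h⟩
  have main : ∀ k, (t (j0 + k) = false → s (j0 + k) = s j0) ∧
      (t (j0 + k) = true → 1 ≤ k ∧ s (j0 + k - 1) = s j0) := by
    intro k
    induction k with
    | zero => simp [htj0]
    | succ k ih =>
      refine ⟨?_, ?_⟩
      · intro h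
        by_cases hk : t (j0 + k) = true
        · obtain ⟨i1, i2⟩ := ih.2 hk
          obtain ⟨i, rfl⟩ : ∃ i, k = i + 1 := ⟨k - 1, by omega⟩
          have := hE (j0 + i) (by omega) hk
          rw [← i2]
          show xor (suc3 (l (j0 + i + 2)) (l (j0 + i + 3))) _ = xor (suc3 (l (j0 + i)) (l (j0 + i + 1))) _
          rw [this]
          congr 2
          simp only [eq_iff_iff]
          omega
        · have hk : t (j0 + k) = false := by simpa using hk
          rw [← ih.1 hk]
          have := hV (j0 + k) (by omega) hk h
          show xor (suc3 (l (j0 + k + 1)) (l (j0 + k + 2))) _ = xor (suc3 (l (j0 + k)) (l (j0 + k + 1))) _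
          rw [this]
          rcases Nat.mod_two_eq_zero_or_one (j0 + k) with h | h
          · have h' : (j0 + (k + 1)) % 2 = 1 := by omega
            simp [h, h']
          · have h' : (j0 + (k + 1)) % 2 = 0 := by omega
            simp [h, h']
      · intro h
        refine ⟨by omega, ?_⟩
        have hk : t (j0 + k) = false := by
          by_contra hk
          have := ht.nc (j0 + k) (by simpa using hk)
          rw [show j0 + k + 1 = j0 + (k+1) by omega, h] at this
          simp at this
        exact ih.1 hk
  have h1 := (main n).1 (by rw [ht.per]; exact htj0)
  have : s (j0 + n) = !(s j0) := by
    show xor (suc3 (l (j0 + n)) (l (j0 + n + 1))) _ = !(xor (suc3 (l j0) (l (j0 + 1))) _)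
    rw [show j0 + n + 1 = j0 + 1 + n by omega, hl.per, hl.per]
    rcases Nat.mod_two_eq_zero_or_one j0 with h | h
    · have h' : (j0 + n) % 2 = 1 := by omega
      simp [h, h']
    · have h' : (j0 + n) % 2 = 0 := by omega
      simp [h, h']
  rw [this] at h1
  cases hs : s j0 <;> simp [hs] at h1


/-! ### Even cycles, and small cases -/

theorem even_col {n : ℕ} {l : ℕ → Fin 5} (hn : 2 ≤ n) (hl : LS n l) (he : n % 2 = 0)
    (B : ℕ) (hB : ((range n).filter (fun j => ¬ l (j+1) = l (j+2))).card ≤ B) :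
    SeqCol n l B := by
  have hper : ∀ j, alt (j + n) = alt j := by
    intro j; unfold alt; rw [show (j + n) % 2 = j % 2 by omega]
  refine ⟨alt, hper, ?_, ?_⟩
  · intro j
    exact ⟨alt_ne j, (lt3_ne (hl.lt _) (alt_nlt _)).symm, (lt3_ne (hl.lt _) (alt_nlt _)).symm⟩
  · unfold seqCost
    have h1 : ((range n).filter (fun j => mixedAt alt j)) = ∅ := by
      apply filter_false_of_mem
      intro j _ h; apply h; simp [alt_nlt]
    rw [h1, card_empty, zero_add]
    refine le_trans (card_le_card ?_) hB
    apply monotone_filter_right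
    intro j _ hj heq
    apply hj
    unfold normAt
    rw [alt_add_two, heq]
    exact norm_eq _ _ _ (alt_ne _).symm (lt3_ne (hl.lt _) (alt_nlt _)).symm
          (lt3_ne (hl.lt _) (alt_nlt _)).symm

def normF (a b c d e : Fin 5) : Bool :=
  (b == d && c == e) || (b == e && c == d) || (b != d && b != e && c != d && c != e)

set_option synthInstance.maxSize 2000 in
set_option synthInstance.maxHeartbeats 400000 in
set_option maxRecDepth 100000 in
theorem normF_sound : ∀ a b c d e : Fin 5, a ≠ b → a ≠ c → b ≠ c → a ≠ d → a ≠ e → d ≠ e →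
    normF a b c d e = true → normal5 a b c d e := by decide +kernel

def rcF (l : ℕ → Fin 5) (ln : ℕ) (s : Fin 5) : ℕ → Fin 5
  | 0 => s
  | i+1 => if i + 1 < ln then thirdC (l (i+1)) (rcF l ln s i) else
      if rcF l ln s i = 3 then 4 else 3

def wrapF (n : ℕ) (f : ℕ → Fin 5) (i : ℕ) : Fin 5 := if i < n then f i else f (i - n)

def okF (n : ℕ) (l f : ℕ → Fin 5) (B : ℕ) : Bool :=
  (List.range n).all (fun j => f j != f (j+1) && f j != l (j+1) && f (j+1) != l (j+1)) &&
  Nat.ble ((List.range n).countP (fun j => decide (f j < 3) != decide (f (j+1) < 3)) +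
    (List.range n).countP (fun j => !(normF (f (j+1)) (f j) (l (j+1)) (f (j+2)) (l (j+2))))) B

def srchF (n : ℕ) (l : ℕ → Fin 5) (B : ℕ) : Bool :=
  (List.range n).any fun a => (List.range n).any fun k => [0,1,2].any fun s =>
    okF n (fun j => l (j + a)) (wrapF n (rcF (fun j => l (j + a)) (k+1) s)) B

theorem card_filter_range_countP (n : ℕ) (p : ℕ → Prop) [DecidablePred p] :
    ((range n).filter p).card = (List.range n).countP (fun j => decide (p j)) := by
  rw [List.countP_eq_length_filter]; rfl

theorem okF_sound {n B : ℕ} {l f : ℕ → Fin 5} (hn : 2 ≤ n) (hl : ∀ j, l (j + n) = l j)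
    (h0 : f n = f 0) (h1 : f (n+1) = f 1) (h : okF n l f B = true) : SeqCol n l B := by
  unfold okF at h
  simp only [Bool.and_eq_true, List.all_eq_true, List.mem_range, bne_iff_ne, Nat.ble_eq] at h
  obtain ⟨h2, h3⟩ := h
  have hp : ∀ j < n, properAt l f j := fun j hj => ⟨(h2 j hj).1.1, (h2 j hj).1.2, (h2 j hj).2⟩
  refine SeqCol.of_fun hn hl h0 h1 hp (le_trans ?_ h3)
  unfold seqCost
  rw [card_filter_range_countP, card_filter_range_countP]
  apply Nat.add_le_add
  · apply List.countP_mono_left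
    intro j _ hj
    simp only [mixedAt, decide_eq_true_eq] at hj
    by_cases a : f j < 3 <;> by_cases b : f (j+1) < 3 <;> simp_all
  · apply List.countP_mono_left
    intro j hj hh
    rw [List.mem_range] at hj
    simp only [decide_eq_true_eq] at hh
    by_contra hc
    apply hh
    simp only [Bool.not_eq_true, Bool.not_eq_false'] at hc
    have p1 := hp j hj
    have p2 : properAt l f (j+1) := by
      rcases Nat.lt_or_ge (j+1) n with h | h
      · exact hp _ h
      · have e : j + 1 = n := by omega
        have q := hp 0 (by omega)
        unfold properAt at q ⊢
        rw [e, h0, h1, show n + 1 = 1 + n by omega, hl]; exact q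
    have hc' : normF (f (j+1)) (f j) (l (j+1)) (f (j+2)) (l (j+2)) = true := by
      cases hx : normF (f (j+1)) (f j) (l (j+1)) (f (j+2)) (l (j+2)) <;> simp_all
    exact normF_sound _ _ _ _ _ p1.1.symm p1.2.2 p1.2.1 p2.1 p2.2.1 p2.2.2 hc'

theorem srchF_sound {n B : ℕ} {l : ℕ → Fin 5} (hn : 2 ≤ n) (hl : ∀ j, l (j + n) = l j)
    (h : srchF n l B = true) : SeqCol n l B := by
  unfold srchF at h
  simp only [List.any_eq_true, List.mem_range] at h
  obtain ⟨a, ha, k, hk, s, hs, h⟩ := h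
  refine SeqCol.rot (a := a) (by omega) hl ?_
  refine okF_sound hn ?_ ?_ ?_ h
  · intro j; show l (j + n + a) = l (j + a); rw [show j + n + a = j + a + n by omega, hl]
  · simp [wrapF, show 0 < n by omega]
  · simp [wrapF, show 1 < n by omega]

def labF (L : List (Fin 5)) (j : ℕ) : Fin 5 := L.getD (j % L.length) 0

def two3 (p : Fin 5 → Bool) : Bool := (p 0 && p 1) || (p 0 && p 2) || (p 1 && p 2)

theorem two3_spec {p : Fin 5 → Bool} (h : two3 p = true) {c1 c2 : Fin 5} (h1 : c1 < 3) (h2 : c2 < 3)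
    (hne : c1 ≠ c2) : p c1 = true ∨ p c2 = true := by
  have k : ∀ c : Fin 5, c < 3 → c = 0 ∨ c = 1 ∨ c = 2 := by decide
  unfold two3 at h
  rcases k c1 h1 with rfl | rfl | rfl <;> rcases k c2 h2 with rfl | rfl | rfl <;>
    simp_all <;> tauto

def allL (p : Fin 5 → Bool) : Bool := p 0 && p 1 && p 2
theorem allL_spec {p : Fin 5 → Bool} (h : allL p = true) {c : Fin 5} (h1 : c < 3) : p c = true := by
  have k : ∀ c : Fin 5, c < 3 → c = 0 ∨ c = 1 ∨ c = 2 := by decide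
  unfold allL at h
  rcases k c h1 with rfl | rfl | rfl <;> simp_all

set_option maxRecDepth 100000 in
theorem small3 : (allL fun a => allL fun b => two3 fun d => srchF 3 (labF [d,a,b]) 3) = true := by
  decide +kernel
set_option maxRecDepth 100000 in
theorem small51 : (allL fun a => allL fun b => allL fun c => two3 fun d => srchF 5 (labF [d,a,a,b,c]) 4) = true := by
  decide +kernel
set_option maxRecDepth 100000 in
theorem small52 : (allL fun a => allL fun b => allL fun c => two3 fun d => srchF 5 (labF [d,a,b,b,c]) 4) = true := by
  decide +kernel
set_option maxRecDepth 100000 in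
theorem small53 : (allL fun a => allL fun b => allL fun c => two3 fun d => srchF 5 (labF [d,a,b,c,c]) 4) = true := by
  decide +kernel
set_option maxRecDepth 100000 in
theorem small54 : (allL fun a => allL fun b => two3 fun d => srchF 5 (labF [d,a,a,b,b]) 3) = true := by
  decide +kernel
set_option maxRecDepth 100000 in
theorem small7 : (allL fun a => allL fun b => allL fun c => two3 fun d => srchF 7 (labF [d,a,a,b,b,c,c]) 4) = true := by
  decide +kernel


/-! ### The cycle lemmas -/

def distL (n : ℕ) (l g : ℕ → Fin 5) : ℕ := ((range n).filter (fun i => l i ≠ g i)).card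

theorem uneq_le_dist {n : ℕ} {t : ℕ → Bool} {l g : ℕ → Fin 5} (ht : CS n t) (hl : LS n l)
    (hg : LS n g) (geq : ∀ j, t j = true → g j = g (j+1)) :
    ((range n).filter (fun i => t i = true ∧ l i ≠ l (i+1))).card ≤ distL n l g := by
  have h3 := ht.n3
  have s1 := card_filter_shift n 1 (fun i => t (i + n - 1) = true ∧ l i ≠ g i) (by
    intro j
    rw [show j + n + n - 1 = (j + n - 1) + n by omega, ht.per, hl.per, hg.per])
  have e1 : ∀ j, t (j + 1 + n - 1) = t j := fun j => by
    rw [show j + 1 + n - 1 = j + n by omega, ht.per]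
  simp only [e1] at s1
  have hsub : (range n).filter (fun i => t i = true ∧ l i ≠ l (i+1)) ⊆
      (range n).filter (fun i => t i = true ∧ l i ≠ g i) ∪
      (range n).filter (fun i => t i = true ∧ l (i+1) ≠ g (i+1)) := by
    intro i hi
    simp only [mem_filter, mem_union, mem_range] at hi ⊢
    obtain ⟨a, b, c⟩ := hi
    by_cases h : l i = g i
    · right; refine ⟨a, b, ?_⟩
      intro h'; apply c; rw [h, h', geq _ b]
    · left; exact ⟨a, b, h⟩
  refine (card_le_card hsub).trans ((card_union_le _ _).trans ?_)
  rw [s1, ← card_union_of_disjoint]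
  · apply card_le_card
    intro i hi
    simp only [mem_filter, mem_union, mem_range] at hi ⊢
    rcases hi with ⟨a, _, c⟩ | ⟨a, _, c⟩ <;> exact ⟨a, c⟩
  · rw [disjoint_left]
    intro i h1 h2
    simp only [mem_filter, mem_range] at h1 h2
    have := ht.nc _ h2.2.1
    rw [show i + n - 1 + 1 = i + n by omega, ht.per, h1.2.1] at this
    simp at this

theorem cnt_range (t : ℕ → Bool) (n : ℕ) : cnt t 0 n = ((range n).filter (fun i => t i = false)).card := by
  rw [cnt_card, range_eq_Ico]

theorem even_bound {n : ℕ} {t : ℕ → Bool} {l : ℕ → Fin 5} (ht : CS n t) (hl : LS n l) (he : n % 2 = 0) :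
    SeqCol n l (cnt t 0 n + ((range n).filter (fun i => t i = true ∧ l i ≠ l (i+1))).card) := by
  have h3 := ht.n3
  refine even_col (by omega) hl he _ ?_
  have s1 := card_filter_shift n 1 (fun i => ¬ l i = l (i+1)) (by
    intro j; rw [show j + n + 1 = j + 1 + n by omega, hl.per, hl.per])
  simp only [add_assoc] at s1
  norm_num at s1
  rw [s1, cnt_range]
  refine le_trans (card_le_card ?_) (card_union_le _ _)
  intro i hi
  simp only [mem_filter, mem_union, mem_range] at hi ⊢
  cases h : t i <;> simp [hi.1, hi.2]

theorem odd_uneq {n : ℕ} {t : ℕ → Bool} {l : ℕ → Fin 5} (ht : CS n t) (hl : LS n l) (ho : n % 2 = 1)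
    (t0 : t 0 = true) (h0 : l 0 ≠ l 1) :
    SeqCol n l (cnt t 0 n + ((range n).filter (fun i => t i = true ∧ l i ≠ l (i+1))).card + 1) := by
  have h3 := ht.n3
  have ln : l n = l 0 := by have := hl.per 0; simpa using this
  have ln1 : l (n+1) = l 1 := by have := hl.per 1; rw [add_comm 1 n] at this; exact this
  have hs := thirdC_spec (l 0) (l 1) (hl.lt _) (hl.lt _)
  set f0 : ℕ → Fin 5 := fun i => if i = 0 then thirdC (l 0) (l 1) else alt (i+1) with hf0
  set f : ℕ → Fin 5 := fun i => if i < n then f0 i else f0 (i - n) with hf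
  have f00 : f 0 = thirdC (l 0) (l 1) := by simp [hf, hf0, show 0 < n by omega]
  have fo : ∀ i, 0 < i → i < n → f i = alt (i+1) := fun i a b => by
    simp [hf, hf0, b, show i ≠ 0 by omega]
  have fn : f n = f 0 := by simp [hf, show 0 < n by omega]
  have fn1 : f (n+1) = f 1 := by simp [hf, show 1 < n by omega]
  have altl : ∀ i j, alt i ≠ l j := fun i j => (lt3_ne (hl.lt _) (alt_nlt _)).symm
  have tn : t (n-1) = false := by
    by_contra hc
    have := ht.nc _ (by simpa using hc)
    rw [show n - 1 + 1 = 0 + n by omega, ht.per, t0] at this; simp at this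
  refine SeqCol.of_fun (by omega) hl.per fn fn1 ?_ ?_
  · intro j hj
    unfold properAt
    rcases Nat.eq_zero_or_pos j with rfl | hj0
    · rw [f00, fo 1 (by omega) (by omega)]
      exact ⟨lt3_ne hs.1 (alt_nlt _), hs.2.2, altl _ _⟩
    · rw [fo j hj0 hj]
      rcases Nat.lt_or_ge (j+1) n with h | h
      · rw [fo (j+1) (by omega) h]
        exact ⟨alt_ne _, altl _ _, altl _ _⟩
      · have e : j + 1 = n := by omega
        rw [e, fn, ln, f00]
        exact ⟨(lt3_ne hs.1 (alt_nlt _)).symm, altl _ _, hs.2.1⟩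
  · unfold seqCost
    have hm : ((range n).filter (fun j => mixedAt f j)) ⊆ {0, n-1} := by
      intro j hj
      simp only [mem_filter, mem_range] at hj
      obtain ⟨hj, hm⟩ := hj
      by_contra hne
      simp only [mem_insert, mem_singleton, not_or] at hne
      apply hm
      rw [fo j (by omega) hj, fo (j+1) (by omega) (by omega)]
      simp [alt_nlt]
    set U := (range n).filter (fun i => t i = true ∧ l i ≠ l (i+1)) with hU
    have hU0 : 0 ∈ U := by simp [hU, t0, h0]; omega
    have hab : ((range n).filter (fun j => ¬ normAt l f j)) ⊆
        (((range n).filter (fun i => t i = false)) ∪ U.erase 0).image (fun i => i - 1) := by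
      intro j hj
      simp only [mem_filter, mem_range] at hj
      obtain ⟨hj, hm⟩ := hj
      rcases Nat.lt_or_ge (j+1) n with h | h
      · rw [mem_image]
        refine ⟨j+1, ?_, rfl⟩
        by_contra hne
        simp only [mem_union, mem_filter, mem_range, mem_erase, hU, not_or, not_and] at hne
        obtain ⟨n1, n2⟩ := hne
        have tj : t (j+1) = true := by have := n1 h; simpa using this
        have hj0 : j ≠ 0 := by
          rintro rfl
          have := ht.nc _ t0
          simp [this] at tj
        have hjn : j + 1 ≠ n - 1 := by intro he; rw [he, tn] at tj; simp at tj
        have e : l (j+1) = l (j+2) := by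
          have := n2 (by omega) h tj; simpa using this
        apply hm
        unfold normAt
        rw [fo j (by omega) hj, fo (j+1) (by omega) h, fo (j+2) (by omega) (by omega), ← e]
        rw [show alt (j+2+1) = alt (j+1) from alt_add_two (j+1)]
        exact norm_eq _ _ _ (alt_ne _).symm (altl _ _) (altl _ _)
      · exfalso
        have e : j + 1 = n := by omega
        apply hm
        unfold normAt
        rw [show j + 2 = n + 1 by omega, e, fn, fn1, ln, ln1, f00, fo 1 (by omega) (by omega),
          fo j (by omega) hj]
        have : alt (j+1) = alt (1 + 1 + 1) := by unfold alt; rw [e, ho]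
        rw [this]
        exact norm_rich _ _ _ _ _ (lt3_ne hs.1 (alt_nlt _)) hs.2.1 (lt3_ne hs.1 (alt_nlt _)) hs.2.2
          (altl _ _) (alt_ne _).symm (altl _ _) (altl _ _).symm h0 (altl _ _)
    have k1 := card_le_card hm
    have k2 := (card_le_card hab).trans (card_image_le.trans (card_union_le _ _))
    rw [← cnt_range, card_erase_of_mem hU0] at k2
    have k5 : ({0, n-1} : Finset ℕ).card ≤ 2 := card_le_two
    have : 1 ≤ U.card := card_pos.mpr ⟨0, hU0⟩
    omega

theorem CS.shift {n : ℕ} {t : ℕ → Bool} (h : CS n t) (a : ℕ) : CS n (fun j => t (j + a)) :=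
  ⟨h.n3, fun j => by show t (j + n + a) = _; rw [show j + n + a = j + a + n by omega, h.per],
   fun j hj => by show t (j + 1 + a) = _; rw [show j + 1 + a = j + a + 1 by omega]; exact h.nc _ hj⟩

theorem LS.shift {n : ℕ} {l : ℕ → Fin 5} (h : LS n l) (a : ℕ) : LS n (fun j => l (j + a)) :=
  ⟨fun j => by show l (j + n + a) = _; rw [show j + n + a = j + a + n by omega, h.per],
   fun j => h.lt _⟩

theorem CS.cnt_shift {n : ℕ} {t : ℕ → Bool} (h : CS n t) (a : ℕ) :
    cnt (fun j => t (j + a)) 0 n = cnt t 0 n := by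
  rw [cnt_range, cnt_range]
  exact card_filter_shift n a (fun i => t i = false) (fun j => by rw [h.per])

/-- S1 -/
theorem cyc_bound {n : ℕ} {t : ℕ → Bool} {l g : ℕ → Fin 5} (ht : CS n t) (hl : LS n l)
    (hg : LS n g) (geq : ∀ j, t j = true → g j = g (j+1)) (hc : n % 2 = 1 → 3 ≤ cnt t 0 n)
    (hgs : SeqCol n g (cnt t 0 n)) : SeqCol n l (cnt t 0 n + 2 * distL n l g) := by
  have h3 := ht.n3
  have hud := uneq_le_dist ht hl hg geq
  rcases Nat.mod_two_eq_zero_or_one n with he | ho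
  · exact (even_bound ht hl he).mono (by omega)
  by_cases h1 : ∀ i < n, l i = g i
  · have : l = g := by
      funext j; rw [← per_mod hl.per j, ← per_mod hg.per j]
      exact h1 _ (Nat.mod_lt _ (by omega))
    rw [this]; exact hgs.mono (by omega)
  have hd : 1 ≤ distL n l g := by
    push Not at h1
    obtain ⟨i, a, b⟩ := h1
    exact card_pos.mpr ⟨i, by simp [a, b]⟩
  by_cases h2 : ∀ j, t j = true → l j = l (j+1)
  · obtain ⟨p, q, r, hp, hr⟩ := exists_crun ht hl h2 ho
    have h4 := hc ho
    exact ((hr.bound ht hl h2 (by omega) (by omega)).1).mono (by omega)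
  · push Not at h2
    obtain ⟨a, ha, hb⟩ := h2
    refine SeqCol.rot (a := a) (by omega) hl.per ?_
    refine (odd_uneq (ht.shift a) (hl.shift a) ho (by simpa using ha) ?_).mono ?_
    · simp only [zero_add]; rw [add_comm 1 a]; exact hb
    · rw [ht.cnt_shift]
      have := card_filter_shift n a (fun i => t i = true ∧ l i ≠ l (i+1)) (by
        intro j; rw [ht.per, hl.per, show j + n + 1 = j + 1 + n by omega, hl.per])
      simp only [show ∀ j, j + 1 + a = j + a + 1 from fun j => by omega]
      rw [this]
      have : 1 ≤ ((range n).filter (fun i => t i = true ∧ l i ≠ l (i+1))).card := by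
        apply card_pos.mpr
        refine ⟨a % n, ?_⟩
        simp only [mem_filter, mem_range]
        refine ⟨Nat.mod_lt _ (by omega), ?_, ?_⟩
        · rw [per_mod ht.per]; exact ha
        · rw [per_mod hl.per, ← per_mod hl.per (a % n + 1), Nat.mod_add_mod, per_mod hl.per]; exact hb
      omega

theorem tri_bound {l : ℕ → Fin 5} (hl : LS 3 l) : SeqCol 3 l 6 := by
  have key : ∀ a b c : Fin 5, a < 3 → b < 3 → c < 3 →
      ∃ x y z : Fin 5, x ≠ y ∧ y ≠ z ∧ z ≠ x ∧ x ≠ a ∧ x ≠ b ∧ y ≠ b ∧ y ≠ c ∧ z ≠ c ∧ z ≠ a := by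
    decide +kernel
  obtain ⟨x, y, z, h1, h2, h3, h4, h5, h6, h7, h8, h9⟩ := key (l 0) (l 1) (l 2) (hl.lt _) (hl.lt _) (hl.lt _)
  have l3 : l 3 = l 0 := hl.per 0
  have l4 : l 4 = l 1 := hl.per 1
  let f : ℕ → Fin 5 := fun i => if i % 3 = 0 then x else if i % 3 = 1 then y else z
  refine SeqCol.of_fun (f := f) (by norm_num) hl.per (by simp [f]) (by simp [f]) ?_ ?_
  · intro j hj
    unfold properAt
    interval_cases j
    · simp [f]; exact ⟨h1, h5, h6⟩
    · simp [f]; exact ⟨h2, h7, h8⟩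
    · simp [f, l3]; exact ⟨h3, h9, h4⟩
  · unfold seqCost
    have a1 := card_filter_le (range 3) (fun j => mixedAt f j)
    have a2 := card_filter_le (range 3) (fun j => ¬ normAt l f j)
    simp only [card_range] at a1 a2
    omega

theorem good_big {n : ℕ} {t : ℕ → Bool} {g : ℕ → Fin 5} (ht : CS n t)
    (hg : LS n g) (geq : ∀ j, t j = true → g j = g (j+1)) (hb : n % 2 = 0 ∨ 5 ≤ cnt t 0 n) :
    SeqCol n g (cnt t 0 n) := by
  rcases Nat.mod_two_eq_zero_or_one n with he | ho
  · have := uneq_le_dist ht hg hg geq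
    refine (even_bound ht hg he).mono ?_
    have hd : distL n g g = 0 := by simp [distL]
    omega
  · obtain ⟨p, q, r, hp, hr⟩ := exists_crun ht hg geq ho
    exact hr.good ht hg geq hp (by omega)

theorem cnt_half {n : ℕ} {t : ℕ → Bool} (ht : CS n t) (a k : ℕ) : k ≤ cnt t a (a + 2 * k) := by
  induction k with
  | zero => omega
  | succ k ih =>
    rw [show a + 2 * (k+1) = a + 2 * k + 1 + 1 by omega, cnt_succ t (by omega), cnt_succ t (by omega)]
    have : 1 ≤ e0 t (a + 2*k) + e0 t (a+2*k+1) := by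
      unfold e0
      by_cases h : t (a + 2*k) = true
      · rw [ht.nc _ h]; simp
      · simp [h]
    omega

theorem cnt_odd {n : ℕ} {t : ℕ → Bool} (ht : CS n t) (ho : n % 2 = 1) : n + 1 ≤ 2 * cnt t 0 n := by
  obtain ⟨k, rfl⟩ : ∃ k, n = 2 * k + 1 := ⟨n / 2, by omega⟩
  by_cases h : t 0 = true
  · have h1 : t (2 * k) = false := by
      by_contra hc
      have := ht.nc _ (by simpa using hc)
      rw [show 2 * k + 1 = 0 + (2 * k + 1) by omega, ht.per, h] at this; simp at this
    rw [cnt_succ t (by omega)]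
    have := cnt_half ht 0 k
    rw [zero_add] at this
    simp [e0, h1]; omega
  · rw [cnt_bot t (by omega)]
    have := cnt_half ht 1 k
    rw [add_comm 1] at this
    simp [e0, h]; omega

def updL (n : ℕ) (g : ℕ → Fin 5) (w : ℕ) (c : Fin 5) (i : ℕ) : Fin 5 := if i % n = w % n then c else g i

theorem updL_LS {n : ℕ} {g : ℕ → Fin 5} (hg : LS n g) {c : Fin 5} (hc : c < 3) (w : ℕ) :
    LS n (updL n g w c) := by
  constructor
  · intro j; unfold updL; rw [Nat.add_mod_right, hg.per]
  · intro j; unfold updL; split_ifs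
    · exact hc
    · exact hg.lt _

/-- vertex `j` is between two `E₀` edges -/
def isVp (n : ℕ) (t : ℕ → Bool) (j : ℕ) : Prop := t j = false ∧ t (j + n - 1) = false

theorem updL_eq {n : ℕ} {t : ℕ → Bool} {g : ℕ → Fin 5} (ht : CS n t) 
    (geq : ∀ j, t j = true → g j = g (j+1)) {w : ℕ} (hw : isVp n t w) (c : Fin 5) :
    ∀ j, t j = true → updL n g w c j = updL n g w c (j+1) := by
  intro j hj
  have h3 := ht.n3
  have h1 : ¬ j % n = w % n := by
    intro h
    have := per_mod ht.per j
    rw [h, per_mod ht.per, hw.1, hj] at this; simp at this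
  have h2 : ¬ (j + 1) % n = w % n := by
    intro h
    have e : j % n = (w + n - 1) % n := by
      have : (j + 1 + (n - 1)) % n = (w + (n-1)) % n := Nat.ModEq.add_right (n-1) h
      rw [show j + 1 + (n - 1) = j + n by omega, Nat.add_mod_right, ← Nat.add_sub_assoc (by omega)] at this
      exact this
    have := per_mod ht.per j
    rw [e, per_mod ht.per, hw.2, hj] at this; simp at this
  simp [updL, h1, h2, geq j hj]


theorem srch_two {n B : ℕ} (hn : 2 ≤ n) {g : ℕ → Fin 5} (hg : LS n g) {m : Fin 5 → ℕ → Fin 5}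
    (hm : ∀ c, m c = updL n g 0 c)
    (h : (two3 fun d => srchF n (m d) B) = true) {c1 c2 : Fin 5} (h1 : c1 < 3) (h2 : c2 < 3)
    (hne : c1 ≠ c2) : SeqCol n (updL n g 0 c1) B ∨ SeqCol n (updL n g 0 c2) B := by
  rcases two3_spec h h1 h2 hne with h | h
  · left; rw [hm] at h; exact srchF_sound hn (updL_LS hg h1 0).per h
  · right; rw [hm] at h; exact srchF_sound hn (updL_LS hg h2 0).per h

theorem lab3 {g : ℕ → Fin 5} (hg : LS 3 g) (c : Fin 5) : labF [c, g 1, g 2] = updL 3 g 0 c := by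
  funext j
  have h := Nat.mod_lt j (show 0 < 3 by norm_num)
  have e := per_mod hg.per j
  unfold labF updL
  simp only [List.length_cons, List.length_nil]
  rw [← e]
  generalize j % 3 = k at *
  interval_cases k <;> simp

theorem lab5 {g : ℕ → Fin 5} (hg : LS 5 g) (c : Fin 5) :
    labF [c, g 1, g 2, g 3, g 4] = updL 5 g 0 c := by
  funext j
  have h := Nat.mod_lt j (show 0 < 5 by norm_num)
  have e := per_mod hg.per j
  unfold labF updL
  simp only [List.length_cons, List.length_nil]
  rw [← e]
  generalize j % 5 = k at *
  interval_cases k <;> simp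

theorem lab7 {g : ℕ → Fin 5} (hg : LS 7 g) (c : Fin 5) :
    labF [c, g 1, g 2, g 3, g 4, g 5, g 6] = updL 7 g 0 c := by
  funext j
  have h := Nat.mod_lt j (show 0 < 7 by norm_num)
  have e := per_mod hg.per j
  unfold labF updL
  simp only [List.length_cons, List.length_nil]
  rw [← e]
  generalize j % 7 = k at *
  interval_cases k <;> simp

theorem lemH0 {n : ℕ} {t : ℕ → Bool} {g : ℕ → Fin 5} (ht : CS n t)
    (hg : LS n g) (geq : ∀ j, t j = true → g j = g (j+1)) (ho : n % 2 = 1) (h3 : 3 ≤ cnt t 0 n)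
    (h4 : cnt t 0 n ≤ 4) (hw : isVp n t 0) {c1 c2 : Fin 5} (h1 : c1 < 3) (h2 : c2 < 3)
    (hne : c1 ≠ c2) :
    SeqCol n (updL n g 0 c1) (cnt t 0 n) ∨ SeqCol n (updL n g 0 c2) (cnt t 0 n) := by
  have h5 := cnt_odd ht ho
  have n3 := ht.n3
  have hn : n = 3 ∨ n = 5 ∨ n = 7 := by omega
  obtain ⟨w1, w2⟩ := hw
  rcases hn with rfl | rfl | rfl
  · have e : cnt t 0 3 = 3 := by
      have : cnt t 0 3 ≤ 3 := by rw [cnt_range]; exact (card_filter_le _ _).trans (by simp)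
      omega
    rw [e]
    exact srch_two (by norm_num) hg (lab3 hg)
      (allL_spec (allL_spec small3 (hg.lt 1)) (hg.lt 2)) h1 h2 hne
  · norm_num at w2
    have a1 := geq 1
    have a2 := geq 2
    have a3 := geq 3
    have b1 := ht.nc 1
    have b2 := ht.nc 2
    norm_num at a1 a2 a3 b1 b2
    have e : cnt t 0 5 = 2 + e0 t 1 + e0 t 2 + e0 t 3 := by
      rw [cnt, ← range_eq_Ico]; simp [sum_range_succ, e0, w1, w2]; omega
    unfold e0 at e
    have s1 := allL_spec (allL_spec (allL_spec small51 (hg.lt 2)) (hg.lt 3)) (hg.lt 4)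
    have s2 := allL_spec (allL_spec (allL_spec small52 (hg.lt 1)) (hg.lt 3)) (hg.lt 4)
    have s3 := allL_spec (allL_spec (allL_spec small53 (hg.lt 1)) (hg.lt 2)) (hg.lt 4)
    have s4 := allL_spec (allL_spec small54 (hg.lt 2)) (hg.lt 4)
    have key : (two3 fun d => srchF 5 (labF [d, g 1, g 2, g 3, g 4]) (cnt t 0 5)) = true := by
      cases t1 : t 1 <;> cases t2 : t 2 <;> cases t3 : t 3 <;> simp [t1, t2, t3] at a1 a2 a3 b1 b2 e
      · omega
      · rw [a3, e]; exact s3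
      · rw [a2, e]; exact s2
      · rw [a1, e]; exact s1
      · rw [a1, a3, e]; exact s4
    exact srch_two (by norm_num) hg (lab5 hg) key h1 h2 hne
  · norm_num at w2
    have a1 := geq 1
    have a3 := geq 3
    have a5 := geq 5
    have b1 := ht.nc 1
    have b2 := ht.nc 2
    have b3 := ht.nc 3
    have b4 := ht.nc 4
    norm_num at a1 a3 a5 b1 b2 b3 b4
    have e : cnt t 0 7 = 2 + e0 t 1 + e0 t 2 + e0 t 3 + e0 t 4 + e0 t 5 := by
      rw [cnt, ← range_eq_Ico]; simp [sum_range_succ, e0, w1, w2]; omega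
    unfold e0 at e
    have s := allL_spec (allL_spec (allL_spec small7 (hg.lt 2)) (hg.lt 4)) (hg.lt 6)
    have key : (two3 fun d => srchF 7 (labF [d, g 1, g 2, g 3, g 4, g 5, g 6]) (cnt t 0 7)) = true := by
      have f4 : cnt t 0 7 = 4 := by omega
      have f1 : t 1 = true ∧ t 3 = true ∧ t 5 = true := by
        cases t1 : t 1 <;> cases t2 : t 2 <;> cases t3 : t 3 <;> cases t4 : t 4 <;> cases t5 : t 5 <;>
          simp [t1, t2, t3, t4, t5] at b1 b2 b3 b4 e <;> first | omega | simp
      rw [f4, a1 f1.1, a3 f1.2.1, a5 f1.2.2]; exact s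
    exact srch_two (by norm_num) hg (lab7 hg) key h1 h2 hne

/-- Lemma H. -/
theorem lemH {n : ℕ} {t : ℕ → Bool} {g : ℕ → Fin 5} (ht : CS n t)
    (hg : LS n g) (geq : ∀ j, t j = true → g j = g (j+1)) (h3 : n % 2 = 1 → 3 ≤ cnt t 0 n)
    {w : ℕ} (hw : isVp n t w) {c1 c2 : Fin 5} (h1 : c1 < 3) (h2 : c2 < 3)
    (hne : c1 ≠ c2) :
    SeqCol n (updL n g w c1) (cnt t 0 n) ∨ SeqCol n (updL n g w c2) (cnt t 0 n) := by
  have n3 := ht.n3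
  by_cases hb : n % 2 = 0 ∨ 5 ≤ cnt t 0 n
  · left; exact good_big ht (updL_LS hg h1 w) (updL_eq ht geq hw c1) hb
  · push Not at hb
    have ho : n % 2 = 1 := by omega
    have hw' : isVp n (fun j => t (j + w)) 0 := by
      refine ⟨by simpa using hw.1, ?_⟩
      show t (0 + n - 1 + w) = false
      rw [show 0 + n - 1 + w = w + n - 1 by omega]; exact hw.2
    have := lemH0 (ht.shift w) (hg.shift w)
      (by intro j hj; show g (j + w) = g (j + 1 + w); rw [show j + 1 + w = j + w + 1 by omega]; exact geq _ hj)
      ho (by rw [ht.cnt_shift]; exact h3 ho) (by rw [ht.cnt_shift]; omega) hw' h1 h2 hne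
    rw [ht.cnt_shift] at this
    have e : ∀ c, updL n (fun j => g (j + w)) 0 c = fun j => updL n g w c (j + w) := by
      intro c; funext j
      unfold updL
      have : (j % n = 0 % n) ↔ ((j + w) % n = w % n) := by
        constructor
        · intro h
          have : (j + w) % n = (0 + w) % n := Nat.ModEq.add_right w h
          simpa using this
        · intro h
          have : j + w ≡ 0 + w [MOD n] := by rw [zero_add]; exact h
          exact Nat.ModEq.add_right_cancel' w this
      simp only [this]
    rw [e, e] at this
    rcases this with h | h
    · left; exact SeqCol.rot (by omega) (updL_LS hg h1 w).per h
    · right; exact SeqCol.rot (by omega) (updL_LS hg h2 w).per h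

/-- central `V` position in a bad cycle -/
theorem centralV {n : ℕ} {t : ℕ → Bool} (ht : CS n t) (ho : n % 2 = 1) (h3 : 3 ≤ cnt t 0 n)
    (h4 : cnt t 0 n ≤ 4) : ∃ w < n, isVp n t w ∧ ∀ j < n, isVp n t j →
      j = w ∨ (j + 1) % n = w ∨ j = (w + 1) % n := by
  have h5 := cnt_odd ht ho
  have n3 := ht.n3
  have hn : n = 3 ∨ n = 5 ∨ n = 7 := by omega
  unfold isVp
  have tm : ∀ j, t (j + n - 1) = t ((j + n - 1) % n) := fun j => (per_mod ht.per _).symm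
  simp only [tm]
  have nc : ∀ j < n, t j = true → t ((j+1) % n) = false := fun j _ h => by
    rw [per_mod ht.per]; exact ht.nc j h
  clear tm
  rw [cnt_range] at h3 h4
  rcases hn with rfl | rfl | rfl
  · refine ⟨0, by norm_num, ?_, ?_⟩
    · have e := (filter_card_eq (s := range 3) (p := fun i => t i = false) (by 
        refine le_antisymm (card_filter_le _ _) (by simpa using h3)))
      exact ⟨e 0 (by simp), e _ (by simp)⟩
    · intro j hj _; interval_cases j <;> simp
  · have key : ∀ b : Fin 5 → Bool, (∀ j : Fin 5, b j = true → b (j+1) = false) →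
        (univ.filter (fun j => b j = false)).card ≤ 4 →
        ∃ w : Fin 5, (b w = false ∧ b (w + 4) = false) ∧
          ∀ j : Fin 5, b j = false ∧ b (j + 4) = false → j = w ∨ j + 1 = w ∨ j = w + 1 := by decide +kernel
    obtain ⟨w, hw, hj⟩ := key (fun j => t j.1) (fun j h => by 
        have := nc j.1 j.2 h; rw [Fin.val_add]; exact this) (by
        refine le_trans (le_of_eq ?_) h4
        refine card_bij (fun j _ => j.1) (by simp) (by intro a _ b _ h; exact Fin.ext h) ?_
        intro b hb; simp only [mem_filter, mem_range] at hb
        exact ⟨⟨b, hb.1⟩, by simpa using hb.2, rfl⟩)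
    refine ⟨w.1, w.2, ⟨hw.1, by have := hw.2; rw [Fin.val_add] at this; exact this⟩, ?_⟩
    intro j hj5 hjj
    rcases hj ⟨j, hj5⟩ ⟨hjj.1, by rw [Fin.val_add]; exact hjj.2⟩ with h | h | h
    · left; rw [← h]
    · right; left; rw [← h, Fin.val_add]; rfl
    · right; right; have := congrArg Fin.val h; rw [Fin.val_add] at this; exact this
  · have key : ∀ b : Fin 7 → Bool, (∀ j : Fin 7, b j = true → b (j+1) = false) →
        (univ.filter (fun j => b j = false)).card ≤ 4 →
        ∃ w : Fin 7, (b w = false ∧ b (w + 6) = false) ∧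
          ∀ j : Fin 7, b j = false ∧ b (j + 6) = false → j = w ∨ j + 1 = w ∨ j = w + 1 := by decide +kernel
    obtain ⟨w, hw, hj⟩ := key (fun j => t j.1) (fun j h => by 
        have := nc j.1 j.2 h; rw [Fin.val_add]; exact this) (by
        refine le_trans (le_of_eq ?_) h4
        refine card_bij (fun j _ => j.1) (by simp) (by intro a _ b _ h; exact Fin.ext h) ?_
        intro b hb; simp only [mem_filter, mem_range] at hb
        exact ⟨⟨b, hb.1⟩, by simpa using hb.2, rfl⟩)
    refine ⟨w.1, w.2, ⟨hw.1, by have := hw.2; rw [Fin.val_add] at this; exact this⟩, ?_⟩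
    intro j hj5 hjj
    rcases hj ⟨j, hj5⟩ ⟨hjj.1, by rw [Fin.val_add]; exact hjj.2⟩ with h | h | h
    · left; rw [← h]
    · right; left; rw [← h, Fin.val_add]; rfl
    · right; right; have := congrArg Fin.val h; rw [Fin.val_add] at this; exact this


/-! ### The theorem of Petersen -/

section Petersen
variable {V : Type*} [Fintype V] [DecidableEq V] (G : SimpleGraph V) [DecidableRel G.Adj]

theorem bd_ge3 (hcubic : ∀ v : V, G.degree v = 3)
    (hb : ∀ e ∈ G.edgeSet, ¬ G.IsBridge e) (S : Finset V) (hS : Odd S.card) :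
    3 ≤ ((univ : Finset (V × V)).filter (fun p => p.1 ∈ S ∧ p.2 ∉ S ∧ G.Adj p.1 p.2)).card := by
  set B := (univ : Finset (V × V)).filter (fun p => p.1 ∈ S ∧ p.2 ∉ S ∧ G.Adj p.1 p.2) with hB
  set I := (univ : Finset (V × V)).filter (fun p => p.1 ∈ S ∧ p.2 ∈ S ∧ G.Adj p.1 p.2) with hI
  have hIe : (I.card : ZMod 2) = 0 := by
    rw [card_eq_sum_ones, Nat.cast_sum]
    refine sum_involution (fun p _ => (p.2, p.1)) ?_ ?_ ?_ ?_
    · intro p _; decide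
    · intro p hp _ h
      simp only [hI, mem_filter] at hp
      have := congrArg Prod.fst h
      simp only at this
      exact hp.2.2.2.ne this.symm
    · intro p hp
      simp only [hI, mem_filter, mem_univ, true_and] at hp ⊢
      exact ⟨hp.2.1, hp.1, hp.2.2.symm⟩
    · intro p _; rfl
  have hA : I.card + B.card = 3 * S.card := by
    rw [← card_union_of_disjoint]
    · have : I ∪ B = (S.sigma (fun v => G.neighborFinset v)).image (fun p => (p.1, p.2)) := by
        ext ⟨a, b⟩
        simp only [hI, hB, mem_union, mem_filter, mem_univ, true_and, mem_image, mem_sigma,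
          SimpleGraph.mem_neighborFinset, Prod.mk.injEq]
        constructor
        · rintro (h | h)
          · exact ⟨⟨a, b⟩, ⟨h.1, h.2.2⟩, rfl, rfl⟩
          · exact ⟨⟨a, b⟩, ⟨h.1, h.2.2⟩, rfl, rfl⟩
        · rintro ⟨⟨x, y⟩, h, rfl, rfl⟩
          by_cases hy : y ∈ S
          · exact Or.inl ⟨h.1, hy, h.2⟩
          · exact Or.inr ⟨h.1, hy, h.2⟩
      rw [this, card_image_of_injective, card_sigma]
      · simp [hcubic, mul_comm]
      · rintro ⟨x, y⟩ ⟨z, w⟩ h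
        simp only [Prod.mk.injEq] at h
        obtain ⟨rfl, rfl⟩ := h; rfl
    · rw [disjoint_left]
      intro p h1 h2
      simp only [hI, hB, mem_filter] at h1 h2
      exact h2.2.2.1 h1.2.2.1
  have hI2 : Even I.card := by
    rw [ZMod.natCast_eq_zero_iff_even] at hIe; exact hIe
  have hBo : B.card % 2 = 1 := by
    obtain ⟨k, hk⟩ := hS
    obtain ⟨m, hm⟩ := hI2
    omega
  have h1 : B.card ≠ 1 := by
    intro h1
    obtain ⟨⟨v, w⟩, hp⟩ := card_eq_one.mp h1
    have hmem : (v, w) ∈ B := by rw [hp]; simp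
    simp only [hB, mem_filter, mem_univ, true_and] at hmem
    obtain ⟨hv, hw, hadj⟩ := hmem
    have := hb s(v, w) hadj
    rw [SimpleGraph.isBridge_iff, not_not] at this
    obtain ⟨p⟩ := this
    obtain ⟨d, hd, d1, d2⟩ := p.exists_boundary_dart (S : Set V) hv hw
    have hda := d.adj
    rw [SimpleGraph.deleteEdges_adj] at hda
    have : (d.fst, d.snd) ∈ B := by
      simp only [hB, mem_filter, mem_univ, true_and]
      exact ⟨d1, d2, hda.1⟩
    rw [hp, mem_singleton, Prod.mk.injEq] at this
    apply hda.2
    simp [this.1, this.2]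
  omega

theorem petersen (hcubic : ∀ v : V, G.degree v = 3)
    (hb : ∀ e ∈ G.edgeSet, ¬ G.IsBridge e) : ∃ M : G.Subgraph, M.IsPerfectMatching := by
  classical
  rw [SimpleGraph.tutte]
  intro u hu
  unfold SimpleGraph.IsTutteViolator at hu
  set H := ((⊤ : G.Subgraph).deleteVerts u).coe with hH
  -- vertex sets
  let S : H.ConnectedComponent → Finset V := fun K => (Set.toFinite ((fun x => x.1) '' K.supp)).toFinset
  have memS : ∀ K v, v ∈ S K ↔ ∃ h : v ∈ ((⊤ : G.Subgraph).deleteVerts u).verts,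
      H.connectedComponentMk ⟨v, h⟩ = K := by
    intro K v
    simp [S]
  have vmem : ∀ v, v ∈ ((⊤ : G.Subgraph).deleteVerts u).verts ↔ v ∉ u := by
    intro v; simp
  have cardS : ∀ K, (S K).card = K.supp.ncard := by
    intro K
    rw [← Set.ncard_image_of_injective K.supp Subtype.val_injective, Set.ncard_eq_toFinset_card]
  let O : Finset H.ConnectedComponent := (Set.toFinite H.oddComponents).toFinset
  have hO : O.card = H.oddComponents.ncard := by rw [Set.ncard_eq_toFinset_card]
  let U : Finset V := (Set.toFinite u).toFinset
  have hU : U.card = u.ncard := by rw [Set.ncard_eq_toFinset_card]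
  have memU : ∀ v, v ∈ U ↔ v ∈ u := by intro v; simp [U]
  let Bd : H.ConnectedComponent → Finset (V × V) := fun K =>
    (univ : Finset (V × V)).filter (fun p => p.1 ∈ S K ∧ p.2 ∉ S K ∧ G.Adj p.1 p.2)
  have h3 : ∀ K ∈ O, 3 ≤ (Bd K).card := by
    intro K hK
    apply bd_ge3 G hcubic hb
    rw [cardS]
    simpa [O] using hK
  have hdis : ∀ K ∈ O, ∀ K' ∈ O, K ≠ K' → Disjoint (Bd K) (Bd K') := by
    intro K _ K' _ hne
    rw [disjoint_left]
    intro p h1 h2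
    simp only [Bd, mem_filter, memS] at h1 h2
    obtain ⟨_, ⟨_, a⟩, _⟩ := h1
    obtain ⟨_, ⟨_, b⟩, _⟩ := h2
    exact hne (a.symm.trans b)
  have hsub : O.biUnion Bd ⊆ (U.sigma (fun v => G.neighborFinset v)).image (fun p => (p.2, p.1)) := by
    intro p hp
    rw [mem_biUnion] at hp
    obtain ⟨K, _, hp⟩ := hp
    simp only [Bd, mem_filter, mem_univ, true_and] at hp
    obtain ⟨a, b, c⟩ := hp
    rw [mem_image]
    refine ⟨⟨p.2, p.1⟩, ?_, rfl⟩
    simp only [mem_sigma, SimpleGraph.mem_neighborFinset]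
    refine ⟨?_, c.symm⟩
    rw [memU]
    by_contra hu2
    apply b
    rw [memS] at a ⊢
    obtain ⟨ha, hK⟩ := a
    refine ⟨(vmem _).2 hu2, ?_⟩
    rw [← hK]
    apply SimpleGraph.ConnectedComponent.sound
    apply SimpleGraph.Adj.reachable
    have ha' := (vmem _).1 ha
    rw [hH, SimpleGraph.Subgraph.coe_adj, SimpleGraph.Subgraph.deleteVerts_adj]
    simp [ha', hu2, c.symm]
  have e1 := card_le_card hsub
  rw [card_biUnion hdis] at e1
  have e2 := card_image_le (s := U.sigma (fun v => G.neighborFinset v)) (f := fun p => (p.2, p.1))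
  have e3 : (U.sigma (fun v => G.neighborFinset v)).card = 3 * U.card := by
    rw [card_sigma]; simp [hcubic, mul_comm]
  have e4 := sum_le_sum h3
  rw [sum_const, smul_eq_mul] at e4
  omega

end Petersen


section Kempe
open scoped Classical

theorem path_end {V : Type*} [Fintype V] (K : SimpleGraph V) (hd : ∀ v, K.degree v ≤ 2) (x : V)
    (hx : K.degree x = 1) : ∃ z, z ≠ x ∧ K.Reachable x z ∧ K.degree z = 1 ∧
      ∀ u, K.Reachable x u → u ≠ x → u ≠ z → K.degree u = 2 := by
  set C := K.connectedComponentMk x with hC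
  set H := C.toSimpleGraph with hH
  have hdeg : ∀ u : C, H.degree u = K.degree u.1 := by
    intro u
    rw [← SimpleGraph.card_neighborFinset_eq_degree, ← SimpleGraph.card_neighborFinset_eq_degree]
    refine Finset.card_bij (fun a _ => a.1) ?_ ?_ ?_
    · intro a ha
      rw [SimpleGraph.mem_neighborFinset] at ha ⊢
      exact ha
    · intro a _ b _ h; exact Subtype.ext h
    · intro b hb
      rw [SimpleGraph.mem_neighborFinset] at hb
      refine ⟨⟨b, C.mem_supp_of_adj_mem_supp u.2 hb⟩, ?_, rfl⟩
      rw [SimpleGraph.mem_neighborFinset]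
      exact hb
  have hmem : ∀ u, K.Reachable x u → u ∈ C.supp := by
    intro u hu
    rw [SimpleGraph.ConnectedComponent.mem_supp_iff, hC, SimpleGraph.ConnectedComponent.eq]
    exact hu.symm
  let x' : C := ⟨x, hmem x (SimpleGraph.Reachable.refl x)⟩
  have hre : ∀ u : C, K.Reachable x u.1 := by
    intro u
    have := u.2
    have h2 := (SimpleGraph.ConnectedComponent.mem_supp_iff C u.1).1 this
    exact (SimpleGraph.ConnectedComponent.exact (h2 : K.connectedComponentMk u.1 = K.connectedComponentMk x)).symm
  obtain ⟨z, hzx, hzo⟩ := H.exists_ne_odd_degree_of_exists_odd_degree x' (by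
    rw [hdeg]; change Odd (K.degree x); rw [hx]; decide)
  have hz1 : K.degree z.1 = 1 := by
    rw [hdeg] at hzo
    have := hd z.1
    rcases hzo with ⟨k, hk⟩; omega
  refine ⟨z.1, fun h => hzx (Subtype.ext h), hre z, hz1, ?_⟩
  intro u hu hux huz
  by_contra hne
  have hconn : H.Connected := C.connected_toSimpleGraph
  have h1 := hconn.card_vert_le_card_edgeSet_add_one
  have h2 := H.sum_degrees_eq_twice_card_edges
  let u' : C := ⟨u, hmem u hu⟩
  have hle : K.degree u ≤ 1 := by have := hd u; omega
  have h3 : ∑ v : C, H.degree v + 3 ≤ 2 * Fintype.card C := by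
    have h4 : ∀ v : C, H.degree v + (if v = x' ∨ v = z ∨ v = u' then 1 else 0) ≤ 2 := by
      intro v
      rw [hdeg]
      split_ifs with h
      · rcases h with rfl | rfl | rfl
        · change K.degree x + 1 ≤ 2; omega
        · omega
        · change K.degree u + 1 ≤ 2; omega
      · exact hd v.1
    have h5 := Finset.sum_le_sum (s := univ) (fun v _ => h4 v)
    rw [Finset.sum_add_distrib] at h5
    simp only [Finset.sum_const, Finset.card_univ, smul_eq_mul] at h5
    have h6 : ∑ v : C, (if v = x' ∨ v = z ∨ v = u' then 1 else 0) = 3 := by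
      rw [← Finset.card_filter]
      have : (univ.filter fun v : C => v = x' ∨ v = z ∨ v = u') = {x', z, u'} := by
        ext v; simp
      rw [this, Finset.card_eq_three]
      refine ⟨x', z, u', fun h => hzx h.symm, fun h => hux (congrArg Subtype.val h).symm, fun h => huz (congrArg Subtype.val h).symm, rfl⟩
    omega
  have h7 : Nat.card C = Fintype.card C := Nat.card_eq_fintype_card
  have h8 : Nat.card H.edgeSet = H.edgeFinset.card := by
    rw [Nat.card_eq_fintype_card, ← SimpleGraph.edgeFinset_card]
  rw [h7, h8] at h1
  omega

def kempeG {V : Type*} (G : SimpleGraph V) (φ : Sym2 V → Fin 5) (a a' : Fin 5) : SimpleGraph V where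
  Adj u w := G.Adj u w ∧ (φ s(u,w) = a ∨ φ s(u,w) = a')
  symm := ⟨by intro u w h; rw [Sym2.eq_swap]; exact ⟨h.1.symm, h.2⟩⟩
  loopless := ⟨by intro u h; exact G.loopless.irrefl u h.1⟩

theorem kempe {V : Type*} [Fintype V] (G : SimpleGraph V) (φ : Sym2 V → Fin 5) (a a' : Fin 5)
    (hlow : ∀ v w w', G.Adj v w → G.Adj v w' → w ≠ w' → (φ s(v,w) = a ∨ φ s(v,w) = a') → φ s(v,w) ≠ φ s(v,w'))
    (x m : V) (hxm : G.Adj x m) (ham : φ s(x,m) = a ∨ φ s(x,m) = a')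
    (hx : ∀ w, G.Adj x w → w ≠ m → ¬ (φ s(x,w) = a ∨ φ s(x,w) = a')) :
    ∃ (K : Set V) (z : V), x ∈ K ∧ z ∈ K ∧ z ≠ x ∧
      (∀ u ∈ K, ∀ w, G.Adj u w → (φ s(u,w) = a ∨ φ s(u,w) = a') → w ∈ K) ∧
      (∀ u ∈ K, u ≠ x → u ≠ z → ∃ p q, p ≠ q ∧ G.Adj u p ∧ G.Adj u q ∧ φ s(u,p) = a ∧ φ s(u,q) = a') ∧
      (∃ p, G.Adj z p ∧ (φ s(z,p) = a ∨ φ s(z,p) = a') ∧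
        ∀ w, G.Adj z w → w ≠ p → ¬ (φ s(z,w) = a ∨ φ s(z,w) = a')) ∧
      (∀ T : Set V, x ∈ T → (∀ u ∈ T, ∀ w, G.Adj u w → (φ s(u,w) = a ∨ φ s(u,w) = a') → w ∈ T) → K ⊆ T) := by
  obtain ⟨Kg, hKg⟩ : ∃ Kg : SimpleGraph V, ∀ u w, Kg.Adj u w ↔ G.Adj u w ∧ (φ s(u,w) = a ∨ φ s(u,w) = a') :=
    ⟨kempeG G φ a a', fun u w => Iff.rfl⟩
  have hd : ∀ v, Kg.degree v ≤ 2 := by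
    intro v
    rw [← SimpleGraph.card_neighborFinset_eq_degree]
    have : ((Kg.neighborFinset v).image (fun w => φ s(v,w))).card ≤ 2 := by
      refine (Finset.card_le_card (t := {a, a'}) ?_).trans Finset.card_le_two
      intro c hc
      simp only [Finset.mem_image, SimpleGraph.mem_neighborFinset, hKg] at hc
      obtain ⟨w, hw, rfl⟩ := hc
      simpa using hw.2
    rwa [Finset.card_image_of_injOn] at this
    intro w hw w' hw' h
    simp only [Finset.mem_coe, SimpleGraph.mem_neighborFinset, hKg] at hw hw'
    by_contra hne
    exact hlow v w w' hw.1 hw'.1 hne hw.2 h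
  have hx1 : Kg.degree x = 1 := by
    rw [← SimpleGraph.card_neighborFinset_eq_degree, Finset.card_eq_one]
    refine ⟨m, ?_⟩
    ext w
    simp only [SimpleGraph.mem_neighborFinset, hKg, Finset.mem_singleton]
    constructor
    · intro h; by_contra hne; exact hx w h.1 hne h.2
    · rintro rfl; exact ⟨hxm, ham⟩
  obtain ⟨z, hzx, hzr, hz1, hall⟩ := path_end Kg hd x hx1
  refine ⟨{u | Kg.Reachable x u}, z, SimpleGraph.Reachable.refl x, hzr, hzx, ?_, ?_, ?_, ?_⟩
  · intro u hu w hw hc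
    have : Kg.Adj u w := (hKg u w).2 ⟨hw, hc⟩
    exact hu.trans this.reachable
  · intro u hu hux huz
    have := hall u hu hux huz
    rw [← SimpleGraph.card_neighborFinset_eq_degree, Finset.card_eq_two] at this
    obtain ⟨p, q, hpq, hN⟩ := this
    have hp : Kg.Adj u p := by rw [← SimpleGraph.mem_neighborFinset, hN]; simp
    have hq : Kg.Adj u q := by rw [← SimpleGraph.mem_neighborFinset, hN]; simp
    rw [hKg] at hp hq
    have hne := hlow u p q hp.1 hq.1 hpq hp.2
    rcases hp.2 with h1 | h1 <;> rcases hq.2 with h2 | h2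
    · exact absurd (h1.trans h2.symm) hne
    · exact ⟨p, q, hpq, hp.1, hq.1, h1, h2⟩
    · exact ⟨q, p, hpq.symm, hq.1, hp.1, h2, h1⟩
    · exact absurd (h1.trans h2.symm) hne
  · rw [← SimpleGraph.card_neighborFinset_eq_degree, Finset.card_eq_one] at hz1
    obtain ⟨p, hp⟩ := hz1
    have h1 : Kg.Adj z p := by rw [← SimpleGraph.mem_neighborFinset, hp]; simp
    rw [hKg] at h1
    refine ⟨p, h1.1, h1.2, ?_⟩
    intro w hw hne hc
    have : w ∈ Kg.neighborFinset z := by rw [SimpleGraph.mem_neighborFinset, hKg]; exact ⟨hw, hc⟩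
    rw [hp] at this
    exact hne (by simpa using this)
  · intro T hxT hT u hu
    obtain ⟨p⟩ := hu
    have key : ∀ u v, Kg.Walk u v → u ∈ T → v ∈ T := by
      intro u v p
      induction p with
      | nil => exact id
      | cons h p ih => intro hu; rw [hKg] at h; exact ih (hT _ hu _ h.1 h.2)
    exact key _ _ p hxT

end Kempe


section SysSec
open scoped Classical

/-- A cubic graph with a distinguished family of disjoint cycles (the orbits of `σ`). -/
structure Sys (V : Type*) where
  G : SimpleGraph V
  σ : Equiv.Perm V
  t : V → Bool
  mt : V → V
  σσ : ∀ v, σ v ≠ v → σ (σ v) ≠ v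
  nb : ∀ v, σ v ≠ v → ∀ w, G.Adj v w ↔ (w = σ v ∨ w = σ.symm v ∨ w = mt v)
  mne : ∀ v, σ v ≠ v → mt v ≠ σ v ∧ mt v ≠ σ.symm v
  deg : ∀ v, ∃ p q r, p ≠ q ∧ p ≠ r ∧ q ≠ r ∧ ∀ w, G.Adj v w ↔ (w = p ∨ w = q ∨ w = r)
  tc : ∀ v, t v = true → σ v ≠ v
  tt : ∀ v, t v = true → t (σ v) = false
  Vm : ∀ v, σ v ≠ v → t v = false → t (σ.symm v) = false →
    σ (mt v) ≠ mt v ∧ t (mt v) = false ∧ t (σ.symm (mt v)) = false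

namespace Sys
variable {V : Type*} (S : Sys V)

def core (v : V) : Prop := S.σ v ≠ v
def Vv (v : V) : Prop := S.core v ∧ S.t v = false ∧ S.t (S.σ.symm v) = false
def isT (v : V) : Prop := S.Vv v ∧ S.σ (S.σ (S.σ v)) = v ∧ S.t (S.σ v) = true
def tri (v u : V) : Prop := u = v ∨ u = S.σ v ∨ u = S.σ.symm v
def nT (v : V) : Prop := S.core v ∧ ∀ u, S.isT u → ¬ S.tri u v
def pend (P : Finset V) (v : V) : Prop := S.core v ∧ ∀ u, S.isT u → S.tri u v → u ∈ P
def trk (P : Finset V) (v : V) : Prop := ∀ u ∈ P, ¬ S.tri u v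

theorem core_σ {v : V} (h : S.core v) : S.core (S.σ v) := fun h' => h (S.σ.injective h')
theorem core_symm {v : V} (h : S.core v) : S.core (S.σ.symm v) := fun h' => h (by
  have := congrArg S.σ h'; simp only [Equiv.apply_symm_apply] at this; exact this)
theorem symm_ne {v : V} (h : S.core v) : S.σ.symm v ≠ v := fun h' => h (by
  have := congrArg S.σ h'; simp only [Equiv.apply_symm_apply] at this; exact this.symm)
theorem σ_ne_symm {v : V} (h : S.core v) : S.σ v ≠ S.σ.symm v := fun h' => S.σσ v h (by
  have := congrArg S.σ h'; simpa using this)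
theorem adj_σ {v : V} (h : S.core v) : S.G.Adj v (S.σ v) := (S.nb v h _).2 (Or.inl rfl)
theorem adj_symm {v : V} (h : S.core v) : S.G.Adj v (S.σ.symm v) := (S.nb v h _).2 (Or.inr (Or.inl rfl))
theorem adj_mt {v : V} (h : S.core v) : S.G.Adj v (S.mt v) := (S.nb v h _).2 (Or.inr (Or.inr rfl))
theorem mt_ne {v : V} (h : S.core v) : S.mt v ≠ v := (S.adj_mt h).ne'
theorem mt_mt {v : V} (h : S.core v) (h' : S.core (S.mt v)) : S.mt (S.mt v) = v := by
  rcases (S.nb _ h' v).1 (S.adj_mt h).symm with e | e | e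
  · exact absurd (by rw [Equiv.eq_symm_apply]; exact e.symm) (S.mne v h).2
  · exact absurd ((Equiv.eq_symm_apply _).1 e).symm (S.mne v h).1
  · exact e.symm
theorem Vv_mt {v : V} (h : S.Vv v) : S.Vv (S.mt v) := S.Vm v h.1 h.2.1 h.2.2
theorem Vv_mt_mt {v : V} (h : S.Vv v) : S.mt (S.mt v) = v := S.mt_mt h.1 (S.Vv_mt h).1
theorem isT_symm {v : V} (h : S.isT v) : S.σ.symm v = S.σ (S.σ v) := by
  rw [Equiv.symm_apply_eq]; exact h.2.1.symm
theorem isT_not {v u : V} (h : S.isT v) (h' : S.Vv u) (ht : S.tri v u) : u = v := by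
  rcases ht with rfl | rfl | rfl
  · rfl
  · exact absurd h'.2.1 (by rw [h.2.2]; simp)
  · have := h'.2.2
    rw [S.isT_symm h, Equiv.symm_apply_apply, h.2.2] at this; simp at this
theorem tri_symm {v u : V} (h : S.isT v) (ht : S.tri v u) : S.tri u v := by
  rcases ht with rfl | rfl | rfl
  · exact Or.inl rfl
  · right; right; simp
  · right; left; simp
theorem tri_σ {v u : V} (h : S.isT v) (ht : S.tri v u) : S.tri v (S.σ u) := by
  rcases ht with rfl | rfl | rfl
  · exact Or.inr (Or.inl rfl)
  · right; right; rw [S.isT_symm h]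
  · left; simp
theorem tri_σsymm {v u : V} (h : S.isT v) (ht : S.tri v u) : S.tri v (S.σ.symm u) := by
  rcases ht with rfl | rfl | rfl
  · exact Or.inr (Or.inr rfl)
  · left; simp
  · right; left; rw [S.isT_symm h]; simp
theorem tri_σ_iff {v u : V} (h : S.isT v) : S.tri v (S.σ u) ↔ S.tri v u :=
  ⟨fun h' => by simpa using S.tri_σsymm h h', S.tri_σ h⟩
theorem tri_uniq {v v' u : V} (h : S.isT v) (h' : S.isT v') (ht : S.tri v u) (ht' : S.tri v' u) : v = v' := by
  refine S.isT_not h' h.1 ?_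
  rcases ht with rfl | rfl | rfl
  · exact ht'
  · have := S.tri_σsymm h' ht'; simpa using this
  · have := S.tri_σ h' ht'; simpa using this
theorem tri_core {v u : V} (h : S.isT v) (ht : S.tri v u) : S.core u := by
  rcases ht with rfl | rfl | rfl
  · exact h.1.1
  · exact S.core_σ h.1.1
  · exact S.core_symm h.1.1
theorem nT_σ {v : V} : S.nT (S.σ v) ↔ S.nT v := by
  constructor
  · rintro ⟨h1, h2⟩
    exact ⟨by simpa using S.core_symm h1, fun u hu ht => h2 u hu (S.tri_σ hu ht)⟩
  · rintro ⟨h1, h2⟩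
    exact ⟨S.core_σ h1, fun u hu ht => h2 u hu ((S.tri_σ_iff hu).1 ht)⟩
theorem pend_σ {P : Finset V} {v : V} : S.pend P (S.σ v) ↔ S.pend P v := by
  constructor
  · rintro ⟨h1, h2⟩
    exact ⟨by simpa using S.core_symm h1, fun u hu ht => h2 u hu (S.tri_σ hu ht)⟩
  · rintro ⟨h1, h2⟩
    exact ⟨S.core_σ h1, fun u hu ht => h2 u hu ((S.tri_σ_iff hu).1 ht)⟩
theorem pend_symm {P : Finset V} {v : V} : S.pend P (S.σ.symm v) ↔ S.pend P v := by
  rw [← S.pend_σ]; simp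
theorem nT_pend {P : Finset V} {v : V} (h : S.nT v) : S.pend P v :=
  ⟨h.1, fun u hu ht => absurd ht (h.2 u hu)⟩
theorem tri_pend {P : Finset V} {v u : V} (h : S.isT v) (hv : v ∈ P) (ht : S.tri v u) : S.pend P u :=
  ⟨S.tri_core h ht, fun u' hu' ht' => by rw [← S.tri_uniq h hu' ht ht']; exact hv⟩
theorem nT_iter {v : V} (h : S.nT v) (k : ℕ) : S.nT (S.σ^[k] v) := by
  induction k with
  | zero => exact h
  | succ k ih => rw [Function.iterate_succ_apply']; exact S.nT_σ.2 ih
theorem core_iter {v : V} (h : S.core v) (k : ℕ) : S.core (S.σ^[k] v) := by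
  induction k with
  | zero => exact h
  | succ k ih => rw [Function.iterate_succ_apply']; exact S.core_σ ih

noncomputable def per (v : V) : ℕ := Function.minimalPeriod S.σ v

variable [Fintype V]

theorem per_pos (v : V) : 0 < S.per v :=
  Function.minimalPeriod_pos_of_mem_periodicPts
    (Function.Injective.mem_periodicPts S.σ.injective v)

theorem per3 {v : V} (h : S.core v) : 3 ≤ S.per v := by
  have h0 := S.per_pos v
  have hp := Function.isPeriodicPt_minimalPeriod S.σ v
  change Function.IsPeriodicPt S.σ (S.per v) v at hp
  by_contra hlt
  have : S.per v = 1 ∨ S.per v = 2 := by omega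
  rcases this with e | e <;> rw [e] at hp
  · exact h hp
  · exact S.σσ v h hp

theorem iter_per (v : V) (j : ℕ) : S.σ^[j + S.per v] v = S.σ^[j] v :=
  Function.iterate_add_minimalPeriod_eq

theorem per_iter (v : V) (k : ℕ) (hv : 0 < S.per v) : S.per (S.σ^[k] v) = S.per v :=
  Function.minimalPeriod_apply_iterate (Function.minimalPeriod_pos_iff_mem_periodicPts.1 hv) k

theorem CSv {v : V} (h : S.core v) : CS (S.per v) (fun j => S.t (S.σ^[j] v)) :=
  ⟨S.per3 h, fun j => by show S.t _ = S.t _; rw [S.iter_per], fun j hj => by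
    show S.t (S.σ^[j+1] v) = false
    rw [Function.iterate_succ_apply']; exact S.tt _ hj⟩

theorem LSv {v : V} {g : V → Fin 5} (h : ∀ j, g (S.σ^[j] v) < 3) : LS (S.per v) (fun j => g (S.σ^[j] v)) :=
  ⟨fun j => by show g _ = g _; rw [S.iter_per], h⟩

/-- number of `E₀` edges on the cycle of `v` -/
noncomputable def ct (v : V) : ℕ := cnt (fun j => S.t (S.σ^[j] v)) 0 (S.per v)

def GoodAt (g : V → Fin 5) (v : V) : Prop := SeqCol (S.per v) (fun j => g (S.σ^[j] v)) (S.ct v)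

theorem ct_iter {v : V} (h : S.core v) (k : ℕ) : S.ct (S.σ^[k] v) = S.ct v := by
  unfold ct
  rw [S.per_iter v k (S.per_pos v), ← (S.CSv h).cnt_shift k]
  simp only [← Function.iterate_add_apply]

theorem good_of_iter {g : V → Fin 5} {v : V} (h : S.core v) (k : ℕ) (hg : S.GoodAt g (S.σ^[k] v)) :
    S.GoodAt g v := by
  unfold GoodAt at hg ⊢
  rw [S.ct_iter h, S.per_iter v k (S.per_pos v)] at hg
  simp only [← Function.iterate_add_apply] at hg
  exact SeqCol.rot (S.per_pos v) (l := fun j => g (S.σ^[j] v)) (fun j => by show g _ = g _; rw [S.iter_per]) hg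

/-- if `g'` differs from `g` only at `w` -/
theorem good_upd {g g' : V → Fin 5} {w : V} (hgg : ∀ u, u ≠ w → g' u = g u) {v : V} (hv : S.core v)
    (hw : S.nT v → S.nT w → S.GoodAt g' w) (hn : S.nT v) (h : S.GoodAt g v) : S.GoodAt g' v := by
  by_cases hk : ∃ k, S.σ^[k] v = w
  · obtain ⟨k, hk⟩ := hk
    refine S.good_of_iter hv k ?_
    rw [hk]; exact hw hn (by rw [← hk]; exact S.nT_iter hn k)
  · push Not at hk
    unfold GoodAt at h ⊢
    have : (fun j => g' (S.σ^[j] v)) = (fun j => g (S.σ^[j] v)) := by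
      funext j; exact hgg _ (hk j)
    rw [this]; exact h

theorem ct3 {v : V} (h : S.nT v) (ho : S.per v % 2 = 1) : 3 ≤ S.ct v := by
  have h1 := cnt_odd (S.CSv h.1) ho
  change S.per v + 1 ≤ 2 * S.ct v at h1
  by_cases h5 : 5 ≤ S.per v
  · omega
  have h3 := S.per3 h.1
  have hp : S.per v = 3 := by omega
  have hall : ∀ u, S.nT u → S.per u = 3 → S.t (S.σ u) = false := by
    intro u hu hp
    by_contra hc
    rw [Bool.not_eq_false] at hc
    have h3 : S.σ (S.σ (S.σ u)) = u := by
      have := S.iter_per u 0; rw [hp] at this; exact this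
    have h2 := S.tt _ hc
    refine hu.2 u ⟨⟨hu.1, ?_, ?_⟩, h3, hc⟩ (Or.inl rfl)
    · by_contra hd
      rw [Bool.not_eq_false] at hd
      have := S.tt _ hd; rw [hc] at this; simp at this
    · rw [show S.σ.symm u = S.σ (S.σ u) by rw [Equiv.symm_apply_eq]; exact h3.symm]; exact h2
  have hall' : ∀ j, S.t (S.σ^[j] v) = false := by
    intro j
    rw [← S.iter_per v j, hp, show j + 3 = (j+2)+1 by rfl, Function.iterate_succ_apply']
    exact hall _ (S.nT_iter h _) (by rw [S.per_iter _ _ (S.per_pos v), hp])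
  unfold ct
  rw [cnt_range, hp]
  simp [hall']

end Sys
end SysSec


section SysSec2
open scoped Classical
namespace Sys
variable {V : Type*} (S : Sys V)

noncomputable def updV (g : V → Fin 5) (w : V) (c : Fin 5) (u : V) : Fin 5 := if u = w then c else g u

theorem updV_ne {g : V → Fin 5} {w : V} {c : Fin 5} {u : V} (h : u ≠ w) : updV g w c u = g u := if_neg h
theorem updV_self {g : V → Fin 5} {w : V} {c : Fin 5} : updV g w c w = c := if_pos rfl

theorem iter_pred [Fintype V] (w : V) : S.σ^[S.per w - 1] w = S.σ.symm w := by
  rw [Equiv.eq_symm_apply, ← Function.iterate_succ_apply' S.σ]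
  have h := S.per_pos w
  rw [show (S.per w - 1).succ = 0 + S.per w by omega, S.iter_per]; rfl

theorem goodH [Fintype V] {g : V → Fin 5} {w : V} (hw : S.nT w) (hV : S.Vv w) (hl : ∀ u, S.nT u → g u < 3)
    (ht : ∀ u, S.nT u → S.t u = true → g u = g (S.σ u)) {c1 c2 : Fin 5} (h1 : c1 < 3) (h2 : c2 < 3)
    (hne : c1 ≠ c2) : S.GoodAt (updV g w c1) w ∨ S.GoodAt (updV g w c2) w := by
  have e : ∀ c, updL (S.per w) (fun j => g (S.σ^[j] w)) 0 c = fun j => updV g w c (S.σ^[j] w) := by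
    intro c; funext j
    unfold updL updV
    have : j % S.per w = 0 % S.per w ↔ S.σ^[j] w = w := by
      rw [Nat.zero_mod, ← Nat.dvd_iff_mod_eq_zero]
      exact (Function.isPeriodicPt_iff_minimalPeriod_dvd (f := S.σ) (x := w) (n := j)).symm
    simp only [this]
  have := lemH (S.CSv hw.1) (g := fun j => g (S.σ^[j] w)) (S.LSv (fun j => hl _ (S.nT_iter hw j)))
    (by intro j hj
        show g _ = g (S.σ^[j+1] w)
        rw [Function.iterate_succ_apply']; exact ht _ (S.nT_iter hw j) hj)
    (S.ct3 hw) (w := 0) ⟨hV.2.1, by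
      show S.t (S.σ^[0 + S.per w - 1] w) = false
      rw [Nat.zero_add, S.iter_pred]; exact hV.2.2⟩ h1 h2 hne
  rw [e, e] at this
  exact this

def ULow (φ : Sym2 V → Fin 5) (v m : V) : Prop :=
  S.G.Adj v m ∧ φ s(v,m) < 3 ∧ ∀ w, S.G.Adj v w → w ≠ m → ¬ φ s(v,w) < 3
def Full (φ : Sym2 V → Fin 5) (v : V) : Prop := ∀ w, S.G.Adj v w → φ s(v,w) < 3
def Op (φ : Sym2 V → Fin 5) (g : V → Fin 5) (P : Finset V) (v : V) : Prop :=
  ∃ m, S.ULow φ v m ∧ (∀ w, S.G.Adj v w → w ≠ m → ¬ S.pend P w ∧ g w = g v) ∧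
    (∀ w w', S.G.Adj v w → S.G.Adj v w' → w ≠ m → w' ≠ m → w ≠ w' → φ s(v,w) ≠ φ s(v,w'))
def LowP (φ : Sym2 V → Fin 5) : Prop :=
  ∀ v w w', S.G.Adj v w → S.G.Adj v w' → w ≠ w' → φ s(v,w) < 3 → φ s(v,w) ≠ φ s(v,w')

structure St [Fintype V] (φ : Sym2 V → Fin 5) (g : V → Fin 5) (P D : Finset V) : Prop where
  PT : ∀ v ∈ P, S.isT v
  DP : D ⊆ P
  low : S.LowP φ
  pσ : ∀ v, S.pend P v → ¬ φ s(v, S.σ v) < 3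
  pm : ∀ v, S.pend P v → φ s(v, S.mt v) < 3
  np : ∀ v, ¬ S.pend P v → S.Full φ v ∨ S.Op φ g P v
  gl : ∀ v, S.nT v → g v < 3
  gt : ∀ v, S.nT v → S.t v = true → g v = g (S.σ v)
  good : ∀ v, S.nT v → S.GoodAt g v
  fr : ∀ v ∈ P, v ∉ D → φ s(S.σ v, S.mt (S.σ v)) = φ s(S.σ.symm v, S.mt (S.σ.symm v))
  ff : ∀ v ∈ P, v ∉ D → S.isT (S.mt v) →
    S.mt v ∈ P ∧ S.mt v ∉ D ∧ φ s(v, S.mt v) ≠ φ s(S.σ v, S.mt (S.σ v))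

def hit (φ : Sym2 V → Fin 5) (g : V → Fin 5) (P : Finset V) (v : V) : Prop :=
  S.trk P v ∧ ∃ m, S.ULow φ v m ∧ φ s(v,m) ≠ g v

variable {S}

theorem St.ps [Fintype V] {φ g P D} (h : S.St φ g P D) {v : V} (hv : S.pend P v) : ¬ φ s(v, S.σ.symm v) < 3 := by
  have := h.pσ _ (S.pend_symm.2 hv)
  rwa [Equiv.apply_symm_apply, Sym2.eq_swap] at this

theorem St.ul [Fintype V] {φ g P D} (h : S.St φ g P D) {v : V} (hv : S.pend P v) : S.ULow φ v (S.mt v) := by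
  refine ⟨S.adj_mt hv.1, h.pm v hv, ?_⟩
  intro w hw hne
  rcases (S.nb v hv.1 w).1 hw with rfl | rfl | rfl
  · exact h.pσ v hv
  · exact h.ps hv
  · exact absurd rfl hne

theorem ULow.uniq {φ} {v m m' : V} (h : S.ULow φ v m) (h' : S.ULow φ v m') : m = m' := by
  by_contra hne
  exact h.2.2 m' h'.1 (Ne.symm hne) h'.2.1

theorem ULow.congr {φ φ'} {v m : V} (h : S.ULow φ v m) (he : ∀ w, S.G.Adj v w → φ' s(v,w) = φ s(v,w)) :
    S.ULow φ' v m :=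
  ⟨h.1, by rw [he m h.1]; exact h.2.1, fun w hw hne => by rw [he w hw]; exact h.2.2 w hw hne⟩

theorem Full.congr {φ φ'} {v : V} (h : S.Full φ v) (he : ∀ w, S.G.Adj v w → φ' s(v,w) = φ s(v,w)) :
    S.Full φ' v := fun w hw => by rw [he w hw]; exact h w hw

theorem ULow.not_full {φ} {v m : V} (h : S.ULow φ v m) : ¬ S.Full φ v := by
  intro hf
  obtain ⟨p, q, r, h1, h2, h3, h4⟩ := S.deg v
  by_cases hp : p = m
  · subst hp
    exact h.2.2 q ((h4 q).2 (by simp)) (Ne.symm h1) (hf q ((h4 q).2 (by simp)))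
  · exact h.2.2 p ((h4 p).2 (by simp)) hp (hf p ((h4 p).2 (by simp)))

theorem Op.congr {φ φ'} {g g' : V → Fin 5} {P P' : Finset V} {v : V} (h : S.Op φ g P v)
    (he : ∀ w, S.G.Adj v w → φ' s(v,w) = φ s(v,w))
    (hp : ∀ w, S.G.Adj v w → ¬ φ s(v,w) < 3 → ¬ S.pend P w → ¬ S.pend P' w)
    (hg : ∀ w, S.G.Adj v w → ¬ φ s(v,w) < 3 → ¬ S.pend P w → g w = g v → g' w = g' v) : S.Op φ' g' P' v := by
  obtain ⟨m, h1, h2, h3⟩ := h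
  refine ⟨m, h1.congr he, ?_, ?_⟩
  · intro w hw hne
    have := h2 w hw hne
    have h4 := h1.2.2 w hw hne
    exact ⟨hp w hw h4 this.1, hg w hw h4 this.1 this.2⟩
  · intro w w' hw hw' h1 h2 hne
    rw [he w hw, he w' hw']
    exact h3 w w' hw hw' h1 h2 hne

/-- vertices with two low Kempe neighbours are full -/
theorem St.full_of_two [Fintype V] {φ g P D} (h : S.St φ g P D) {v p q : V} (hp : S.G.Adj v p) (hq : S.G.Adj v q)
    (hpq : p ≠ q) (h1 : φ s(v,p) < 3) (h2 : φ s(v,q) < 3) : ¬ S.pend P v ∧ S.Full φ v := by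
  have key : ∀ m, ¬ S.ULow φ v m := by
    intro m hm
    by_cases e : p = m
    · exact hm.2.2 q hq (by rw [← e]; exact hpq.symm) h2
    · exact hm.2.2 p hp e h1
  have hn : ¬ S.pend P v := fun hv => key _ (h.ul hv)
  refine ⟨hn, ?_⟩
  rcases h.np v hn with h | ⟨m, hm, _⟩
  · exact h
  · exact absurd hm (key m)

/-- marking more triangles as dead -/
theorem St.mark [Fintype V] {φ g P D D'} (h : S.St φ g P D) (hD : D ⊆ D') (hP : D' ⊆ P)
    (hc : ∀ v ∈ D', v ∉ D → S.isT (S.mt v) → S.mt v ∈ D') : S.St φ g P D' :=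
  { h with
    DP := hP
    fr := fun v hv hv' => h.fr v hv (fun hh => hv' (hD hh))
    ff := fun v hv hv' ht => by
      obtain ⟨h1, h2, h3⟩ := h.ff v hv (fun hh => hv' (hD hh)) ht
      refine ⟨h1, fun hh => hv' ?_, h3⟩
      have hT := h.PT v hv
      have := hc _ hh h2 (by rw [S.Vv_mt_mt hT.1]; exact hT)
      rwa [S.Vv_mt_mt hT.1] at this }

end Sys
end SysSec2


section SysSec3
open scoped Classical
namespace Sys
variable {V : Type*} {S : Sys V}

noncomputable def updE (S : Sys V) (φ : Sym2 V → Fin 5) (v : V) (c : Fin 5) (e : Sym2 V) : Fin 5 :=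
  if e = s(v, S.mt v) then c else φ e

theorem updE_other {φ} {v : V} {c} {u w : V} (h1 : u ≠ v) (h2 : u ≠ S.mt v) : S.updE φ v c s(u,w) = φ s(u,w) := by
  unfold updE; rw [if_neg]; intro h; rw [Sym2.eq_iff] at h
  rcases h with h | h
  · exact h1 h.1
  · exact h2 h.1

theorem updE_self {φ} {v : V} {c} : S.updE φ v c s(v, S.mt v) = c := if_pos rfl
theorem updE_self' {φ} {v : V} {c} (h : S.mt (S.mt v) = v) : S.updE φ v c s(S.mt v, S.mt (S.mt v)) = c := by
  rw [h]; exact if_pos Sym2.eq_swap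

theorem updE_ne {φ} {v : V} {c} {u w : V} (hv : S.mt (S.mt v) = v) (h1 : u = v ∨ u = S.mt v) (h2 : w ≠ S.mt u) :
    S.updE φ v c s(u,w) = φ s(u,w) := by
  unfold updE; rw [if_neg]; intro h; rw [Sym2.eq_iff] at h
  rcases h1 with rfl | rfl
  · rcases h with h | h
    · exact h2 h.2
    · apply h2; rw [h.2]; exact h.1
  · rw [hv] at h2
    rcases h with h | h
    · apply h2; rw [h.2, h.1]
    · exact h2 h.2

theorem Vv_pend {P : Finset V} {w : V} (h : S.Vv w) (h' : S.isT w → w ∈ P) : S.pend P w :=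
  ⟨h.1, fun u hu ht => by
    have := S.isT_not hu h ht
    subst this; exact h' hu⟩

theorem Vv_nT {w : V} (h : S.Vv w) (h' : ¬ S.isT w) : S.nT w :=
  ⟨h.1, fun u hu ht => by
    have := S.isT_not hu h ht
    subst this; exact h' hu⟩

theorem St.setE [Fintype V] {φ g P D} (h : S.St φ g P D) {v : V} (hv : v ∈ D) {c : Fin 5} (hc : c < 3)
    {g' : V → Fin 5} (hg : ∀ u, u ≠ S.mt v → g' u = g u)
    (hw : S.nT (S.mt v) → g' (S.mt v) < 3 ∧ S.GoodAt g' (S.mt v))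
    (hD : S.isT (S.mt v) → S.mt v ∈ D) :
    S.St (S.updE φ v c) g' P D ∧ ∀ u, S.hit (S.updE φ v c) g' P u →
      (u ≠ S.mt v ∧ S.hit φ g P u) ∨ (u = S.mt v ∧ S.trk P u ∧ c ≠ g' u) := by
  have hT := h.PT v (h.DP hv)
  have hVw := S.Vv_mt hT.1
  have hmm := S.Vv_mt_mt hT.1
  have pv : S.pend P v := S.tri_pend hT (h.DP hv) (Or.inl rfl)
  have pw : S.pend P (S.mt v) := Vv_pend hVw (fun hh => h.DP (hD hh))
  have ulv := h.ul pv
  have ulw := h.ul pw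
  -- high edges elsewhere
  have hhi : ∀ u, (u = v ∨ u = S.mt v) → ∀ w, S.G.Adj u w → w ≠ S.mt u → ¬ S.updE φ v c s(u,w) < 3 := by
    intro u hu w hadj hne
    rw [updE_ne hmm hu hne]
    rcases hu with rfl | rfl
    · exact ulv.2.2 w hadj hne
    · exact ulw.2.2 w hadj hne
  have hself : ∀ u, (u = v ∨ u = S.mt v) → S.updE φ v c s(u, S.mt u) = c := by
    rintro u (rfl | rfl)
    · exact updE_self
    · exact updE_self' hmm
  have hnp : ∀ u, ¬ S.pend P u → u ≠ v ∧ u ≠ S.mt v := by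
    intro u hu; constructor <;> (rintro rfl; contradiction)
  -- labels of triangle side vertices
  have hside : ∀ u ∈ P, S.updE φ v c s(S.σ u, S.mt (S.σ u)) = φ s(S.σ u, S.mt (S.σ u)) ∧
      S.updE φ v c s(S.σ.symm u, S.mt (S.σ.symm u)) = φ s(S.σ.symm u, S.mt (S.σ.symm u)) := by
    intro u hu
    have hTu := h.PT u hu
    have k : ∀ y, S.tri u y → y ≠ u → S.updE φ v c s(y, S.mt y) = φ s(y, S.mt y) := by
      intro y hy hne
      refine updE_other ?_ ?_
      · rintro rfl; exact hne (S.isT_not hTu hT.1 hy)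
      · rintro rfl; exact hne (S.isT_not hTu hVw hy)
    exact ⟨k _ (Or.inr (Or.inl rfl)) hTu.1.1, k _ (Or.inr (Or.inr rfl)) (S.symm_ne hTu.1.1)⟩
  have hVvt : ∀ u, S.t u = true → u ≠ S.mt v ∧ S.σ u ≠ S.mt v := by
    intro u hu
    refine ⟨?_, ?_⟩
    · rintro rfl; rw [hVw.2.1] at hu; simp at hu
    · intro e; have := hVw.2.2; rw [← e, Equiv.symm_apply_apply, hu] at this; simp at this
  refine ⟨{ PT := h.PT, DP := h.DP, low := ?_, pσ := ?_, pm := ?_, np := ?_, gl := ?_, gt := ?_, good := ?_, fr := ?_, ff := ?_ }, ?_⟩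
  · intro u w w' ha ha' hne hlt
    by_cases hu : u = v ∨ u = S.mt v
    · have e1 : w = S.mt u := by
        by_contra hh; exact hhi u hu w ha hh hlt
      intro heq
      have e2 : w' = S.mt u := by
        by_contra hh; rw [heq] at hlt; exact hhi u hu w' ha' hh hlt
      exact hne (e1.trans e2.symm)
    · push Not at hu
      rw [updE_other hu.1 hu.2] at hlt ⊢
      rw [updE_other hu.1 hu.2]
      exact h.low u w w' ha ha' hne hlt
  · intro u hu
    by_cases hu' : u = v ∨ u = S.mt v
    · exact hhi u hu' _ (S.adj_σ hu.1) (S.mne u hu.1).1.symm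
    · push Not at hu'
      rw [updE_other hu'.1 hu'.2]; exact h.pσ u hu
  · intro u hu
    by_cases hu' : u = v ∨ u = S.mt v
    · rw [hself u hu']; exact hc
    · push Not at hu'
      rw [updE_other hu'.1 hu'.2]; exact h.pm u hu
  · intro u hu
    obtain ⟨h1, h2⟩ := hnp u hu
    rcases h.np u hu with hf | ho
    · left; exact hf.congr (fun w _ => updE_other h1 h2)
    · right
      refine ho.congr (fun w _ => updE_other h1 h2) (fun w _ _ h => h) ?_
      intro w _ _ hpw e
      rw [hg w (hnp w hpw).2, hg u h2, e]
  · intro u hu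
    by_cases e : u = S.mt v
    · subst e; exact (hw hu).1
    · rw [hg u e]; exact h.gl u hu
  · intro u hu htu
    obtain ⟨h1, h2⟩ := hVvt u htu
    rw [hg u h1, hg _ h2]; exact h.gt u hu htu
  · intro u hu
    exact S.good_upd hg hu.1 (fun _ h => (hw h).2) hu (h.good u hu)
  · intro u hu huD
    rw [(hside u hu).1, (hside u hu).2]; exact h.fr u hu huD
  · intro u hu huD hmt
    rw [(hside u hu).1]
    have h1 : u ≠ v := by rintro rfl; exact huD hv
    have h2 : u ≠ S.mt v := by rintro rfl; exact huD (hD (h.PT _ hu))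
    rw [updE_other h1 h2]; exact h.ff u hu huD hmt
  · rintro u ⟨htr, m, hm, hne⟩
    by_cases e : u = S.mt v
    · right
      refine ⟨e, htr, ?_⟩
      have : m = S.mt u := by
        by_contra hh; exact hhi u (Or.inr e) m hm.1 hh hm.2.1
      subst this
      rwa [hself u (Or.inr e)] at hne
    · left
      have e2 : u ≠ v := by rintro rfl; exact htr u (h.DP hv) (Or.inl rfl)
      refine ⟨e, htr, m, hm.congr (fun w _ => (updE_other e2 e).symm), ?_⟩
      rw [updE_other e2 e, hg u e] at hne
      exact hne

/-- Kempe swap -/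
noncomputable def swp (φ : Sym2 V → Fin 5) (K : Set V) (a a' : Fin 5) (e : Sym2 V) : Fin 5 :=
  if ∃ u ∈ e, u ∈ K then Equiv.swap a a' (φ e) else φ e

theorem swp_in {φ : Sym2 V → Fin 5} {K : Set V} {a a' : Fin 5} {u w : V} (hu : u ∈ K) :
    swp φ K a a' s(u,w) = Equiv.swap a a' (φ s(u,w)) := by
  unfold swp; rw [if_pos ⟨u, by simp, hu⟩]

theorem swp_out {φ : Sym2 V → Fin 5} {K : Set V} {a a' : Fin 5}
    (hK : ∀ u ∈ K, ∀ w, S.G.Adj u w → (φ s(u,w) = a ∨ φ s(u,w) = a') → w ∈ K) {u w : V}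
    (h : S.G.Adj u w) (hu : u ∉ K) : swp φ K a a' s(u,w) = φ s(u,w) := by
  unfold swp
  split_ifs with hh
  · obtain ⟨y, hy, hyK⟩ := hh
    have : y = w := by
      rcases Sym2.mem_iff.1 hy with rfl | rfl
      · contradiction
      · rfl
    subst this
    have hn : ¬ (φ s(u,y) = a ∨ φ s(u,y) = a') := by
      intro h2; rw [Sym2.eq_swap] at h2; exact hu (hK y hyK u h.symm h2)
    push Not at hn
    exact Equiv.swap_apply_of_ne_of_ne hn.1 hn.2
  · rfl

theorem swap_lt {a a' c : Fin 5} (ha : a < 3) (ha' : a' < 3) : Equiv.swap a a' c < 3 ↔ c < 3 := by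
  rw [Equiv.swap_apply_def]
  split_ifs with h1 h2
  · rw [h1]; simp [ha, ha']
  · rw [h2]; simp [ha, ha']
  · rfl

theorem St.swp [Fintype V] {φ g P D} (h : S.St φ g P D) {K : Set V} {a a' : Fin 5} (ha : a < 3) (ha' : a' < 3)
    {x z : V} (hK : ∀ u ∈ K, ∀ w, S.G.Adj u w → (φ s(u,w) = a ∨ φ s(u,w) = a') → w ∈ K)
    (hF : ∀ u ∈ K, u ≠ x → u ≠ z → S.Full φ u)
    (hx : ∀ u ∈ P, S.tri u x → u ∈ D) (hz : ∀ u ∈ P, S.tri u z → u ∈ D) (hxP : ¬ S.trk P x) :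
    S.St (swp φ K a a') g P D ∧ ∀ u, S.hit (Sys.swp φ K a a') g P u → (u ≠ z ∧ S.hit φ g P u) ∨ (u = z ∧ S.trk P u) := by
  have hlt : ∀ u w, S.G.Adj u w → (Sys.swp φ K a a' s(u,w) < 3 ↔ φ s(u,w) < 3) := by
    intro u w hw
    by_cases hu : u ∈ K
    · rw [swp_in hu, swap_lt ha ha']
    · rw [swp_out hK hw hu]
  have hinj : ∀ u w w', S.G.Adj u w → S.G.Adj u w' → (Sys.swp φ K a a' s(u,w) = Sys.swp φ K a a' s(u,w') ↔ φ s(u,w) = φ s(u,w')) := by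
    intro u w w' hw hw'
    by_cases hu : u ∈ K
    · rw [swp_in hu, swp_in hu, Equiv.apply_eq_iff_eq]
    · rw [swp_out hK hw hu, swp_out hK hw' hu]
  have hul : ∀ u m, S.ULow (Sys.swp φ K a a') u m ↔ S.ULow φ u m := by
    intro u m
    unfold ULow
    constructor
    · rintro ⟨h1, h2, h3⟩
      exact ⟨h1, (hlt _ _ h1).1 h2, fun w hw hne hh => h3 w hw hne ((hlt _ _ hw).2 hh)⟩
    · rintro ⟨h1, h2, h3⟩
      exact ⟨h1, (hlt _ _ h1).2 h2, fun w hw hne hh => h3 w hw hne ((hlt _ _ hw).1 hh)⟩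
  have hsame : ∀ u m, S.ULow φ u m → u ≠ x → u ≠ z → Sys.swp φ K a a' s(u,m) = φ s(u,m) := by
    intro u m hm hux huz
    apply swp_out hK hm.1
    intro hu
    exact hm.not_full (hF u hu hux huz)
  have hfr : ∀ u ∈ P, u ∉ D → ∀ y, S.tri u y → Sys.swp φ K a a' s(y, S.mt y) = φ s(y, S.mt y) := by
    intro u hu huD y hy
    have := S.tri_pend (h.PT u hu) hu hy
    refine hsame y _ (h.ul this) ?_ ?_
    · rintro rfl; exact huD (hx u hu hy)
    · rintro rfl; exact huD (hz u hu hy)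
  refine ⟨{ PT := h.PT, DP := h.DP, low := ?_, pσ := ?_, pm := ?_, np := ?_, gl := h.gl, gt := h.gt, good := h.good, fr := ?_, ff := ?_ }, ?_⟩
  · intro u w w' hw hw' hne hl
    rw [Ne, hinj u w w' hw hw']
    exact h.low u w w' hw hw' hne ((hlt _ _ hw).1 hl)
  · intro u hu; rw [hlt _ _ (S.adj_σ hu.1)]; exact h.pσ u hu
  · intro u hu; rw [hlt _ _ (S.adj_mt hu.1)]; exact h.pm u hu
  · intro u hu
    rcases h.np u hu with hf | ⟨m, h1, h2, h3⟩
    · left; intro w hw; rw [hlt _ _ hw]; exact hf w hw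
    · right
      refine ⟨m, (hul u m).2 h1, h2, ?_⟩
      intro w w' hw hw' e1 e2 e3
      rw [Ne, hinj u w w' hw hw']; exact h3 w w' hw hw' e1 e2 e3
  · intro u hu huD
    rw [hfr u hu huD _ (Or.inr (Or.inl rfl)), hfr u hu huD _ (Or.inr (Or.inr rfl))]
    exact h.fr u hu huD
  · intro u hu huD hmt
    rw [hfr u hu huD _ (Or.inr (Or.inl rfl)), hfr u hu huD _ (Or.inl rfl)]
    exact h.ff u hu huD hmt
  · rintro u ⟨htr, m, hm, hne⟩
    by_cases e : u = z
    · exact Or.inr ⟨e, htr⟩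
    · left
      have hux : u ≠ x := by rintro rfl; exact hxP htr
      rw [hul] at hm
      rw [hsame u m hm hux e] at hne
      exact ⟨e, htr, m, hm, hne⟩

end Sys
end SysSec3


section SysSec4
open scoped Classical
namespace Sys
variable {V : Type*} {S : Sys V}

noncomputable def triC (S : Sys V) (φ : Sym2 V → Fin 5) (v : V) (c1 c2 c3 : Fin 5) (e : Sym2 V) : Fin 5 :=
  if e = s(v, S.σ v) then c1 else if e = s(v, S.σ.symm v) then c2 else
    if e = s(S.σ v, S.σ.symm v) then c3 else φ e

section
variable {φ : Sym2 V → Fin 5} {v : V} {c1 c2 c3 : Fin 5}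

theorem triC1 : S.triC φ v c1 c2 c3 s(v, S.σ v) = c1 := if_pos rfl
theorem triC2 (hv : S.core v) : S.triC φ v c1 c2 c3 s(v, S.σ.symm v) = c2 := by
  unfold triC
  rw [if_neg, if_pos rfl]
  intro h; rw [Sym2.eq_iff] at h
  rcases h with h | h
  · exact S.σ_ne_symm hv h.2.symm
  · exact hv h.1.symm
theorem triC3 (hv : S.core v) : S.triC φ v c1 c2 c3 s(S.σ v, S.σ.symm v) = c3 := by
  unfold triC
  rw [if_neg, if_neg, if_pos rfl]
  · intro h; rw [Sym2.eq_iff] at h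
    rcases h with h | h
    · exact hv h.1
    · exact S.symm_ne hv h.2
  · intro h; rw [Sym2.eq_iff] at h
    rcases h with h | h
    · exact hv h.1
    · exact S.symm_ne hv h.2

theorem triC_out {u w : V} (h : ¬ (S.tri v u ∧ S.tri v w)) : S.triC φ v c1 c2 c3 s(u,w) = φ s(u,w) := by
  unfold triC
  have k : ∀ p q, S.tri v p → S.tri v q → s(u,w) ≠ s(p,q) := by
    intro p q hp hq he
    rw [Sym2.eq_iff] at he
    rcases he with ⟨rfl, rfl⟩ | ⟨rfl, rfl⟩
    · exact h ⟨hp, hq⟩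
    · exact h ⟨hq, hp⟩
  have t0 : S.tri v v := Or.inl rfl
  have t1 : S.tri v (S.σ v) := Or.inr (Or.inl rfl)
  have t2 : S.tri v (S.σ.symm v) := Or.inr (Or.inr rfl)
  rw [if_neg (k _ _ t0 t1), if_neg (k _ _ t0 t2), if_neg (k _ _ t1 t2)]

theorem not_tri_mt (hT : S.isT v) {u : V} (hu : S.tri v u) : ¬ S.tri v (S.mt u) := by
  have hc := S.tri_core hT hu
  have h1 := S.mne u hc
  have h2 := S.mt_ne hc
  have hs := S.isT_symm hT
  intro h
  rcases hu with rfl | rfl | rfl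
  · rcases h with h | h | h
    · exact h2 h
    · exact h1.1 h
    · exact h1.2 h
  · rcases h with h | h | h
    · exact h1.2 (by rw [h]; simp)
    · exact h2 h
    · exact h1.1 (by rw [h, hs])
  · rcases h with h | h | h
    · exact h1.1 (by rw [h]; simp)
    · refine h1.2 ?_
      rw [h, hs]; simp
    · exact h2 h

theorem triC_mt (hT : S.isT v) {u : V} (hu : S.tri v u) : S.triC φ v c1 c2 c3 s(u, S.mt u) = φ s(u, S.mt u) :=
  triC_out fun h => not_tri_mt hT hu h.2
end

theorem core_pair {φ : Sym2 V → Fin 5} {u : V} (hu : S.core u)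
    (h1 : φ s(u, S.σ u) ≠ φ s(u, S.σ.symm u)) (h2 : φ s(u, S.σ u) ≠ φ s(u, S.mt u))
    (h3 : φ s(u, S.σ.symm u) ≠ φ s(u, S.mt u)) :
    ∀ w w', S.G.Adj u w → S.G.Adj u w' → w ≠ w' → φ s(u,w) ≠ φ s(u,w') := by
  intro w w' hw hw' hne
  rcases (S.nb u hu w).1 hw with rfl | rfl | rfl <;> rcases (S.nb u hu w').1 hw' with rfl | rfl | rfl
  · exact absurd rfl hne
  · exact h1
  · exact h2
  · exact h1.symm
  · exact absurd rfl hne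
  · exact h3
  · exact h2.symm
  · exact h3.symm
  · exact absurd rfl hne

theorem core_full {φ : Sym2 V → Fin 5} {u : V} (hu : S.core u)
    (h1 : φ s(u, S.σ u) < 3) (h2 : φ s(u, S.σ.symm u) < 3) (h3 : φ s(u, S.mt u) < 3) : S.Full φ u := by
  intro w hw
  rcases (S.nb u hu w).1 hw with rfl | rfl | rfl <;> assumption

theorem pend_erase {P : Finset V} {v u : V} (hT : S.isT v) :
    S.pend (P.erase v) u ↔ S.pend P u ∧ ¬ S.tri v u := by
  constructor
  · rintro ⟨h1, h2⟩
    refine ⟨⟨h1, fun u' hu' ht => Finset.mem_of_mem_erase (h2 u' hu' ht)⟩, fun ht => ?_⟩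
    exact Finset.notMem_erase v P (h2 v hT ht)
  · rintro ⟨⟨h1, h2⟩, h3⟩
    refine ⟨h1, fun u' hu' ht => Finset.mem_erase.2 ⟨?_, h2 u' hu' ht⟩⟩
    rintro rfl; exact h3 ht

theorem tri_vals {φ : Sym2 V → Fin 5} {v : V} {c1 c2 c3 : Fin 5} (hT : S.isT v) :
    S.triC φ v c1 c2 c3 s(S.σ v, S.σ (S.σ v)) = c3 ∧
    S.triC φ v c1 c2 c3 s(S.σ v, S.σ.symm (S.σ v)) = c1 ∧
    S.triC φ v c1 c2 c3 s(S.σ.symm v, S.σ (S.σ.symm v)) = c2 ∧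
    S.triC φ v c1 c2 c3 s(S.σ.symm v, S.σ.symm (S.σ.symm v)) = c3 := by
  have hs := S.isT_symm hT
  refine ⟨?_, ?_, ?_, ?_⟩
  · rw [← hs]; exact triC3 hT.1.1
  · rw [Equiv.symm_apply_apply, Sym2.eq_swap]; exact triC1
  · rw [Equiv.apply_symm_apply, Sym2.eq_swap]; exact triC2 hT.1.1
  · have : S.σ.symm (S.σ.symm v) = S.σ v := by rw [hs]; simp
    rw [this, Sym2.eq_swap]; exact triC3 hT.1.1

theorem St.drop [Fintype V] {φ g P D} (h : S.St φ g P D) {v : V} (hv : v ∈ D)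
    (h1 : φ s(v, S.mt v) ≠ φ s(S.σ v, S.mt (S.σ v)))
    (h2 : φ s(v, S.mt v) ≠ φ s(S.σ.symm v, S.mt (S.σ.symm v)))
    (h3 : φ s(S.σ v, S.mt (S.σ v)) ≠ φ s(S.σ.symm v, S.mt (S.σ.symm v))) :
    ∃ φ', S.St φ' g (P.erase v) (D.erase v) ∧ (∀ u, S.hit φ' g (P.erase v) u → S.hit φ g P u) ∧
      ∀ u, ¬ S.tri v u → ∀ w, φ' s(u,w) = φ s(u,w) := by
  have hT := h.PT v (h.DP hv)
  have hP := h.DP hv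
  have t0 : S.tri v v := Or.inl rfl
  have t1 : S.tri v (S.σ v) := Or.inr (Or.inl rfl)
  have t2 : S.tri v (S.σ.symm v) := Or.inr (Or.inr rfl)
  have l0 := h.pm v (S.tri_pend hT hP t0)
  have l1 := h.pm _ (S.tri_pend hT hP t1)
  have l2 := h.pm _ (S.tri_pend hT hP t2)
  set lv := φ s(v, S.mt v) with hlv
  set lx := φ s(S.σ v, S.mt (S.σ v)) with hlx
  set ly := φ s(S.σ.symm v, S.mt (S.σ.symm v)) with hly
  set φ' := S.triC φ v ly lx lv with hφ'
  obtain ⟨e1, e2, e3, e4⟩ := tri_vals (φ := φ) (c1 := ly) (c2 := lx) (c3 := lv) hT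
  rw [← hφ'] at e1 e2 e3 e4
  have e5 : φ' s(v, S.σ v) = ly := triC1
  have e6 : φ' s(v, S.σ.symm v) = lx := triC2 hT.1.1
  have m0 : φ' s(v, S.mt v) = lv := triC_mt hT t0
  have m1 : φ' s(S.σ v, S.mt (S.σ v)) = lx := triC_mt hT t1
  have m2 : φ' s(S.σ.symm v, S.mt (S.σ.symm v)) = ly := triC_mt hT t2
  have hout : ∀ u, ¬ S.tri v u → ∀ w, φ' s(u,w) = φ s(u,w) := fun u hu w => triC_out fun hh => hu hh.1
  have hin : ∀ u, S.tri v u → (∀ w w', S.G.Adj u w → S.G.Adj u w' → w ≠ w' → φ' s(u,w) ≠ φ' s(u,w')) ∧ S.Full φ' u := by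
    rintro u (rfl | rfl | rfl)
    · refine ⟨core_pair hT.1.1 ?_ ?_ ?_, core_full hT.1.1 ?_ ?_ ?_⟩ <;> simp only [e5, e6, m0] <;> first | assumption | (apply Ne.symm; assumption)
    · refine ⟨core_pair (S.tri_core hT t1) ?_ ?_ ?_, core_full (S.tri_core hT t1) ?_ ?_ ?_⟩ <;> simp only [e1, e2, m1] <;> first | assumption | (apply Ne.symm; assumption)
    · refine ⟨core_pair (S.tri_core hT t2) ?_ ?_ ?_, core_full (S.tri_core hT t2) ?_ ?_ ?_⟩ <;> simp only [e3, e4, m2] <;> first | assumption | (apply Ne.symm; assumption)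
  have hdisj : ∀ u ∈ P.erase v, ∀ y, S.tri u y → ¬ S.tri v y := by
    intro u hu y hy hy'
    rw [Finset.mem_erase] at hu
    exact hu.1 (S.tri_uniq (h.PT u hu.2) hT hy hy')
  have hnD : ∀ u ∈ P.erase v, u ∉ D.erase v → u ∉ D := by
    intro u hu huD hh
    exact huD (Finset.mem_erase.2 ⟨(Finset.mem_erase.1 hu).1, hh⟩)
  refine ⟨φ', { PT := ?_, DP := Finset.erase_subset_erase v h.DP, low := ?_, pσ := ?_, pm := ?_, np := ?_, gl := h.gl, gt := h.gt, good := h.good, fr := ?_, ff := ?_ }, ?_, hout⟩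
  · intro u hu; exact h.PT u (Finset.mem_of_mem_erase hu)
  · intro u w w' hw hw' hne hl
    by_cases hu : S.tri v u
    · exact (hin u hu).1 w w' hw hw' hne
    · rw [hout u hu] at hl ⊢; rw [hout u hu]; exact h.low u w w' hw hw' hne hl
  · intro u hu; rw [pend_erase hT] at hu; rw [hout u hu.2]; exact h.pσ u hu.1
  · intro u hu; rw [pend_erase hT] at hu; rw [hout u hu.2]; exact h.pm u hu.1
  · intro u hu
    by_cases ht : S.tri v u
    · exact Or.inl (hin u ht).2
    · have : ¬ S.pend P u := fun hh => hu ((pend_erase hT).2 ⟨hh, ht⟩)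
      rcases h.np u this with hf | ho
      · left; exact hf.congr (fun w _ => hout u ht w)
      · right
        refine ho.congr (fun w _ => hout u ht w) ?_ (fun _ _ _ _ e => e)
        intro w _ _ hh hh'
        exact hh ((pend_erase hT).1 hh').1
  · intro u hu huD
    rw [hout _ (hdisj u hu _ (Or.inr (Or.inl rfl))), hout _ (hdisj u hu _ (Or.inr (Or.inr rfl)))]
    exact h.fr u (Finset.mem_of_mem_erase hu) (hnD u hu huD)
  · intro u hu huD hmt
    rw [hout _ (hdisj u hu _ (Or.inr (Or.inl rfl))), hout _ (hdisj u hu _ (Or.inl rfl))]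
    obtain ⟨k1, k2, k3⟩ := h.ff u (Finset.mem_of_mem_erase hu) (hnD u hu huD) hmt
    refine ⟨Finset.mem_erase.2 ⟨?_, k1⟩, fun hh => k2 (Finset.mem_of_mem_erase hh), k3⟩
    intro e; rw [e] at k2; exact k2 hv
  · rintro u ⟨htr, m, hm, hne⟩
    have ht : ¬ S.tri v u := fun ht => hm.not_full (hin u ht).2
    refine ⟨?_, m, hm.congr (fun w _ => (hout u ht w).symm), by rwa [hout u ht] at hne⟩
    intro u' hu' ht'
    by_cases e : u' = v
    · rw [e] at ht'; exact ht ht'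
    · exact htr u' (Finset.mem_erase.2 ⟨e, hu'⟩) ht'

end Sys
end SysSec4


theorem fin5_third : ∀ a a' d c : Fin 5, a < 3 → a' < 3 → d < 3 → a ≠ a' → d ≠ a → d ≠ a' → c ≠ a → c ≠ a' → c < 3 → c = d := by
  decide

section SysSec5
open scoped Classical
namespace Sys
variable {V : Type*} {S : Sys V}

def hiM (a a' c : Fin 5) : Fin 5 := if c = a then 3 else if c = a' then 4 else c

noncomputable def rc (φ : Sym2 V → Fin 5) (K : Set V) (a a' : Fin 5) (e : Sym2 V) : Fin 5 :=
  if ∃ u ∈ e, u ∈ K then hiM a a' (φ e) else φ e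

theorem rc_in {φ : Sym2 V → Fin 5} {K : Set V} {a a' : Fin 5} {u w : V} (hu : u ∈ K) :
    rc φ K a a' s(u,w) = hiM a a' (φ s(u,w)) := by
  unfold rc; rw [if_pos ⟨u, by simp, hu⟩]

theorem rc_out {φ : Sym2 V → Fin 5} {K : Set V} {a a' : Fin 5}
    (hK : ∀ u ∈ K, ∀ w, S.G.Adj u w → (φ s(u,w) = a ∨ φ s(u,w) = a') → w ∈ K) {u w : V}
    (h : S.G.Adj u w) (hu : u ∉ K) : rc φ K a a' s(u,w) = φ s(u,w) := by
  unfold rc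
  split_ifs with hh
  · obtain ⟨y, hy, hyK⟩ := hh
    have : y = w := by
      rcases Sym2.mem_iff.1 hy with rfl | rfl
      · contradiction
      · rfl
    subst this
    have hn : ¬ (φ s(u,y) = a ∨ φ s(u,y) = a') := by
      intro h2; rw [Sym2.eq_swap] at h2; exact hu (hK y hyK u h.symm h2)
    push Not at hn
    unfold hiM; rw [if_neg hn.1, if_neg hn.2]
  · rfl

theorem ULow.lowP {φ : Sym2 V → Fin 5} {u m : V} (h : S.ULow φ u m) {w w' : V} (hw : S.G.Adj u w)
    (hw' : S.G.Adj u w') (hne : w ≠ w') (hl : φ s(u,w) < 3) : φ s(u,w) ≠ φ s(u,w') := by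
  intro he
  have e1 : w = m := by by_contra hh; exact h.2.2 w hw hh hl
  have e2 : w' = m := by by_contra hh; rw [he] at hl; exact h.2.2 w' hw' hh hl
  exact hne (e1.trans e2.symm)

theorem third_nb {v p q : V} (hp : S.G.Adj v p) (hq : S.G.Adj v q) (hpq : p ≠ q) :
    ∃ r, r ≠ p ∧ r ≠ q ∧ ∀ w, S.G.Adj v w ↔ (w = p ∨ w = q ∨ w = r) := by
  obtain ⟨a, b, c, h1, h2, h3, h4⟩ := S.deg v
  rcases (h4 p).1 hp with rfl | rfl | rfl <;> rcases (h4 q).1 hq with rfl | rfl | rfl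
  · exact absurd rfl hpq
  · exact ⟨c, h2.symm, h3.symm, h4⟩
  · exact ⟨b, h1.symm, h3, fun w => by rw [h4]; tauto⟩
  · exact ⟨c, h3.symm, h2.symm, fun w => by rw [h4]; tauto⟩
  · exact absurd rfl hpq
  · exact ⟨a, h1, h2, fun w => by rw [h4]; tauto⟩
  · exact ⟨b, h3, h1.symm, fun w => by rw [h4]; tauto⟩
  · exact ⟨a, h2, h1, fun w => by rw [h4]; tauto⟩
  · exact absurd rfl hpq

theorem ulow_core {φ : Sym2 V → Fin 5} {u m p q : V} (h : ∀ w, S.G.Adj u w → w = m ∨ w = p ∨ w = q)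
    (hm : S.G.Adj u m) (h1 : φ s(u,m) < 3) (h2 : ¬ φ s(u,p) < 3) (h3 : ¬ φ s(u,q) < 3) : S.ULow φ u m := by
  refine ⟨hm, h1, ?_⟩
  intro w hw hne
  rcases h w hw with rfl | rfl | rfl
  · exact absurd rfl hne
  · exact h2
  · exact h3

theorem op_core {φ : Sym2 V → Fin 5} {g : V → Fin 5} {P : Finset V} {u m p q : V}
    (h : ∀ w, S.G.Adj u w → w = m ∨ w = p ∨ w = q)
    (hm : S.G.Adj u m) (h1 : φ s(u,m) < 3) (h2 : ¬ φ s(u,p) < 3) (h3 : ¬ φ s(u,q) < 3)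
    (h4 : φ s(u,p) ≠ φ s(u,q)) (hp : ¬ S.pend P p) (hq : ¬ S.pend P q) (gp : g p = g u) (gq : g q = g u) :
    S.Op φ g P u := by
  refine ⟨m, ulow_core h hm h1 h2 h3, ?_, ?_⟩
  · intro w hw hne
    rcases h w hw with rfl | rfl | rfl
    · exact absurd rfl hne
    · exact ⟨hp, gp⟩
    · exact ⟨hq, gq⟩
  · intro w w' hw hw' e1 e2 hne
    rcases h w hw with rfl | rfl | rfl <;> rcases h w' hw' with rfl | rfl | rfl <;>
      first | exact absurd rfl e1 | exact absurd rfl e2 | exact absurd rfl hne | exact h4 | exact h4.symm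

set_option maxHeartbeats 1000000 in
theorem St.op2 [Fintype V] {φ g P D} (h : S.St φ g P D) {v : V} (hv : v ∈ D) {a a' b b' d : Fin 5}
    (ha : a < 3) (ha' : a' < 3) (hd : d < 3) (haa : a ≠ a') (hda : d ≠ a) (hda' : d ≠ a')
    (hb : (b = a ∧ b' = a') ∨ (b = a' ∧ b' = a))
    (hx : φ s(S.σ v, S.mt (S.σ v)) = a) (hy : φ s(S.σ.symm v, S.mt (S.σ.symm v)) = a)
    (hvb : φ s(v, S.mt v) = b') {K : Set V} (hxK : S.σ v ∈ K) (hyK : S.σ.symm v ∈ K) (hvK : v ∉ K)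
    (hK : ∀ u ∈ K, ∀ w, S.G.Adj u w → (φ s(u,w) = a ∨ φ s(u,w) = a') → w ∈ K)
    (hF : ∀ u ∈ K, u ≠ S.σ v → u ≠ S.σ.symm v → ∃ p q, p ≠ q ∧ S.G.Adj u p ∧ S.G.Adj u q ∧
      φ s(u,p) = a ∧ φ s(u,q) = a') :
    ∃ φ' g', S.St φ' g' (P.erase v) (D.erase v) ∧ ∀ u, S.hit φ' g' (P.erase v) u → u = S.σ.symm v ∨ S.hit φ g P u := by
  have hT := h.PT v (h.DP hv)
  have hP := h.DP hv
  have t0 : S.tri v v := Or.inl rfl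
  have t1 : S.tri v (S.σ v) := Or.inr (Or.inl rfl)
  have t2 : S.tri v (S.σ.symm v) := Or.inr (Or.inr rfl)
  have c1 := S.tri_core hT t1
  have c2 := S.tri_core hT t2
  have hs := S.isT_symm hT
  have hbl : b < 3 := by rcases hb with ⟨e, _⟩ | ⟨e, _⟩ <;> rw [e] <;> assumption
  have hbl' : b' < 3 := by rcases hb with ⟨_, e⟩ | ⟨_, e⟩ <;> rw [e] <;> assumption
  have hbb : b ≠ b' := by rcases hb with ⟨e, e'⟩ | ⟨e, e'⟩ <;> rw [e, e'] <;> first | assumption | exact haa.symm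
  have hdb : d ≠ b := by rcases hb with ⟨e, _⟩ | ⟨e, _⟩ <;> rw [e] <;> assumption
  have hdb' : d ≠ b' := by rcases hb with ⟨_, e⟩ | ⟨_, e⟩ <;> rw [e] <;> assumption
  have n3 : ¬ (3 : Fin 5) < 3 := by decide
  have n4 : ¬ (4 : Fin 5) < 3 := by decide
  have n34 : (3 : Fin 5) ≠ 4 := by decide
  obtain ⟨φ', hφ'⟩ : ∃ φ', φ' = S.triC (rc φ K a a') v d b 4 := ⟨_, rfl⟩
  obtain ⟨e1, e2, e3, e4⟩ := tri_vals (φ := rc φ K a a') (c1 := d) (c2 := b) (c3 := 4) hT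
  rw [← hφ'] at e1 e2 e3 e4
  have e5 : φ' s(v, S.σ v) = d := by rw [hφ']; exact triC1
  have e6 : φ' s(v, S.σ.symm v) = b := by rw [hφ']; exact triC2 hT.1.1
  have m0 : φ' s(v, S.mt v) = b' := by
    rw [hφ', triC_mt hT t0, rc_out hK (S.adj_mt hT.1.1) hvK, hvb]
  have m1 : φ' s(S.σ v, S.mt (S.σ v)) = 3 := by
    rw [hφ', triC_mt hT t1, rc_in hxK, hx]; simp [hiM]
  have m2 : φ' s(S.σ.symm v, S.mt (S.σ.symm v)) = 3 := by
    rw [hφ', triC_mt hT t2, rc_in hyK, hy]; simp [hiM]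
  -- members of K
  have hKt : ∀ u ∈ K, S.tri v u → u = S.σ v ∨ u = S.σ.symm v := by
    rintro u hu (rfl | hh)
    · contradiction
    · exact hh
  have hKin : ∀ u ∈ K, ¬ S.tri v u → ∃ p q r, p ∈ K ∧ q ∈ K ∧ (∀ w, S.G.Adj u w → w = r ∨ w = p ∨ w = q) ∧ S.G.Adj u r ∧
      φ' s(u,p) = 3 ∧ φ' s(u,q) = 4 ∧ φ' s(u,r) = d ∧ ¬ S.pend P u ∧ S.Full φ u := by
    intro u hu ht
    obtain ⟨p, q, hpq, hp, hq, h1, h2⟩ := hF u hu (fun e => ht (by rw [e]; exact t1)) (fun e => ht (by rw [e]; exact t2))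
    obtain ⟨r, hrp, hrq, hN⟩ := third_nb hp hq hpq
    have hr : S.G.Adj u r := (hN r).2 (by simp)
    have hfu := h.full_of_two hp hq hpq (by rw [h1]; exact ha) (by rw [h2]; exact ha')
    have hv' : ∀ w, φ' s(u,w) = hiM a a' (φ s(u,w)) := fun w => by
      rw [hφ', triC_out fun hh => ht hh.1, rc_in hu]
    have r1 : φ s(u,r) ≠ a := by rw [← h1]; exact h.low u r p hr hp hrp (hfu.2 r hr)
    have r2 : φ s(u,r) ≠ a' := by rw [← h2]; exact h.low u r q hr hq hrq (hfu.2 r hr)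
    refine ⟨p, q, r, hK u hu p hp (Or.inl h1), hK u hu q hq (Or.inr h2), ?_, hr, ?_, ?_, ?_, hfu⟩
    · intro w hw; have := (hN w).1 hw; tauto
    · rw [hv', h1]; simp [hiM]
    · rw [hv', h2]; simp [hiM, haa.symm]
    · rw [hv']; simp only [hiM, r1, r2, if_false]
      exact fin5_third a a' d _ ha ha' hd haa hda hda' r1 r2 (hfu.2 r hr)
  have hKnp : ∀ u ∈ K, ¬ S.pend (P.erase v) u := by
    intro u hu hp
    rw [pend_erase hT] at hp
    obtain ⟨p, q, r, hh⟩ := hKin u hu hp.2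
    exact hh.2.2.2.2.2.2.2.1 hp.1
  have hnK : ∀ u, S.pend (P.erase v) u → u ∉ K := fun u hu hh => hKnp u hh hu
  have hout : ∀ u, ¬ S.tri v u → u ∉ K → ∀ w, S.G.Adj u w → φ' s(u,w) = φ s(u,w) := fun u hu huK w hw => by
    rw [hφ', triC_out fun hh => hu hh.1, rc_out hK hw huK]
  obtain ⟨g', hg1, hg2⟩ : ∃ g' : V → Fin 5, (∀ u ∈ K, g' u = d) ∧ ∀ u, u ∉ K → g' u = g u :=
    ⟨fun u => if u ∈ K then d else g u, fun u hu => if_pos hu, fun u hu => if_neg hu⟩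
  have nbx : ∀ w, S.G.Adj (S.σ v) w → w = v ∨ w = S.σ.symm v ∨ w = S.mt (S.σ v) := by
    intro w hw
    rcases (S.nb _ c1 w).1 hw with e | e | e
    · rw [hs]; tauto
    · left; rw [e]; simp
    · tauto
  have nby : ∀ w, S.G.Adj (S.σ.symm v) w → w = v ∨ w = S.σ v ∨ w = S.mt (S.σ.symm v) := by
    intro w hw
    rcases (S.nb _ c2 w).1 hw with e | e | e
    · left; rw [e]; simp
    · right; left; rw [e, hs]; simp
    · tauto
  have mxK : S.mt (S.σ v) ∈ K := hK _ hxK _ (S.adj_mt c1) (Or.inl hx)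
  have myK : S.mt (S.σ.symm v) ∈ K := hK _ hyK _ (S.adj_mt c2) (Or.inl hy)
  have xv : φ' s(S.σ v, v) = d := by rw [Sym2.eq_swap]; exact e5
  have yv : φ' s(S.σ.symm v, v) = b := by rw [Sym2.eq_swap]; exact e6
  have xy : φ' s(S.σ v, S.σ.symm v) = 4 := by rw [hφ']; exact triC3 hT.1.1
  have yx : φ' s(S.σ.symm v, S.σ v) = 4 := by rw [Sym2.eq_swap]; exact xy
  have ox : S.Op φ' g' (P.erase v) (S.σ v) := by
    refine op_core nbx (S.adj_σ hT.1.1).symm ?_ ?_ ?_ ?_ (hKnp _ hyK) (hKnp _ mxK) ?_ ?_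
    · rw [xv]; exact hd
    · rw [xy]; exact n4
    · rw [m1]; exact n3
    · rw [xy, m1]; exact n34.symm
    · rw [hg1 _ hyK, hg1 _ hxK]
    · rw [hg1 _ mxK, hg1 _ hxK]
  have oy : S.Op φ' g' (P.erase v) (S.σ.symm v) := by
    refine op_core nby (S.adj_symm hT.1.1).symm ?_ ?_ ?_ ?_ (hKnp _ hxK) (hKnp _ myK) ?_ ?_
    · rw [yv]; exact hbl
    · rw [yx]; exact n4
    · rw [m2]; exact n3
    · rw [yx, m2]; exact n34.symm
    · rw [hg1 _ hxK, hg1 _ hyK]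
    · rw [hg1 _ myK, hg1 _ hyK]
  have oK : ∀ u ∈ K, ¬ S.tri v u → S.Op φ' g' (P.erase v) u := by
    intro u hu ht
    obtain ⟨p, q, r, hp, hq, hN, hr, k1, k2, k3, _⟩ := hKin u hu ht
    refine op_core hN hr ?_ ?_ ?_ ?_ (hKnp _ hp) (hKnp _ hq) ?_ ?_
    · rw [k3]; exact hd
    · rw [k1]; exact n3
    · rw [k2]; exact n4
    · rw [k1, k2]; exact n34
    · rw [hg1 _ hp, hg1 _ hu]
    · rw [hg1 _ hq, hg1 _ hu]
  have oAll : ∀ u ∈ K, S.Op φ' g' (P.erase v) u := by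
    intro u hu
    by_cases ht : S.tri v u
    · rcases hKt u hu ht with rfl | rfl
      · exact ox
      · exact oy
    · exact oK u hu ht
  have fv : S.Full φ' v := core_full hT.1.1 (by rw [e5]; exact hd) (by rw [e6]; exact hbl) (by rw [m0]; exact hbl')
  have pv := core_pair (φ := φ') hT.1.1 (by rw [e5, e6]; exact hdb) (by rw [e5, m0]; exact hdb') (by rw [e6, m0]; exact hbb)
  have hcase : ∀ u, u = v ∨ u ∈ K ∨ (¬ S.tri v u ∧ u ∉ K) := by
    intro u
    by_cases hu : u ∈ K
    · tauto
    · by_cases ht : S.tri v u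
      · rcases ht with rfl | rfl | rfl
        · left; rfl
        · contradiction
        · contradiction
      · tauto
  have hdisj : ∀ u ∈ P.erase v, ∀ y, S.tri u y → ¬ S.tri v y := by
    intro u hu y hy hy'
    rw [Finset.mem_erase] at hu
    exact hu.1 (S.tri_uniq (h.PT u hu.2) hT hy hy')
  have hpe : ∀ u ∈ P.erase v, ∀ y, S.tri u y → φ' s(y, S.mt y) = φ s(y, S.mt y) := by
    intro u hu y hy
    have hTu := h.PT u (Finset.mem_of_mem_erase hu)
    exact hout y (hdisj u hu y hy) (hnK y (S.tri_pend hTu hu hy)) _ (S.adj_mt (S.tri_core hTu hy))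
  have hnD : ∀ u ∈ P.erase v, u ∉ D.erase v → u ∉ D := by
    intro u hu huD hh
    exact huD (Finset.mem_erase.2 ⟨(Finset.mem_erase.1 hu).1, hh⟩)
  have gnT : ∀ u, S.nT u → g' u = g u := fun u hu => hg2 u (hnK u (S.nT_pend hu))
  refine ⟨φ', g', { PT := ?_, DP := Finset.erase_subset_erase v h.DP, low := ?_, pσ := ?_, pm := ?_, np := ?_, gl := ?_, gt := ?_, good := ?_, fr := ?_, ff := ?_ }, ?_⟩
  · intro u hu; exact h.PT u (Finset.mem_of_mem_erase hu)
  · intro u w w' hw hw' hne hl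
    rcases hcase u with rfl | hu | ⟨ht, hu⟩
    · exact pv w w' hw hw' hne
    · obtain ⟨m, hm, _⟩ := oAll u hu
      exact hm.lowP hw hw' hne hl
    · rw [hout u ht hu w hw] at hl ⊢; rw [hout u ht hu w' hw']; exact h.low u w w' hw hw' hne hl
  · intro u hu
    have := (pend_erase hT).1 hu
    rw [hout u this.2 (hnK u hu) _ (S.adj_σ hu.1)]; exact h.pσ u this.1
  · intro u hu
    have := (pend_erase hT).1 hu
    rw [hout u this.2 (hnK u hu) _ (S.adj_mt hu.1)]; exact h.pm u this.1
  · intro u hu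
    rcases hcase u with rfl | huK | ⟨ht, huK⟩
    · exact Or.inl fv
    · exact Or.inr (oAll u huK)
    · have : ¬ S.pend P u := fun hh => hu ((pend_erase hT).2 ⟨hh, ht⟩)
      rcases h.np u this with hf | ho
      · left; exact hf.congr (fun w hw => hout u ht huK w hw)
      · right
        refine ho.congr (fun w hw => hout u ht huK w hw) ?_ ?_
        · intro w _ _ hh hh'
          exact hh ((pend_erase hT).1 hh').1
        · intro w hw hlt hnp e
          have hwK : w ∉ K := by
            intro hwK
            have hwt : ¬ S.tri v w := fun hwt => hnp (S.tri_pend hT hP hwt)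
            obtain ⟨p, q, r, hh⟩ := hKin w hwK hwt
            have := hh.2.2.2.2.2.2.2.2 u hw.symm
            rw [Sym2.eq_swap] at this
            exact hlt this
          rw [hg2 _ hwK, hg2 _ huK, e]
  · intro u hu; rw [gnT u hu]; exact h.gl u hu
  · intro u hu htu; rw [gnT u hu, gnT _ (S.nT_σ.2 hu)]; exact h.gt u hu htu
  · intro u hu
    have := h.good u hu
    unfold GoodAt at this ⊢
    rw [show (fun j => g' (S.σ^[j] u)) = fun j => g (S.σ^[j] u) from funext fun j => gnT _ (S.nT_iter hu j)]
    exact this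
  · intro u hu huD
    rw [hpe u hu _ (Or.inr (Or.inl rfl)), hpe u hu _ (Or.inr (Or.inr rfl))]
    exact h.fr u (Finset.mem_of_mem_erase hu) (hnD u hu huD)
  · intro u hu huD hmt
    rw [hpe u hu _ (Or.inr (Or.inl rfl)), hpe u hu _ (Or.inl rfl)]
    obtain ⟨k1, k2, k3⟩ := h.ff u (Finset.mem_of_mem_erase hu) (hnD u hu huD) hmt
    refine ⟨Finset.mem_erase.2 ⟨?_, k1⟩, fun hh => k2 (Finset.mem_of_mem_erase hh), k3⟩
    intro e; rw [e] at k2; exact k2 hv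
  · rintro u ⟨htr, m, hm, hne⟩
    rcases hcase u with rfl | huK | ⟨ht, huK⟩
    · exact absurd fv hm.not_full
    · by_cases e : u = S.σ.symm v
      · exact Or.inl e
      · exfalso
        by_cases ht : S.tri v u
        · rcases hKt u huK ht with rfl | rfl
          · have : m = v := by
              by_contra hh
              rcases nbx m hm.1 with e' | e' | e'
              · exact hh e'
              · rw [e'] at hm; exact n4 (xy ▸ hm.2.1)
              · rw [e'] at hm; exact n3 (m1 ▸ hm.2.1)
            rw [this, xv, hg1 _ huK] at hne
            exact hne rfl
          · exact e rfl
        · obtain ⟨p, q, r, hp, hq, hN, hr, k1, k2, k3, _⟩ := hKin u huK ht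
          have : m = r := by
            by_contra hh
            rcases hN m hm.1 with e' | e' | e'
            · exact hh e'
            · rw [e'] at hm; exact n3 (k1 ▸ hm.2.1)
            · rw [e'] at hm; exact n4 (k2 ▸ hm.2.1)
          rw [this, k3, hg1 _ huK] at hne
          exact hne rfl
    · right
      refine ⟨?_, m, hm.congr (fun w hw => (hout u ht huK w hw).symm), by rwa [hout u ht huK m hm.1, hg2 _ huK] at hne⟩
      intro u' hu' ht'
      by_cases e : u' = v
      · rw [e] at ht'; exact ht ht'
      · exact htr u' (Finset.mem_erase.2 ⟨e, hu'⟩) ht'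

end Sys
end SysSec5


section SysSec6
open scoped Classical
namespace Sys
variable {V : Type*} {S : Sys V}

noncomputable def hitN (S : Sys V) [Fintype V] (φ : Sym2 V → Fin 5) (g : V → Fin 5) (P : Finset V) : ℕ :=
  (univ.filter (fun v => S.hit φ g P v)).card

theorem hitN_le [Fintype V] {φ φ' g g' P P'} (h : ∀ u, S.hit φ' g' P' u → S.hit φ g P u) :
    S.hitN φ' g' P' ≤ S.hitN φ g P := by
  refine Finset.card_le_card fun u hu => ?_
  simp only [mem_filter, mem_univ, true_and] at hu ⊢
  exact h u hu

theorem hitN_le1 [Fintype V] {φ φ' g g' P P'} (z : V) (h : ∀ u, S.hit φ' g' P' u → u = z ∨ S.hit φ g P u) :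
    S.hitN φ' g' P' ≤ S.hitN φ g P + 1 := by
  refine (Finset.card_le_card (t := insert z (univ.filter (fun v => S.hit φ g P v))) fun u hu => ?_).trans (Finset.card_insert_le _ _)
  simp only [mem_filter, mem_univ, true_and, mem_insert] at hu ⊢
  exact h u hu

theorem sdiff_lt {P D P' D' : Finset V} {v : V} (hv : v ∈ P) (hvD : v ∉ D) (h : ∀ u ∈ P', u ∉ D' → u ∈ P ∧ u ∉ D ∧ u ≠ v) :
    (P' \ D').card < (P \ D).card := by
  refine Finset.card_lt_card ⟨fun u hu => ?_, fun hh => ?_⟩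
  · have := h u (mem_sdiff.1 hu).1 (mem_sdiff.1 hu).2
    exact mem_sdiff.2 ⟨this.1, this.2.1⟩
  · have := mem_sdiff.1 (hh (mem_sdiff.2 ⟨hv, hvD⟩))
    exact (h v this.1 this.2).2.2 rfl

/-- a Kempe-isolated pair is avoided by chains -/
theorem St.avoid [Fintype V] {φ g P D} (h : S.St φ g P D) {u : V} (hV : S.Vv u) (hp : S.pend P u) (hp' : S.pend P (S.mt u))
    {a a' : Fin 5} (ha : a < 3) (ha' : a' < 3) :
    ∀ p ∈ ({u, S.mt u}ᶜ : Set V), ∀ w, S.G.Adj p w → (φ s(p,w) = a ∨ φ s(p,w) = a') → w ∈ ({u, S.mt u}ᶜ : Set V) := by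
  intro p hpp w hw hc hwm
  have hl : φ s(w,p) < 3 := by rw [Sym2.eq_swap]; rcases hc with e | e <;> rw [e] <;> assumption
  apply hpp
  have : ∀ q, S.pend P q → w = q → p = S.mt q := by
    rintro q hq rfl
    by_contra hne
    exact (h.ul hq).2.2 p hw.symm hne hl
  rcases hwm with e | e
  · right; exact this u hp e
  · left; rw [this _ hp' e, S.Vv_mt_mt hV]

theorem swap_eq {a a' c : Fin 5} (h : c = a ∨ c = a') : Equiv.swap a a' c ≠ c ∨ a = a' := by
  by_cases e : a = a'
  · exact Or.inr e
  · left
    rcases h with rfl | rfl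
    · rw [Equiv.swap_apply_left]; exact fun h => e h.symm
    · rw [Equiv.swap_apply_right]; exact e

theorem swap_mem {a a' c : Fin 5} (h : c = a ∨ c = a') : Equiv.swap a a' c = a ∨ Equiv.swap a a' c = a' := by
  rcases h with rfl | rfl <;> simp

set_option maxHeartbeats 1000000 in
theorem St.step [Fintype V] {φ g P D} (h : S.St φ g P D) {v : V} (hv : v ∈ P) (hvD : v ∉ D) (hnT : ¬ S.isT (S.mt v)) :
    ∃ φ' g' P' D', S.St φ' g' P' D' ∧ (P' \ D').card < (P \ D).card ∧
      S.hitN φ' g' P' + P'.card + 2 * D'.card ≤ S.hitN φ g P + P.card + 2 * D.card := by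
  have hT := h.PT v hv
  have hVw := S.Vv_mt hT.1
  have hmm := S.Vv_mt_mt hT.1
  have nTw := Vv_nT hVw hnT
  have t1 : S.tri v (S.σ v) := Or.inr (Or.inl rfl)
  have t2 : S.tri v (S.σ.symm v) := Or.inr (Or.inr rfl)
  have c1 := S.tri_core hT t1
  have c2 := S.tri_core hT t2
  have p1 : S.pend P (S.σ v) := S.tri_pend hT hv t1
  have p2 : S.pend P (S.σ.symm v) := S.tri_pend hT hv t2
  have p0 : S.pend P v := S.tri_pend hT hv (Or.inl rfl)
  obtain ⟨a, hax⟩ : ∃ a, φ s(S.σ v, S.mt (S.σ v)) = a := ⟨_, rfl⟩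
  have hay : φ s(S.σ.symm v, S.mt (S.σ.symm v)) = a := by rw [← h.fr v hv hvD, hax]
  have ha : a < 3 := by rw [← hax]; exact h.pm _ p1
  have sa := thirdC_spec a a ha ha
  have sb := thirdC_spec a (thirdC a a) ha sa.1
  obtain ⟨d, a', hd, ha', had, haa, hda', hgd⟩ : ∃ d a', d < 3 ∧ a' < 3 ∧ d ≠ a ∧ a ≠ a' ∧ d ≠ a' ∧
      S.GoodAt (updV g (S.mt v) d) (S.mt v) := by
    rcases S.goodH nTw hVw h.gl h.gt sa.1 sb.1 sb.2.2.symm with hh | hh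
    · exact ⟨_, _, sa.1, sb.1, sa.2.1, sb.2.1.symm, sb.2.2.symm, hh⟩
    · exact ⟨_, _, sb.1, sa.1, sb.2.1, sa.2.1.symm, sb.2.2, hh⟩
  obtain ⟨b, b', hb, hbl, hgb⟩ : ∃ b b', ((b = a ∧ b' = a') ∨ (b = a' ∧ b' = a)) ∧ b' < 3 ∧
      S.GoodAt (updV g (S.mt v) b') (S.mt v) := by
    rcases S.goodH nTw hVw h.gl h.gt ha ha' haa with hh | hh
    · exact ⟨a', a, Or.inr ⟨rfl, rfl⟩, ha, hh⟩
    · exact ⟨a, a', Or.inl ⟨rfl, rfl⟩, ha', hh⟩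
  have hb'm : b' = a ∨ b' = a' := by rcases hb with ⟨_, e⟩ | ⟨_, e⟩ <;> tauto
  have hD1P : insert v D ⊆ P := Finset.insert_subset hv h.DP
  have h1 := h.mark (D' := insert v D) (Finset.subset_insert _ _) hD1P (by
    intro u hu huD hh
    rcases mem_insert.1 hu with rfl | hu
    · exact absurd hh hnT
    · exact absurd hu huD)
  obtain ⟨h2, hh2⟩ := h1.setE (v := v) (mem_insert_self _ _) hbl (g' := updV g (S.mt v) b') (fun u hu => updV_ne hu)
    (fun _ => ⟨by rw [updV_self]; exact hbl, hgb⟩) (fun hh => absurd hh hnT)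
  have hits2 : ∀ u, S.hit (S.updE φ v b') (updV g (S.mt v) b') P u → S.hit φ g P u := by
    intro u hu
    rcases hh2 u hu with hh | ⟨rfl, _, hh⟩
    · exact hh.2
    · rw [updV_self] at hh; exact absurd rfl hh
  -- vertices of triangles are not v, mt v
  have otherG : ∀ v'' v', S.isT v'' → S.isT v' → ∀ u, (u = S.σ v' ∨ u = S.σ.symm v') → u ≠ v'' ∧ u ≠ S.mt v'' := by
    intro v'' v' hT'' hT' u hu
    have ht : S.tri v' u := by rcases hu with e | e <;> [exact Or.inr (Or.inl e); exact Or.inr (Or.inr e)]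
    have hne : u ≠ v' := by
      rcases hu with e | e <;> rw [e]
      · exact hT'.1.1
      · exact S.symm_ne hT'.1.1
    refine ⟨?_, ?_⟩ <;> rintro rfl
    · exact hne (S.isT_not hT' hT''.1 ht)
    · exact hne (S.isT_not hT' (S.Vv_mt hT''.1) ht)
  have other := fun v' => otherG v v' hT
  have apexA : ∀ v', S.isT v' → S.σ v ≠ v' ∧ S.σ v ≠ S.mt v' := by
    intro v' hT'
    refine ⟨?_, ?_⟩
    · intro e; exact hT.1.1 (S.isT_not hT (by rw [e]; exact hT'.1) t1)
    · intro e; exact hT.1.1 (S.isT_not hT (by rw [e]; exact S.Vv_mt hT'.1) t1)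
  obtain ⟨φ1, hφ1⟩ : ∃ φ1, φ1 = S.updE φ v b' := ⟨_, rfl⟩
  obtain ⟨g1, hg1⟩ : ∃ g1, g1 = updV g (S.mt v) b' := ⟨_, rfl⟩
  have lx1 : φ1 s(S.σ v, S.mt (S.σ v)) = a := by
    rw [hφ1, updE_other (other v hT _ (Or.inl rfl)).1 (other v hT _ (Or.inl rfl)).2, hax]
  have ly1 : φ1 s(S.σ.symm v, S.mt (S.σ.symm v)) = a := by
    rw [hφ1, updE_other (other v hT _ (Or.inr rfl)).1 (other v hT _ (Or.inr rfl)).2, hay]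
  have lv1 : φ1 s(v, S.mt v) = b' := by rw [hφ1]; exact updE_self
  have fr1 : ∀ v' ∈ P, v' ∉ D → φ1 s(S.σ v', S.mt (S.σ v')) = φ1 s(S.σ.symm v', S.mt (S.σ.symm v')) := by
    intro v' hv' hD'
    have hT' := h.PT v' hv'
    rw [hφ1, updE_other (other v' hT' _ (Or.inl rfl)).1 (other v' hT' _ (Or.inl rfl)).2,
      updE_other (other v' hT' _ (Or.inr rfl)).1 (other v' hT' _ (Or.inr rfl)).2]
    exact h.fr v' hv' hD'
  have ff1 := h.ff
  rw [← hφ1, ← hg1] at h2 hits2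
  clear hh2 h1
  have hmem3 : ∀ c : Fin 5, (c = a ∨ c = a') → c < 3 := by
    rintro c (e | e) <;> rw [e] <;> assumption
  obtain ⟨K, z, hxK, hzK, hzx, hK, hF, ⟨p, hzp, hzc, hzo⟩, hmin⟩ := kempe S.G φ1 a a'
    (fun u w w' hw hw' hne hc => h2.low u w w' hw hw' hne (hmem3 _ hc)) (S.σ v) (S.mt (S.σ v)) (S.adj_mt c1) (Or.inl lx1)
    (fun w hw hne hc => (h2.ul p1).2.2 w hw hne (hmem3 _ hc))
  have avoid : ∀ u, S.isT u → S.pend P u → S.pend P (S.mt u) → u ∉ K ∧ S.mt u ∉ K := by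
    intro u hu hp hp'
    have := hmin _ (show S.σ v ∈ ({u, S.mt u}ᶜ : Set V) from by
      rintro (e | e)
      · exact (apexA u hu).1 e
      · exact (apexA u hu).2 e) (h2.avoid hu.1 hp hp' ha ha')
    exact ⟨fun hh => this hh (Or.inl rfl), fun hh => this hh (Or.inr rfl)⟩
  have hvK := (avoid v hT p0 (S.nT_pend nTw)).1
  have hKfull : ∀ u ∈ K, u ≠ S.σ v → u ≠ z → ¬ S.pend P u ∧ S.Full φ1 u := by
    intro u hu e1 e2
    obtain ⟨p, q, hpq, hp, hq, k1, k2⟩ := hF u hu e1 e2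
    exact h2.full_of_two hp hq hpq (by rw [k1]; exact ha) (by rw [k2]; exact ha')
  by_cases hz : z = S.σ.symm v
  · obtain ⟨φ', g', k1, k2⟩ := h2.op2 (mem_insert_self v D) ha ha' hd haa had hda' hb lx1 ly1 lv1 hxK (by rw [← hz]; exact hzK) hvK hK
      (by rw [← hz]; exact hF)
    rw [Finset.erase_insert hvD] at k1
    refine ⟨φ', g', P.erase v, D, k1, sdiff_lt hv hvD fun u hu huD => ⟨mem_of_mem_erase hu, huD, ne_of_mem_erase hu⟩, ?_⟩
    have := hitN_le1 (S.σ.symm v) (fun u hu => (k2 u hu).imp id (hits2 u))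
    have h4 := Finset.card_erase_add_one hv
    omega
  have hyK : S.σ.symm v ∉ K := fun hh => (hKfull _ hh (S.σ_ne_symm hT.1.1).symm (fun e => hz e.symm)).1 p2
  -- after the swap
  have after : ∀ D2, insert v D ⊆ D2 → S.St φ1 g1 P D2 → (∀ u ∈ P, S.tri u z → u ∈ D2) →
      ∃ φ' g', S.St φ' g' (P.erase v) (D2.erase v) ∧
        (∀ u, S.hit φ' g' (P.erase v) u → (u = z ∧ S.trk P u) ∨ S.hit φ g P u) ∧
        ∀ u, ¬ S.tri v u → u ≠ S.mt v → ∀ w, φ' s(u,w) = Sys.swp φ1 K a a' s(u,w) := by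
    intro D2 hD2 k2 hzD
    have hvD2 : v ∈ D2 := hD2 (mem_insert_self _ _)
    obtain ⟨k3, hh3⟩ := k2.swp ha ha' (x := S.σ v) (z := z) hK (fun u hu e1 e2 => (hKfull u hu e1 e2).2)
      (fun u hu ht => by rw [S.tri_uniq (h.PT u hu) hT ht t1]; exact hvD2) hzD
      (fun hh => hh v hv t1)
    obtain ⟨k4, hh4⟩ := k3.setE hvD2 hd (g' := updV g1 (S.mt v) d) (fun u hu => updV_ne hu)
      (fun _ => ⟨by rw [updV_self]; exact hd, by
        have : updV g1 (S.mt v) d = updV g (S.mt v) d := by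
          funext u; rw [hg1]; unfold updV; split_ifs <;> rfl
        rw [this]; exact hgd⟩) (fun hh => absurd hh hnT)
    have q0 : S.updE (Sys.swp φ1 K a a') v d s(v, S.mt v) = d := updE_self
    have q1 : S.updE (Sys.swp φ1 K a a') v d s(S.σ v, S.mt (S.σ v)) = a' := by
      rw [updE_other (other v hT _ (Or.inl rfl)).1 (other v hT _ (Or.inl rfl)).2, swp_in hxK, lx1, Equiv.swap_apply_left]
    have q2 : S.updE (Sys.swp φ1 K a a') v d s(S.σ.symm v, S.mt (S.σ.symm v)) = a := by
      rw [updE_other (other v hT _ (Or.inr rfl)).1 (other v hT _ (Or.inr rfl)).2, swp_out hK (S.adj_mt c2) hyK, ly1]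
    obtain ⟨φ', k5, hh5, ho5⟩ := k4.drop hvD2 (by rw [q0, q1]; exact hda') (by rw [q0, q2]; exact had) (by rw [q1, q2]; exact haa.symm)
    refine ⟨φ', _, k5, ?_, ?_⟩
    · intro u hu
      rcases hh4 u (hh5 u hu) with ⟨_, hh⟩ | ⟨rfl, _, hh⟩
      · rcases hh3 u hh with ⟨_, hh⟩ | hh
        · exact Or.inr (hits2 u hh)
        · exact Or.inl hh
      · rw [updV_self] at hh; exact absurd rfl hh
    · intro u hu hu' w
      rw [ho5 u hu w, updE_other (fun e => hu (Or.inl e)) hu']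
  by_cases hfz : ∀ u ∈ P, S.tri u z → u ∈ insert v D
  · obtain ⟨φ', g', k1, k2, _⟩ := after _ (Finset.Subset.refl _) h2 hfz
    rw [Finset.erase_insert hvD] at k1
    refine ⟨φ', g', P.erase v, D, k1, sdiff_lt hv hvD fun u hu huD => ⟨mem_of_mem_erase hu, huD, ne_of_mem_erase hu⟩, ?_⟩
    have := hitN_le1 z (fun u hu => (k2 u hu).imp (fun e => e.1) id)
    have h4 := Finset.card_erase_add_one hv
    omega
  push Not at hfz
  obtain ⟨v', hv', htz, hvD'⟩ := hfz
  have hT' := h.PT v' hv'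
  have hvv : v' ≠ v := fun e => hvD' (by rw [e]; exact mem_insert_self _ _)
  have hvD'' : v' ∉ D := fun e => hvD' (mem_insert_of_mem e)
  have pm' : S.pend P (S.mt v') := Vv_pend (S.Vv_mt hT'.1) (fun hh => (h.ff v' hv' hvD'' hh).1)
  have hav := avoid v' hT' (S.tri_pend hT' hv' (Or.inl rfl)) pm'
  have ntrk : ¬ S.trk P z := fun hh => hh v' hv' htz
  have tt1 : S.tri v' (S.σ v') := Or.inr (Or.inl rfl)
  have tt2 : S.tri v' (S.σ.symm v') := Or.inr (Or.inr rfl)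
  have nK : ∀ u, S.tri v' u → u ≠ z → u ∉ K := fun u hu hne hh =>
    (hKfull u hh (fun e => hvv (S.tri_uniq hT' hT hu (by rw [e]; exact t1))) hne).1 (S.tri_pend hT' hv' hu)
  have pz : p = S.mt z := by
    by_contra hh
    exact (h2.ul (S.tri_pend hT' hv' htz)).2.2 p hzp hh (hmem3 _ hzc)
  rw [pz] at hzc
  -- labels after swap
  have lab' : ∀ φ' : Sym2 V → Fin 5, (∀ u, ¬ S.tri v u → u ≠ S.mt v → ∀ w, φ' s(u,w) = Sys.swp φ1 K a a' s(u,w)) →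
      d ≠ φ' s(S.σ v', S.mt (S.σ v')) ∧ d ≠ φ' s(S.σ.symm v', S.mt (S.σ.symm v')) ∧
      φ' s(S.σ v', S.mt (S.σ v')) ≠ φ' s(S.σ.symm v', S.mt (S.σ.symm v')) := by
    intro φ' hφ
    have e1 := hφ (S.σ v') (fun hh => hvv (S.tri_uniq hT' hT tt1 hh)) (other v' hT' _ (Or.inl rfl)).2 (S.mt (S.σ v'))
    have e2 := hφ (S.σ.symm v') (fun hh => hvv (S.tri_uniq hT' hT tt2 hh)) (other v' hT' _ (Or.inr rfl)).2 (S.mt (S.σ.symm v'))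
    rw [e1, e2]
    have hdm : ∀ c : Fin 5, (c = a ∨ c = a') → d ≠ c := by
      rintro c (e | e) <;> rw [e] <;> assumption
    have hfr := fr1 v' hv' hvD''
    rcases htz with e | e | e
    · exact absurd hzK (by rw [e]; exact hav.1)
    · rw [e] at hzc
      rw [swp_in (by rw [← e]; exact hzK), swp_out hK (S.adj_mt (S.tri_core hT' tt2)) (nK _ tt2 (by rw [e]; exact (S.σ_ne_symm hT'.1.1).symm)), ← hfr]
      exact ⟨hdm _ (swap_mem hzc), hdm _ hzc, (swap_eq hzc).resolve_right haa⟩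
    · rw [e] at hzc
      rw [swp_in (u := S.σ.symm v') (by rw [← e]; exact hzK), swp_out hK (S.adj_mt (S.tri_core hT' tt1)) (nK _ tt1 (by rw [e]; exact (S.σ_ne_symm hT'.1.1))), hfr]
      exact ⟨hdm _ hzc, hdm _ (swap_mem hzc), ((swap_eq hzc).resolve_right haa).symm⟩
  -- finishing v'
  have fin' : ∀ (φ' : Sym2 V → Fin 5) (g' : V → Fin 5) (D2 : Finset V), S.St φ' g' (P.erase v) D2 → v' ∈ D2 → (S.isT (S.mt v') → S.mt v' ∈ D2) →
      (∀ u, ¬ S.tri v u → u ≠ S.mt v → ∀ w, φ' s(u,w) = Sys.swp φ1 K a a' s(u,w)) →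
      ∃ φ'', S.St φ'' g' ((P.erase v).erase v') (D2.erase v') ∧
        ∀ u, S.hit φ'' g' ((P.erase v).erase v') u → (u = S.mt v' ∧ S.trk (P.erase v) u) ∨ S.hit φ' g' (P.erase v) u := by
    intro φ' g' D2 k1 hvD2 hmD hφ
    obtain ⟨k2, hh2⟩ := k1.setE hvD2 hd (g' := g') (fun _ _ => rfl) (fun hn => ⟨k1.gl _ hn, k1.good _ hn⟩) hmD
    have hlab := lab' φ' hφ
    have q0 : S.updE φ' v' d s(v', S.mt v') = d := updE_self
    have o1 := otherG v' v' hT' hT' _ (Or.inl rfl)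
    have o2 := otherG v' v' hT' hT' _ (Or.inr rfl)
    obtain ⟨φ'', k3, hh3, _⟩ := k2.drop hvD2 (by rw [q0, updE_other o1.1 o1.2]; exact hlab.1)
      (by rw [q0, updE_other o2.1 o2.2]; exact hlab.2.1)
      (by rw [updE_other o1.1 o1.2, updE_other o2.1 o2.2]; exact hlab.2.2)
    refine ⟨φ'', k3, fun u hu => ?_⟩
    rcases hh2 u (hh3 u hu) with hh | hh
    · exact Or.inr hh.2
    · exact Or.inl ⟨hh.1, hh.2.1⟩
  have hv'e : v' ∈ P.erase v := mem_erase.2 ⟨hvv, hv'⟩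
  have cc1 := Finset.card_erase_add_one hv
  have cc2 := Finset.card_erase_add_one hv'e
  by_cases hTT : S.isT (S.mt v')
  · obtain ⟨hm1, hm2, _⟩ := h.ff v' hv' hvD'' hTT
    have hmv : S.mt v' ≠ v := by
      intro e; apply hnT; rw [← e, S.Vv_mt_mt hT'.1]; exact hT'
    have hmv' := S.mt_ne hT'.1.1
    have hv2 : v ∉ insert v' (insert (S.mt v') D) := by
      simp only [mem_insert, not_or]; exact ⟨hvv.symm, hmv.symm, hvD⟩
    have h3 := h2.mark (D' := insert v (insert v' (insert (S.mt v') D))) (Finset.insert_subset_insert _ ((Finset.subset_insert _ _).trans (Finset.subset_insert _ _))) (by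
        intro u hu; simp only [mem_insert] at hu
        rcases hu with rfl | rfl | rfl | hu
        · exact hv
        · exact hv'
        · exact hm1
        · exact h.DP hu) (by
        intro u hu huD hh
        simp only [mem_insert] at hu huD ⊢
        rcases hu with rfl | rfl | rfl | hu
        · exact absurd (Or.inl rfl) huD
        · exact Or.inr (Or.inr (Or.inl rfl))
        · rw [S.Vv_mt_mt hT'.1]; exact Or.inr (Or.inl rfl)
        · exact absurd (Or.inr hu) huD)
    obtain ⟨φ', g', k1, k2, k3⟩ := after _ (Finset.insert_subset_insert _ ((Finset.subset_insert _ _).trans (Finset.subset_insert _ _))) h3 (by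
      intro u hu ht
      rw [S.tri_uniq (h.PT u hu) hT' ht htz]; simp)
    rw [Finset.erase_insert hv2] at k1
    obtain ⟨φ'', k4, k5⟩ := fin' φ' g' _ k1 (mem_insert_self _ _) (fun _ => by simp) k3
    rw [Finset.erase_insert (by simp only [mem_insert, not_or]; exact ⟨hmv'.symm, hvD''⟩)] at k4
    refine ⟨φ'', g', _, _, k4, sdiff_lt hv hvD fun u hu huD => ?_, ?_⟩
    · rw [mem_insert, not_or] at huD
      exact ⟨mem_of_mem_erase (mem_of_mem_erase hu), huD.2, ne_of_mem_erase (mem_of_mem_erase hu)⟩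
    · have := hitN_le (S := S) (φ := φ) (g := g) (P := P) (φ' := φ'') (g' := g') (P' := (P.erase v).erase v') (by
        intro u hu
        rcases k5 u hu with ⟨rfl, hh⟩ | hh
        · exact absurd (Or.inl rfl) (hh (S.mt v') (mem_erase.2 ⟨hmv, hm1⟩))
        · rcases k2 u hh with ⟨rfl, hh⟩ | hh
          · exact absurd hh ntrk
          · exact hh)
      have c3 := Finset.card_insert_of_notMem hm2
      omega
  · have hv2 : v ∉ insert v' D := by
      simp only [mem_insert, not_or]; exact ⟨hvv.symm, hvD⟩
    have h3 := h2.mark (D' := insert v (insert v' D)) (Finset.insert_subset_insert _ (Finset.subset_insert _ _)) (by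
        intro u hu; simp only [mem_insert] at hu
        rcases hu with rfl | rfl | hu
        · exact hv
        · exact hv'
        · exact h.DP hu) (by
        intro u hu huD hh
        simp only [mem_insert] at hu huD ⊢
        rcases hu with rfl | rfl | hu
        · exact absurd (Or.inl rfl) huD
        · exact absurd hh hTT
        · exact absurd (Or.inr hu) huD)
    obtain ⟨φ', g', k1, k2, k3⟩ := after _ (Finset.insert_subset_insert _ (Finset.subset_insert _ _)) h3 (by
      intro u hu ht
      rw [S.tri_uniq (h.PT u hu) hT' ht htz]; simp)
    rw [Finset.erase_insert hv2] at k1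
    obtain ⟨φ'', k4, k5⟩ := fin' φ' g' _ k1 (mem_insert_self _ _) (fun hh => absurd hh hTT) k3
    rw [Finset.erase_insert hvD''] at k4
    refine ⟨φ'', g', _, _, k4, sdiff_lt hv hvD fun u hu huD => ?_, ?_⟩
    · exact ⟨mem_of_mem_erase (mem_of_mem_erase hu), huD, ne_of_mem_erase (mem_of_mem_erase hu)⟩
    · have := hitN_le1 (S := S) (φ := φ) (g := g) (P := P) (φ' := φ'') (g' := g') (P' := (P.erase v).erase v') (S.mt v') (by
        intro u hu
        rcases k5 u hu with ⟨e, _⟩ | hh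
        · exact Or.inl e
        · rcases k2 u hh with ⟨rfl, hh⟩ | hh
          · exact absurd hh ntrk
          · exact Or.inr hh)
      omega

theorem St.run [Fintype V] (n : ℕ) : ∀ {φ g P D}, S.St φ g P D → (P \ D).card ≤ n →
    ∃ φ' g' P' D', S.St φ' g' P' D' ∧ (∀ v ∈ P', v ∉ D' → S.isT (S.mt v)) ∧
      S.hitN φ' g' P' + P'.card + 2 * D'.card ≤ S.hitN φ g P + P.card + 2 * D.card := by
  induction n with
  | zero =>
    intro φ g P D h hn
    refine ⟨φ, g, P, D, h, fun v hv hvD => ?_, le_rfl⟩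
    have : (P \ D) = ∅ := Finset.card_eq_zero.1 (by omega)
    have h2 : v ∈ P \ D := mem_sdiff.2 ⟨hv, hvD⟩
    rw [this] at h2; simp at h2
  | succ n ih =>
    intro φ g P D h hn
    by_cases hc : ∀ v ∈ P, v ∉ D → S.isT (S.mt v)
    · exact ⟨φ, g, P, D, h, hc, le_rfl⟩
    push Not at hc
    obtain ⟨v, hv, hvD, hnT⟩ := hc
    obtain ⟨φ1, g1, P1, D1, h1, h2, h3⟩ := h.step hv hvD hnT
    obtain ⟨φ2, g2, P2, D2, k1, k2, k3⟩ := ih h1 (by omega)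
    exact ⟨φ2, g2, P2, D2, k1, k2, k3.trans h3⟩

end Sys
end SysSec6


section SysSec7
open scoped Classical
namespace Sys
variable {V : Type*} (S : Sys V)

def mixV (C : V → Fin 5) (v : V) : Prop := ¬ (C (S.σ.symm v) < 3 ↔ C v < 3)
def nrmV (lab C : V → Fin 5) (v : V) : Prop := normal5 (C v) (C (S.σ.symm v)) (lab v) (C (S.σ v)) (lab (S.σ v))
def proV (lab C : V → Fin 5) (v : V) : Prop := C (S.σ.symm v) ≠ C v ∧ C (S.σ.symm v) ≠ lab v ∧ C v ≠ lab v

noncomputable def orb [Fintype V] (r : V) : Finset V := univ.filter (fun v => S.σ.SameCycle r v)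

variable {S}

theorem same_iter (r : V) (j : ℕ) : S.σ.SameCycle r (S.σ^[j] r) := ⟨j, by
  rw [zpow_natCast, Equiv.Perm.iterate_eq_pow]⟩

theorem iter_mod [Fintype V] (r : V) (j : ℕ) : S.σ^[j % S.per r] r = S.σ^[j] r :=
  Function.iterate_mod_minimalPeriod_eq

theorem iter_inj [Fintype V] {r : V} {i j : ℕ} (h : S.σ^[i] r = S.σ^[j] r) : i % S.per r = j % S.per r := by
  rw [← iter_mod r i, ← iter_mod r j] at h
  exact Function.iterate_injOn_Iio_minimalPeriod (Nat.mod_lt _ (S.per_pos r)) (Nat.mod_lt _ (S.per_pos r)) h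

theorem exists_iter [Fintype V] {r v : V} (h : S.σ.SameCycle r v) : ∃ j, S.σ^[j] r = v := by
  obtain ⟨i, hi⟩ := h.exists_nat_pow_eq
  exact ⟨i, by rw [Equiv.Perm.iterate_eq_pow]; exact hi⟩

theorem orb_sum [Fintype V] (r : V) (k : ℕ) (f : V → ℕ) :
    ∑ v ∈ S.orb r, f v = ∑ j ∈ range (S.per r), f (S.σ^[j + k] r) := by
  symm
  refine Finset.sum_nbij (fun j => S.σ^[j + k] r) ?_ ?_ ?_ (fun _ _ => rfl)
  · intro j _
    exact mem_filter.2 ⟨mem_univ _, same_iter r _⟩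
  · intro i hi j hj h
    have hi := mem_range.1 (mem_coe.1 hi)
    have hj := mem_range.1 (mem_coe.1 hj)
    have h1 : S.σ^[k] (S.σ^[i] r) = S.σ^[k] (S.σ^[j] r) := by
      rw [← Function.iterate_add_apply, ← Function.iterate_add_apply, Nat.add_comm k i, Nat.add_comm k j]; exact h
    have h2 := iter_inj (S.σ.injective.iterate k h1)
    rwa [Nat.mod_eq_of_lt hi, Nat.mod_eq_of_lt hj] at h2
  · intro v hv
    obtain ⟨i, hi⟩ := exists_iter (mem_filter.1 (mem_coe.1 hv)).2
    have hp := S.per_pos r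
    refine ⟨(i + (S.per r - 1) * k) % S.per r, mem_coe.2 (mem_range.2 (Nat.mod_lt _ hp)), ?_⟩
    show S.σ^[_ + k] r = v
    rw [Nat.add_comm, Function.iterate_add_apply, iter_mod, ← Function.iterate_add_apply, ← hi, ← iter_mod r i, ← iter_mod]
    congr 1
    obtain ⟨m, hm⟩ : ∃ m, S.per r = m + 1 := ⟨S.per r - 1, by omega⟩
    have : k + (i + (S.per r - 1) * k) = i + S.per r * k := by rw [hm]; simp; ring
    rw [this, Nat.add_mul_mod_self_left]

noncomputable def vcost (S : Sys V) (lab C : V → Fin 5) (v : V) : ℕ :=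
  (if S.mixV C v then 1 else 0) + (if ¬ S.nrmV lab C v then 1 else 0)

theorem seq_orb [Fintype V] {lab : V → Fin 5} {r : V} {B : ℕ}
    (h : SeqCol (S.per r) (fun j => lab (S.σ^[j] r)) B) :
    ∃ C : V → Fin 5, (∀ v, S.σ.SameCycle r v → S.proV lab C v) ∧ ∑ v ∈ S.orb r, S.vcost lab C v ≤ B := by
  obtain ⟨c, h1, h2, h3⟩ := h
  obtain ⟨C, hC⟩ : ∃ C : V → Fin 5, ∀ j, C (S.σ^[j] r) = c j := by
    refine ⟨fun v => if h : ∃ j, S.σ^[j] r = v then c h.choose else 0, fun j => ?_⟩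
    have hh : ∃ i, S.σ^[i] r = S.σ^[j] r := ⟨j, rfl⟩
    show (if h : ∃ i, S.σ^[i] r = S.σ^[j] r then c h.choose else 0) = c j
    rw [dif_pos hh]
    have := iter_inj hh.choose_spec
    rw [← per_mod h1 hh.choose, this, per_mod h1]
  have hs : ∀ j, S.σ.symm (S.σ^[j+1] r) = S.σ^[j] r := fun j => by
    rw [Function.iterate_succ_apply', Equiv.symm_apply_apply]
  have hn : ∀ j, S.σ (S.σ^[j] r) = S.σ^[j+1] r := fun j => by
    rw [Function.iterate_succ_apply']
  refine ⟨C, ?_, ?_⟩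
  · intro v hv
    obtain ⟨i, hi⟩ := exists_iter hv
    obtain ⟨j, hj⟩ : ∃ j, S.σ^[j+1] r = v := by
      have hp := S.per_pos r
      refine ⟨i + S.per r - 1, ?_⟩
      rw [show i + S.per r - 1 + 1 = i + S.per r by omega, S.iter_per, hi]
    subst hj
    unfold proV
    rw [hs, hC, hC]
    exact h2 j
  · rw [orb_sum r 1]
    refine le_trans (le_of_eq ?_) h3
    unfold seqCost
    rw [Finset.card_filter, Finset.card_filter, ← Finset.sum_add_distrib]
    refine Finset.sum_congr rfl fun j _ => ?_
    unfold vcost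
    have e1 : S.mixV C (S.σ^[j+1] r) ↔ mixedAt c j := by
      unfold mixV mixedAt; rw [hs, hC, hC]
    have e2 : S.nrmV lab C (S.σ^[j+1] r) ↔ normAt (fun j => lab (S.σ^[j] r)) c j := by
      unfold nrmV normAt; rw [hs, hn, hC, hC, hC]
    simp only [e1, e2]

end Sys
end SysSec7


theorem fresh_fact : ∀ a c α β : Fin 5, a < 3 → c < 3 → c ≠ a → ((α = 3 ∧ β = 4) ∨ (α = 4 ∧ β = 3)) →
    normal5 (thirdC a c) α c β a ∧ normal5 α β a (thirdC a c) c ∧ ¬ α < 3 ∧ ¬ β < 3 ∧ α ≠ β ∧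
    α ≠ thirdC a c ∧ α ≠ c ∧ α ≠ a ∧ β ≠ thirdC a c ∧ β ≠ a ∧ thirdC a c ≠ a ∧ thirdC a c ≠ c := by
  decide +kernel

section SysSec8
open scoped Classical
namespace Sys
variable {V : Type*} {S : Sys V}

def lab (S : Sys V) (φ : Sym2 V → Fin 5) (u : V) : Fin 5 := φ s(u, S.mt u)
def alph (S : Sys V) (φ : Sym2 V → Fin 5) (v : V) : Fin 5 :=
  if S.lab φ (S.σ v) ≤ S.lab φ (S.σ (S.mt v)) then 3 else 4

noncomputable def fcost (S : Sys V) (F : Finset V) (lab C : V → Fin 5) (v : V) : ℕ :=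
  (if S.mixV C v ∧ v ∉ F then 1 else 0) + (if ¬ S.nrmV lab C v then 1 else 0)

noncomputable def wt (S : Sys V) (φ : Sym2 V → Fin 5) (g : V → Fin 5) (P D : Finset V) (v : V) : ℕ :=
  (if S.t v = false then 1 else 0) + (if S.hit φ g P v then 2 else 0) + (if v ∈ D then 4 else 0)

theorem fcost_le (F : Finset V) (lab C : V → Fin 5) (v : V) : S.fcost F lab C v ≤ S.vcost lab C v := by
  unfold fcost vcost
  by_cases h1 : S.mixV C v <;> by_cases h2 : v ∈ F <;> simp [h1, h2]

theorem per_T [Fintype V] {u : V} (h : S.isT u) : S.per u = 3 := by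
  have h1 := S.per3 h.1.1
  have h2 : S.per u ∣ 3 := Function.IsPeriodicPt.minimalPeriod_dvd (f := S.σ) (x := u) (n := 3) h.2.1
  have := Nat.le_of_dvd (by norm_num) h2
  omega

theorem tri_iter {u : V} (h : S.isT u) (j : ℕ) : S.tri u (S.σ^[j] u) := by
  induction j with
  | zero => exact Or.inl rfl
  | succ j ih => rw [Function.iterate_succ_apply']; exact S.tri_σ h ih

theorem tri_same {u v : V} (h : S.tri u v) : S.σ.SameCycle u v := by
  rcases h with rfl | rfl | rfl
  · exact Equiv.Perm.SameCycle.refl _ _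
  · exact ⟨1, by simp⟩
  · exact ⟨-1, by simp⟩

theorem T_same [Fintype V] {u v : V} (h : S.isT u) (hs : S.σ.SameCycle u v) (hv : S.isT v) : v = u := by
  obtain ⟨j, hj⟩ := exists_iter hs
  exact S.isT_not h hv.1 (by rw [← hj]; exact tri_iter h j)

def LocC (S : Sys V) [Fintype V] (φ : Sym2 V → Fin 5) (g : V → Fin 5) (P D : Finset V) (r : V) (C : V → Fin 5) : Prop :=
  (∀ v, S.σ.SameCycle r v → S.proV (S.lab φ) C v) ∧
  ∑ v ∈ S.orb r, S.fcost (P \ D) (S.lab φ) C v ≤ ∑ v ∈ S.orb r, S.wt φ g P D v ∧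
  ∀ v, S.σ.SameCycle r v → v ∈ P → v ∉ D → C v = thirdC (S.lab φ (S.σ v)) (S.lab φ v) ∧ C (S.σ.symm v) = S.alph φ v

theorem LocC.trans [Fintype V] {φ g P D} {r u : V} {C} (h : S.LocC φ g P D u C) (hs : S.σ.SameCycle r u) : S.LocC φ g P D r C := by
  have ho : S.orb r = S.orb u := by
    ext v; unfold orb; simp only [mem_filter, mem_univ, true_and]
    exact ⟨fun h => hs.symm.trans h, fun h => hs.trans h⟩
  refine ⟨fun v hv => h.1 v (hs.symm.trans hv), by rw [ho]; exact h.2.1, fun v hv => h.2.2 v (hs.symm.trans hv)⟩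

theorem loc_nT [Fintype V] {φ g P D} (h : S.St φ g P D) {r : V} (hr : S.nT r) : ∃ C, S.LocC φ g P D r C := by
  have hl : ∀ j, S.lab φ (S.σ^[j] r) < 3 := fun j => h.pm _ (S.nT_pend (S.nT_iter hr j))
  have := cyc_bound (S.CSv hr.1) (S.LSv (g := S.lab φ) hl) (S.LSv (g := g) (fun j => h.gl _ (S.nT_iter hr j)))
    (by intro j hj
        show g _ = g (S.σ^[j+1] r)
        rw [Function.iterate_succ_apply']; exact h.gt _ (S.nT_iter hr j) hj)
    (fun ho => S.ct3 hr ho) (h.good r hr)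
  obtain ⟨C, h1, h2⟩ := seq_orb this
  refine ⟨C, h1, (Finset.sum_le_sum fun v _ => fcost_le _ _ _ v).trans (h2.trans ?_), ?_⟩
  · rw [orb_sum r 0, cnt_range, distL, Finset.card_filter, Finset.card_filter, Finset.mul_sum, ← Finset.sum_add_distrib]
    refine Finset.sum_le_sum fun j _ => ?_
    rw [Nat.add_zero]
    unfold wt
    have hp := S.nT_pend (P := P) (S.nT_iter hr j)
    have htr : S.trk P (S.σ^[j] r) := fun u hu ht => (S.nT_iter hr j).2 u (h.PT u hu) ht
    by_cases e : S.lab φ (S.σ^[j] r) = g (S.σ^[j] r)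
    · simp [e]; omega
    · have hh : S.hit φ g P (S.σ^[j] r) := ⟨htr, _, h.ul hp, e⟩
      simp [e, hh]
  · intro v hv hvP
    obtain ⟨j, hj⟩ := exists_iter hv
    have := S.nT_iter hr j
    rw [hj] at this
    exact absurd (Or.inl rfl) (this.2 v (h.PT v hvP))

theorem loc_D [Fintype V] {φ g P D} (h : S.St φ g P D) {r : V} (hr : r ∈ D) : ∃ C, S.LocC φ g P D r C := by
  have hT := h.PT r (h.DP hr)
  have hl : ∀ j, S.lab φ (S.σ^[j] r) < 3 := fun j => h.pm _ (S.tri_pend hT (h.DP hr) (tri_iter hT j))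
  have hls := (S.LSv (g := S.lab φ) hl)
  have : SeqCol (S.per r) (fun j => S.lab φ (S.σ^[j] r)) 6 := by
    rw [per_T hT] at hls ⊢; exact tri_bound hls
  obtain ⟨C, h1, h2⟩ := seq_orb this
  refine ⟨C, h1, (Finset.sum_le_sum fun v _ => fcost_le _ _ _ v).trans (h2.trans ?_), ?_⟩
  · rw [orb_sum r 0, per_T hT, Finset.sum_range_succ, Finset.sum_range_succ, Finset.sum_range_one]
    simp only [Nat.add_zero, Function.iterate_zero, id_eq]
    have e0 : S.t r = false := hT.1.2.1
    have e2 : S.t (S.σ (S.σ r)) = false := by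
      rw [← S.isT_symm hT]; exact hT.1.2.2
    simp [wt, e0, e2, hr]; omega
  · intro v hv hvP hvD
    rw [T_same hT hv (h.PT v hvP)] at hvD
    exact absurd hr hvD

theorem loc_F [Fintype V] {φ g P D} (h : S.St φ g P D) {r : V} (hr : r ∈ P) (hrD : r ∉ D) (hTT : S.isT (S.mt r)) :
    ∃ C, S.LocC φ g P D r C := by
  have hT := h.PT r hr
  have hs := S.isT_symm hT
  have hne1 : S.σ r ≠ r := hT.1.1
  have hne2 : S.σ (S.σ r) ≠ r := S.σσ r hne1
  have hne3 : S.σ (S.σ r) ≠ S.σ r := S.core_σ hT.1.1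
  have t0 : S.tri r r := Or.inl rfl
  have t1 : S.tri r (S.σ r) := Or.inr (Or.inl rfl)
  have t2 : S.tri r (S.σ (S.σ r)) := by rw [← hs]; exact Or.inr (Or.inr rfl)
  have hfr := h.fr r hr hrD
  have hff := (h.ff r hr hrD hTT).2.2
  rw [hs] at hfr
  change S.lab φ (S.σ r) = S.lab φ (S.σ (S.σ r)) at hfr
  change S.lab φ r ≠ S.lab φ (S.σ r) at hff
  have la : S.lab φ (S.σ r) < 3 := h.pm _ (S.tri_pend hT hr t1)
  have lc : S.lab φ r < 3 := h.pm _ (S.tri_pend hT hr t0)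
  obtain ⟨β, hβ⟩ : ∃ β : Fin 5, (S.alph φ r = 3 ∧ β = 4) ∨ (S.alph φ r = 4 ∧ β = 3) := by
    unfold alph
    split_ifs
    · exact ⟨4, Or.inl ⟨rfl, rfl⟩⟩
    · exact ⟨3, Or.inr ⟨rfl, rfl⟩⟩
  obtain ⟨f1, f2, f3, f4, f5, f6, f7, f8, f9, f10, f11, f12⟩ := fresh_fact _ _ _ _ la lc hff hβ
  obtain ⟨C, hC0, hC1, hC2⟩ : ∃ C : V → Fin 5, C r = thirdC (S.lab φ (S.σ r)) (S.lab φ r) ∧ C (S.σ r) = β ∧ C (S.σ (S.σ r)) = S.alph φ r :=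
    ⟨fun x => if x = r then thirdC (S.lab φ (S.σ r)) (S.lab φ r) else if x = S.σ r then β else S.alph φ r,
      by simp, by simp [hne1], by simp [hne2, hne3]⟩
  have s2 : S.σ.symm (S.σ (S.σ r)) = S.σ r := by simp
  have s1 : S.σ.symm (S.σ r) = r := by simp
  have s3 : S.σ (S.σ (S.σ r)) = r := hT.2.1
  refine ⟨C, ?_, ?_, ?_⟩
  · intro v hv
    obtain ⟨j, hj⟩ := exists_iter hv
    have := tri_iter hT j
    rw [hj] at this
    unfold proV
    rcases this with rfl | rfl | rfl
    · rw [hs, hC0, hC2]; exact ⟨f6, f7, f12⟩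
    · rw [s1, hC0, hC1]; exact ⟨f9.symm, f11, f10⟩
    · rw [hs, s2, hC1, hC2, ← hfr]; exact ⟨f5.symm, f10, f8⟩
  · rw [orb_sum r 0, orb_sum r 0, per_T hT]
    simp only [Finset.sum_range_succ, Finset.sum_range_zero, Nat.add_zero, Nat.zero_add, Function.iterate_zero, id_eq, Function.iterate_succ_apply']
    have e0 : S.t r = false := hT.1.2.1
    have e2 : S.t (S.σ (S.σ r)) = false := by
      rw [← hs]; exact hT.1.2.2
    have n0 : S.nrmV (S.lab φ) C r := by
      unfold nrmV; rw [hs, hC0, hC1, hC2]; exact f1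
    have n2 : S.nrmV (S.lab φ) C (S.σ (S.σ r)) := by
      unfold nrmV; rw [s2, s3, hC0, hC1, hC2, ← hfr]; exact f2
    have m2 : ¬ S.mixV C (S.σ (S.σ r)) := by
      unfold mixV; rw [s2, hC1, hC2]; simp [f3, f4]
    have c0 : S.fcost (P \ D) (S.lab φ) C r = 0 := by
      unfold fcost; simp [n0, hr, hrD]
    have c2 : S.fcost (P \ D) (S.lab φ) C (S.σ (S.σ r)) = 0 := by
      unfold fcost; simp [n2, m2]
    have c1 : S.fcost (P \ D) (S.lab φ) C (S.σ r) ≤ 2 := by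
      unfold fcost; split_ifs <;> norm_num
    have w0 : 1 ≤ S.wt φ g P D r := by unfold wt; simp only [e0, if_true]; omega
    have w2 : 1 ≤ S.wt φ g P D (S.σ (S.σ r)) := by unfold wt; simp only [e2, if_true]; omega
    omega
  · intro v hv hvP hvD
    rw [T_same hT hv (h.PT v hvP), hs]
    exact ⟨hC0, hC2⟩

theorem loc [Fintype V] {φ g P D} (h : S.St φ g P D) (hTT : ∀ v ∈ P, v ∉ D → S.isT (S.mt v)) {r : V} (hr : S.pend P r) :
    ∃ C, S.LocC φ g P D r C := by
  by_cases hn : S.nT r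
  · exact loc_nT h hn
  · have : ∃ u, S.isT u ∧ S.tri u r := by
      by_contra hh; push Not at hh; exact hn ⟨hr.1, hh⟩
    obtain ⟨u, hu, ht⟩ := this
    have huP := hr.2 u hu ht
    have hs : S.σ.SameCycle r u := (tri_same ht).symm
    by_cases huD : u ∈ D
    · obtain ⟨C, hC⟩ := loc_D h huD
      exact ⟨C, hC.trans hs⟩
    · obtain ⟨C, hC⟩ := loc_F h huP huD (hTT u huP huD)
      exact ⟨C, hC.trans hs⟩

theorem pend_iter {P : Finset V} {v : V} (h : S.pend P v) (k : ℕ) : S.pend P (S.σ^[k] v) := by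
  induction k with
  | zero => exact h
  | succ k ih => rw [Function.iterate_succ_apply']; exact S.pend_σ.2 ih

theorem pend_same [Fintype V] {P : Finset V} {u v : V} (hs : S.σ.SameCycle u v) (h : S.pend P u) : S.pend P v := by
  obtain ⟨j, hj⟩ := exists_iter hs
  rw [← hj]; exact pend_iter h j

theorem glue [Fintype V] {φ g P D} (h : S.St φ g P D) (hTT : ∀ v ∈ P, v ∉ D → S.isT (S.mt v)) :
    ∃ C : V → Fin 5, (∀ v, S.pend P v → S.proV (S.lab φ) C v) ∧
      ∑ v ∈ univ.filter (fun v => S.pend P v), S.fcost (P \ D) (S.lab φ) C v ≤ ∑ v ∈ univ.filter (fun v => S.pend P v), S.wt φ g P D v ∧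
      ∀ v ∈ P, v ∉ D → C v = thirdC (S.lab φ (S.σ v)) (S.lab φ v) ∧ C (S.σ.symm v) = S.alph φ v := by
  have hex : ∀ r : V, ∃ C, S.pend P r → S.LocC φ g P D r C := by
    intro r
    by_cases hr : S.pend P r
    · obtain ⟨C, hC⟩ := loc h hTT hr
      exact ⟨C, fun _ => hC⟩
    · exact ⟨fun _ => 0, fun hh => absurd hh hr⟩
  choose Cl hCl using hex
  letI st := Equiv.Perm.SameCycle.setoid S.σ
  obtain ⟨rep, hrep, hrep'⟩ : ∃ rep : V → V, (∀ v, S.σ.SameCycle (rep v) v) ∧ ∀ u v, S.σ.SameCycle u v → rep u = rep v :=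
    ⟨fun v => Quotient.out (Quotient.mk st v), fun v => Quotient.exact (Quotient.out_eq (Quotient.mk st v)), fun u v huv => by
      show Quotient.out (Quotient.mk st u) = Quotient.out (Quotient.mk st v)
      rw [Quotient.sound (s := st) huv]⟩
  have sσ : ∀ v, S.σ.SameCycle v (S.σ v) := fun v => ⟨1, by simp⟩
  have ss : ∀ v, S.σ.SameCycle v (S.σ.symm v) := fun v => ⟨-1, by simp⟩
  obtain ⟨C, hC⟩ : ∃ C : V → Fin 5, ∀ r v, rep v = r → C v = Cl r v ∧ C (S.σ v) = Cl r (S.σ v) ∧ C (S.σ.symm v) = Cl r (S.σ.symm v) :=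
    ⟨fun v => Cl (rep v) v, fun r v hv => ⟨by simp only [hv], by simp only [← hrep' _ _ (sσ v), hv], by simp only [← hrep' _ _ (ss v), hv]⟩⟩
  have hpr : ∀ v, S.pend P v → S.pend P (rep v) := fun v hv => pend_same (hrep v).symm hv
  refine ⟨C, ?_, ?_, ?_⟩
  · intro v hv
    obtain ⟨e1, _, e3⟩ := hC _ v rfl
    unfold proV; rw [e1, e3]
    exact (hCl _ (hpr v hv)).1 v (hrep v)
  · rw [← Finset.sum_fiberwise (univ.filter (fun v => S.pend P v)) rep, ← Finset.sum_fiberwise (univ.filter (fun v => S.pend P v)) rep]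
    refine Finset.sum_le_sum fun r _ => ?_
    by_cases hr : ∃ v, S.pend P v ∧ rep v = r
    · obtain ⟨v0, hv0, hr0⟩ := hr
      have hpr0 : S.pend P r := by rw [← hr0]; exact hpr v0 hv0
      have hrr : rep r = r := by
        have := hrep' _ _ (hrep v0)
        rw [hr0] at this; exact this
      have hset : (univ.filter (fun v => S.pend P v)).filter (fun v => rep v = r) = S.orb r := by
        ext v
        unfold orb
        simp only [mem_filter, mem_univ, true_and]
        constructor
        · rintro ⟨_, e⟩; rw [← e]; exact hrep v
        · intro hs; exact ⟨pend_same hs hpr0, by rw [← hrep' _ _ hs, hrr]⟩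
      rw [hset]
      refine le_trans (le_of_eq ?_) (hCl r hpr0).2.1
      refine Finset.sum_congr rfl fun v hv => ?_
      obtain ⟨e1, e2, e3⟩ := hC r v (by
        have := (mem_filter.1 hv).2
        rw [← hrep' _ _ this, hrr])
      unfold fcost mixV nrmV
      rw [e1, e2, e3]
    · push Not at hr
      have : (univ.filter (fun v => S.pend P v)).filter (fun v => rep v = r) = ∅ := by
        ext v; simp only [mem_filter, mem_univ, true_and, notMem_empty, iff_false, not_and]
        exact hr v
      rw [this]; simp
  · intro v hv hvD
    obtain ⟨e1, _, e3⟩ := hC _ v rfl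
    rw [e1, e3]
    exact (hCl _ (hpr v (S.tri_pend (h.PT v hv) hv (Or.inl rfl)))).2.2 v (hrep v) hv hvD

end Sys
end SysSec8


theorem cs_full : ∀ a b c : Fin 5, a < 3 → b < 3 → c < 3 → a ≠ b → a ≠ c → b ≠ c → ({a, b, c} : Finset (Fin 5)) = {0,1,2} := by
  decide +kernel
theorem cs_op : ∀ a b c : Fin 5, ¬ a < 3 → ¬ b < 3 → a ≠ b → ({a, b, c} : Finset (Fin 5)) = {3,4,c} := by
  decide +kernel
theorem cs_low : ∀ l : Fin 5, l < 3 → ∀ A B : Finset (Fin 5), (A = {0,1,2} ∨ A = {3,4,l}) → (B = {0,1,2} ∨ B = {3,4,l}) →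
    (A ∪ B).card = 3 ∨ (A ∪ B).card = 5 := by
  intro l hl A B hA hB
  rcases hA with rfl | rfl <;> rcases hB with rfl | rfl <;> revert l <;> decide +kernel
theorem cs_high : ∀ l : Fin 5, l < 3 → (({3,4,l} : Finset (Fin 5)) ∪ {3,4,l}).card = 3 := by
  decide +kernel
theorem cs_fresh : ∀ l a b : Fin 5, l < 3 → a < 3 → b < 3 → l ≠ a → l ≠ b →
    ((({thirdC a l, if a ≤ b then 3 else 4, l} : Finset (Fin 5)) ∪ {thirdC b l, if b ≤ a then 3 else 4, l}).card = 3 ∨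
    (({thirdC a l, if a ≤ b then 3 else 4, l} : Finset (Fin 5)) ∪ {thirdC b l, if b ≤ a then 3 else 4, l}).card = 5) := by
  decide +kernel

section SysSec9
open scoped Classical
namespace Sys
variable {V : Type*} {S : Sys V}

/-- the colours seen at a vertex -/
noncomputable def cols (S : Sys V) (c : Sym2 V → Fin 5) (v : V) : Finset (Fin 5) :=
  univ.filter (fun k => ∃ w, S.G.Adj v w ∧ c s(v,w) = k)
def EN (S : Sys V) (c : Sym2 V → Fin 5) (v w : V) : Prop :=
  (S.cols c v ∪ S.cols c w).card = 3 ∨ (S.cols c v ∪ S.cols c w).card = 5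
def bad (S : Sys V) (c : Sym2 V → Fin 5) (e : Sym2 V) : Prop :=
  ∃ v w, e = s(v,w) ∧ S.G.Adj v w ∧ ¬ S.EN c v w

theorem EN_symm {c : Sym2 V → Fin 5} {v w : V} : S.EN c v w ↔ S.EN c w v := by
  unfold EN; rw [Finset.union_comm]

theorem cols3 {c : Sym2 V → Fin 5} {v p q r : V} (h : ∀ w, S.G.Adj v w ↔ (w = p ∨ w = q ∨ w = r)) :
    S.cols c v = {c s(v,p), c s(v,q), c s(v,r)} := by
  ext k
  unfold cols
  simp only [mem_filter, mem_univ, true_and, mem_insert, mem_singleton]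
  constructor
  · rintro ⟨w, hw, rfl⟩
    rcases (h w).1 hw with rfl | rfl | rfl <;> simp
  · rintro (rfl | rfl | rfl)
    · exact ⟨p, (h p).2 (by simp), rfl⟩
    · exact ⟨q, (h q).2 (by simp), rfl⟩
    · exact ⟨r, (h r).2 (by simp), rfl⟩

noncomputable def fin (S : Sys V) (φ : Sym2 V → Fin 5) (P : Finset V) (C : V → Fin 5) (e : Sym2 V) : Fin 5 :=
  if h : ∃ v, S.pend P v ∧ e = s(v, S.σ v) then C h.choose else φ e

theorem σ_edge_inj {u v : V} (hu : S.core u) (h : s(u, S.σ u) = s(v, S.σ v)) : u = v := by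
  rw [Sym2.eq_iff] at h
  rcases h with h | ⟨h1, h2⟩
  · exact h.1
  · rw [h1] at h2 hu
    exact absurd h2 (S.σσ v (fun h => hu (by rw [h, h])))

section
variable {φ : Sym2 V → Fin 5} {P : Finset V} {C : V → Fin 5}
theorem fin_σ {v : V} (h : S.pend P v) : S.fin φ P C s(v, S.σ v) = C v := by
  have hh : ∃ u, S.pend P u ∧ s(v, S.σ v) = s(u, S.σ u) := ⟨v, h, rfl⟩
  unfold fin
  rw [dif_pos hh, ← σ_edge_inj h.1 hh.choose_spec.2]
theorem fin_symm {v : V} (h : S.pend P v) : S.fin φ P C s(v, S.σ.symm v) = C (S.σ.symm v) := by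
  have := fin_σ (φ := φ) (C := C) (S.pend_symm.2 h)
  rwa [Equiv.apply_symm_apply, Sym2.eq_swap] at this
theorem fin_np {v w : V} (h : ¬ S.pend P v) : S.fin φ P C s(v, w) = φ s(v,w) := by
  unfold fin
  rw [dif_neg]
  rintro ⟨u, hu, he⟩
  rw [Sym2.eq_iff] at he
  rcases he with ⟨rfl, _⟩ | ⟨rfl, _⟩
  · exact h hu
  · exact h (S.pend_σ.2 hu)
theorem fin_low [Fintype V] {g D} (hS : S.St φ g P D) {e : Sym2 V} (h : φ e < 3) : S.fin φ P C e = φ e := by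
  unfold fin
  rw [dif_neg]
  rintro ⟨u, hu, rfl⟩
  exact hS.pσ u hu h
end

section
variable [Fintype V] {φ : Sym2 V → Fin 5} {g : V → Fin 5} {P D : Finset V} {C : V → Fin 5}

theorem cols_pend (hS : S.St φ g P D) {v : V} (h : S.pend P v) :
    S.cols (S.fin φ P C) v = {C v, C (S.σ.symm v), S.lab φ v} := by
  rw [cols3 (S.nb v h.1), fin_σ h, fin_symm h, fin_low hS (hS.pm v h)]; rfl

theorem cols_full (hS : S.St φ g P D) {v : V} (h : ¬ S.pend P v) (hf : S.Full φ v) :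
    S.cols (S.fin φ P C) v = {0,1,2} := by
  obtain ⟨p, q, r, h1, h2, h3, h4⟩ := S.deg v
  have hp := (h4 p).2 (by simp)
  have hq := (h4 q).2 (by simp)
  have hr := (h4 r).2 (by simp)
  rw [cols3 h4, fin_np h, fin_np h, fin_np h]
  exact cs_full _ _ _ (hf p hp) (hf q hq) (hf r hr) (hS.low v p q hp hq h1 (hf p hp)) (hS.low v p r hp hr h2 (hf p hp))
    (hS.low v q r hq hr h3 (hf q hq))

theorem cols_op {v m : V} (h : ¬ S.pend P v) (ho : S.Op φ g P v) (hm : S.ULow φ v m) :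
    S.cols (S.fin φ P C) v = {3,4, φ s(v,m)} := by
  obtain ⟨m', h1, _, h3⟩ := ho
  have := hm.uniq h1
  subst this
  obtain ⟨p, hp, hpm⟩ : ∃ p, S.G.Adj v p ∧ p ≠ m := by
    obtain ⟨p, q, r, h1, h2, h3, h4⟩ := S.deg v
    by_cases e : p = m
    · exact ⟨q, (h4 q).2 (by simp), by rw [← e]; exact h1.symm⟩
    · exact ⟨p, (h4 p).2 (by simp), e⟩
  obtain ⟨q, hq1, hq2, hq3⟩ := third_nb hm.1 hp hpm.symm
  have hq := (hq3 q).2 (by simp)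
  have h5 : ∀ w, S.G.Adj v w ↔ (w = p ∨ w = q ∨ w = m) := fun w => by
    rw [hq3 w]; constructor
    · rintro (h | h | h) <;> simp [h]
    · rintro (h | h | h) <;> simp [h]
  rw [cols3 h5, fin_np h, fin_np h, fin_np h]
  exact cs_op _ _ _ (hm.2.2 p hp hpm) (hm.2.2 q hq hq1) (h3 p q hp hq hpm hq1 hq2.symm)

theorem fin_proper (hS : S.St φ g P D) (hC : ∀ v, S.pend P v → S.proV (S.lab φ) C v) {v w w' : V}
    (hw : S.G.Adj v w) (hw' : S.G.Adj v w') (hne : w ≠ w') : S.fin φ P C s(v,w) ≠ S.fin φ P C s(v,w') := by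
  by_cases h : S.pend P v
  · obtain ⟨h1, h2, h3⟩ := hC v h
    refine core_pair h.1 ?_ ?_ ?_ w w' hw hw' hne
    · rw [fin_σ h, fin_symm h]; exact h1.symm
    · rw [fin_σ h, fin_low hS (hS.pm v h)]; exact h3
    · rw [fin_symm h, fin_low hS (hS.pm v h)]; exact h2
  · rw [fin_np h, fin_np h]
    rcases hS.np v h with hf | ⟨m, h1, h2, h3⟩
    · exact hS.low v w w' hw hw' hne (hf w hw)
    · by_cases e : w = m
      · subst e; exact hS.low v w w' hw hw' hne h1.2.1
      · by_cases e' : w' = m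
        · subst e'; exact (hS.low v w' w hw' hw hne.symm h1.2.1).symm
        · exact h3 w w' hw hw' e e' hne

theorem cols_unmixed (hS : S.St φ g P D) (hC : ∀ v, S.pend P v → S.proV (S.lab φ) C v) {v w : V}
    (hw : S.G.Adj v w) (hl : φ s(v,w) < 3) (hm : ¬ (S.pend P v ∧ S.mixV C v)) :
    S.cols (S.fin φ P C) v = {0,1,2} ∨ S.cols (S.fin φ P C) v = {3,4,φ s(v,w)} := by
  by_cases h : S.pend P v
  · have hwm : w = S.mt v := by
      by_contra hne; exact (hS.ul h).2.2 w hw hne hl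
    subst hwm
    have hmx : C (S.σ.symm v) < 3 ↔ C v < 3 := by
      by_contra hh; exact hm ⟨h, hh⟩
    obtain ⟨h1, h2, h3⟩ := hC v h
    rw [cols_pend hS h]
    by_cases hc : C v < 3
    · left; exact cs_full _ _ _ hc (hmx.2 hc) hl h1.symm h3 h2
    · right; exact cs_op _ _ _ hc (fun hh => hc (hmx.1 hh)) h1.symm
  · rcases hS.np v h with hf | ho
    · left; exact cols_full hS h hf
    · right
      obtain ⟨m, h1, h2, h3⟩ := ho
      have : w = m := by by_contra hne; exact h1.2.2 w hw hne hl
      subst this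
      exact cols_op h ⟨w, h1, h2, h3⟩ h1

theorem fresh_EN (hS : S.St φ g P D) (hTT : ∀ v ∈ P, v ∉ D → S.isT (S.mt v))
    (hF : ∀ v ∈ P, v ∉ D → C v = thirdC (S.lab φ (S.σ v)) (S.lab φ v) ∧ C (S.σ.symm v) = S.alph φ v)
    {v : V} (hv : v ∈ P) (hvD : v ∉ D) : S.EN (S.fin φ P C) v (S.mt v) := by
  obtain ⟨h1, h2, h3⟩ := hS.ff v hv hvD (hTT v hv hvD)
  have hT := hS.PT v hv
  have hmm := S.Vv_mt_mt hT.1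
  obtain ⟨_, _, h4⟩ := hS.ff _ h1 h2 (by rw [hmm]; exact hT)
  have hp : S.pend P v := S.tri_pend hT hv (Or.inl rfl)
  have hp' : S.pend P (S.mt v) := S.tri_pend (hS.PT _ h1) h1 (Or.inl rfl)
  have hl : S.lab φ (S.mt v) = S.lab φ v := by unfold lab; rw [hmm, Sym2.eq_swap]
  unfold EN
  rw [cols_pend hS hp, cols_pend hS hp', (hF v hv hvD).1, (hF v hv hvD).2, (hF _ h1 h2).1, (hF _ h1 h2).2, hl]
  unfold alph
  rw [hmm]
  refine cs_fresh _ _ _ (hS.pm v hp) (hS.pm _ (S.pend_σ.2 hp)) (hS.pm _ (S.pend_σ.2 hp')) h3 ?_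
  rw [← hl]; exact h4

theorem low_edge (hS : S.St φ g P D) (hTT : ∀ v ∈ P, v ∉ D → S.isT (S.mt v))
    (hC : ∀ v, S.pend P v → S.proV (S.lab φ) C v)
    (hF : ∀ v ∈ P, v ∉ D → C v = thirdC (S.lab φ (S.σ v)) (S.lab φ v) ∧ C (S.σ.symm v) = S.alph φ v)
    {v w : V} (hw : S.G.Adj v w) (hl : φ s(v,w) < 3) (hb : ¬ S.EN (S.fin φ P C) v w) :
    ∃ u, (S.pend P u ∧ S.mixV C u ∧ u ∉ P \ D) ∧ s(v,w) = s(u, S.mt u) := by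
  have key : ∀ v w, S.G.Adj v w → φ s(v,w) < 3 → ¬ S.EN (S.fin φ P C) v w → S.pend P v → S.mixV C v →
      (S.pend P v ∧ S.mixV C v ∧ v ∉ P \ D) ∧ s(v,w) = s(v, S.mt v) := by
    intro v w hw hl hb hp hm
    have hwm : w = S.mt v := by
      by_contra hne; exact (hS.ul hp).2.2 w hw hne hl
    subst hwm
    refine ⟨⟨hp, hm, fun hh => hb ?_⟩, rfl⟩
    rw [mem_sdiff] at hh
    exact fresh_EN hS hTT hF hh.1 hh.2
  by_cases h1 : S.pend P v ∧ S.mixV C v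
  · exact ⟨v, key v w hw hl hb h1.1 h1.2⟩
  by_cases h2 : S.pend P w ∧ S.mixV C w
  · have := key w v hw.symm (by rwa [Sym2.eq_swap]) (fun hh => hb (EN_symm.1 hh)) h2.1 h2.2
    rw [Sym2.eq_swap] at this
    exact ⟨w, this⟩
  · refine absurd ?_ hb
    have e2 := cols_unmixed hS hC hw.symm (by rwa [Sym2.eq_swap]) h2
    rw [Sym2.eq_swap] at e2
    exact cs_low _ hl _ _ (cols_unmixed hS hC hw hl h1) e2

theorem trk_np (hS : S.St φ g P D) {v : V} (h : ¬ S.pend P v) : S.trk P v :=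
  fun u hu ht => h (S.tri_pend (hS.PT u hu) hu ht)

theorem high_edge (hS : S.St φ g P D) {v w : V} (hw : S.G.Adj v w) (hl : ¬ φ s(v,w) < 3)
    (hv : ¬ S.pend P v) (hw' : ¬ S.pend P w) (hb : ¬ S.EN (S.fin φ P C) v w) :
    S.hit φ g P v ∨ S.hit φ g P w := by
  have hov : S.Op φ g P v := (hS.np v hv).resolve_left (fun hf => hl (hf w hw))
  have how : S.Op φ g P w := (hS.np w hw').resolve_left (fun hf => hl (by rw [Sym2.eq_swap]; exact hf v hw.symm))
  by_contra hc
  push Not at hc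
  obtain ⟨m, h1, h2, h3⟩ := hov
  obtain ⟨m', h1', h2', h3'⟩ := how
  have hwm : w ≠ m := by rintro rfl; exact hl h1.2.1
  have e1 : φ s(v,m) = g v := by by_contra hh; exact hc.1 ⟨trk_np hS hv, m, h1, hh⟩
  have e2 : φ s(w,m') = g w := by by_contra hh; exact hc.2 ⟨trk_np hS hw', m', h1', hh⟩
  have e3 := (h2 w hw hwm).2
  apply hb
  left
  rw [cols_op hv ⟨m, h1, h2, h3⟩ h1, cols_op hw' ⟨m', h1', h2', h3'⟩ h1', e2, e3, e1]
  exact cs_high _ (by rw [← e1]; exact h1.2.1)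

theorem σ_EN (hS : S.St φ g P D) {v : V} (h : S.pend P v) (hn : S.nrmV (S.lab φ) C v) :
    S.EN (S.fin φ P C) v (S.σ v) := by
  unfold EN
  rw [cols_pend hS h, cols_pend hS (S.pend_σ.2 h), Equiv.symm_apply_apply]
  unfold nrmV normal5 at hn
  have : ({C v, C (S.σ.symm v), S.lab φ v} ∪ {C (S.σ v), C v, S.lab φ (S.σ v)} : Finset (Fin 5)) =
      {C v, C (S.σ.symm v), S.lab φ v, C (S.σ v), S.lab φ (S.σ v)} := by
    ext k; simp only [mem_union, mem_insert, mem_singleton]; constructor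
    · rintro ((h | h | h) | (h | h | h)) <;> simp [h]
    · rintro (h | h | h | h | h) <;> simp [h]
  rw [this]; exact hn

theorem high_pair {v m : V} (hm : S.ULow φ v m) : ∃ p q, ∀ w, S.G.Adj v w → ¬ φ s(v,w) < 3 → w = p ∨ w = q := by
  obtain ⟨p, q, r, h1, h2, h3, h4⟩ := S.deg v
  rcases (h4 m).1 hm.1 with rfl | rfl | rfl
  · refine ⟨q, r, fun w hw hl => ?_⟩
    rcases (h4 w).1 hw with rfl | rfl | rfl
    · exact absurd hm.2.1 hl
    · simp
    · simp
  · refine ⟨p, r, fun w hw hl => ?_⟩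
    rcases (h4 w).1 hw with rfl | rfl | rfl
    · simp
    · exact absurd hm.2.1 hl
    · simp
  · refine ⟨p, q, fun w hw hl => ?_⟩
    rcases (h4 w).1 hw with rfl | rfl | rfl
    · simp
    · simp
    · exact absurd hm.2.1 hl

theorem core_count (hP : ∀ v ∈ P, S.isT v) :
    (univ.filter (fun v => S.pend P v ∧ S.t v = false)).card + 2 * (univ.filter S.isT).card ≤
    (univ.filter (fun v => S.core v ∧ S.t v = false)).card + 2 * P.card := by
  set Q := univ.filter (fun v => S.isT v ∧ v ∉ P) with hQ
  have h1 : (univ.filter S.isT).card = P.card + Q.card := by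
    rw [← Finset.card_union_of_disjoint]
    · congr 1; ext v; simp only [hQ, mem_union, mem_filter, mem_univ, true_and]
      by_cases h : v ∈ P
      · simp [h, hP v h]
      · simp [h]
    · rw [Finset.disjoint_left]; intro v hv hv'
      exact (mem_filter.1 hv').2.2 hv
  have h2 : (univ.filter (fun v => S.pend P v ∧ S.t v = false)).card + (Q.card + (Q.image S.σ.symm).card) ≤
      (univ.filter (fun v => S.core v ∧ S.t v = false)).card := by
    rw [← Finset.card_union_of_disjoint, ← Finset.card_union_of_disjoint]
    · apply Finset.card_le_card
      intro v hv
      simp only [hQ, mem_union, mem_filter, mem_univ, true_and, mem_image] at hv ⊢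
      rcases hv with h | h | ⟨u, h, rfl⟩
      · exact ⟨h.1.1, h.2⟩
      · exact ⟨h.1.1.1, h.1.1.2.1⟩
      · exact ⟨S.core_symm h.1.1.1, h.1.1.2.2⟩
    · rw [Finset.disjoint_left]; intro v hv hv'
      simp only [hQ, mem_union, mem_filter, mem_univ, true_and, mem_image] at hv hv'
      rcases hv' with h | ⟨u, h, rfl⟩
      · exact h.2 (hv.1.2 v h.1 (Or.inl rfl))
      · exact h.2 (hv.1.2 u h.1 (Or.inr (Or.inr rfl)))
    · rw [Finset.disjoint_left]; intro v hv hv'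
      simp only [hQ, mem_filter, mem_univ, true_and, mem_image] at hv hv'
      obtain ⟨u, h, rfl⟩ := hv'
      exact S.symm_ne h.1.1.1 (S.isT_not h.1 hv.1.1 (Or.inr (Or.inr rfl)))
  rw [Finset.card_image_of_injective _ S.σ.symm.injective] at h2
  omega

theorem final (hS : S.St φ g P D) (hTT : ∀ v ∈ P, v ∉ D → S.isT (S.mt v))
    (hB : S.hitN φ g P + P.card + 2 * D.card ≤ (univ.filter S.isT).card) :
    ∃ c : Sym2 V → Fin 5, (∀ v w w', S.G.Adj v w → S.G.Adj v w' → w ≠ w' → c s(v,w) ≠ c s(v,w')) ∧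
      (univ.filter (S.bad c)).card ≤ (univ.filter (fun v => S.core v ∧ S.t v = false)).card := by
  obtain ⟨C, hC, hsum, hF⟩ := glue hS hTT
  refine ⟨S.fin φ P C, fun v w w' hw hw' hne => fin_proper hS hC hw hw' hne, ?_⟩
  set A1 := univ.filter (fun v => S.pend P v ∧ ¬ S.nrmV (S.lab φ) C v) with hA1
  set A2 := univ.filter (fun v => S.pend P v ∧ S.mixV C v ∧ v ∉ P \ D) with hA2
  set A3 := univ.filter (fun v => ¬ S.pend P v ∧ S.hit φ g P v) with hA3
  have hpq : ∀ v, ∃ p q, ¬ S.pend P v → S.hit φ g P v → ∀ w, S.G.Adj v w → ¬ φ s(v,w) < 3 → w = p ∨ w = q := by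
    intro v
    by_cases h : S.hit φ g P v
    · obtain ⟨_, m, hm, _⟩ := h
      obtain ⟨p, q, h⟩ := high_pair hm
      exact ⟨p, q, fun _ _ => h⟩
    · exact ⟨v, v, fun _ h' => absurd h' h⟩
  choose p q hpq using hpq
  have hsub : univ.filter (S.bad (S.fin φ P C)) ⊆
      A1.image (fun v => s(v, S.σ v)) ∪ (A2.image (fun v => s(v, S.mt v)) ∪ (A3.image (fun v => s(v, p v)) ∪ A3.image (fun v => s(v, q v)))) := by
    intro e he
    obtain ⟨v, w, rfl, hw, hb⟩ := (mem_filter.1 he).2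
    simp only [mem_union, mem_image]
    by_cases hl : φ s(v,w) < 3
    · right; left
      obtain ⟨u, hu, he⟩ := low_edge hS hTT hC hF hw hl hb
      exact ⟨u, mem_filter.2 ⟨mem_univ _, hu⟩, he.symm⟩
    have kσ : ∀ v w, S.G.Adj v w → ¬ φ s(v,w) < 3 → ¬ S.EN (S.fin φ P C) v w → S.pend P v →
        ∃ a ∈ A1, s(a, S.σ a) = s(v,w) := by
      intro v w hw hl hb hp
      have e1 : ∀ u, S.pend P u → ¬ S.EN (S.fin φ P C) u (S.σ u) → u ∈ A1 := fun u hu hb =>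
        mem_filter.2 ⟨mem_univ _, hu, fun hn => hb (σ_EN hS hu hn)⟩
      rcases (S.nb v hp.1 w).1 hw with rfl | rfl | rfl
      · exact ⟨v, e1 v hp hb, rfl⟩
      · refine ⟨S.σ.symm v, e1 _ (S.pend_symm.2 hp) ?_, ?_⟩
        · rw [Equiv.apply_symm_apply]; exact fun h => hb (EN_symm.1 h)
        · rw [Equiv.apply_symm_apply, Sym2.eq_swap]
      · exact absurd (hS.pm v hp) hl
    by_cases hv : S.pend P v
    · left; exact kσ v w hw hl hb hv
    by_cases hw' : S.pend P w
    · left; rw [Sym2.eq_swap]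
      exact kσ w v hw.symm (by rwa [Sym2.eq_swap]) (fun h => hb (EN_symm.1 h)) hw'
    right; right
    rcases high_edge hS hw hl hv hw' hb with h | h
    · rcases hpq v hv h w hw hl with e | e
      · left; exact ⟨v, mem_filter.2 ⟨mem_univ _, hv, h⟩, by rw [e]⟩
      · right; exact ⟨v, mem_filter.2 ⟨mem_univ _, hv, h⟩, by rw [e]⟩
    · rcases hpq w hw' h v hw.symm (by rwa [Sym2.eq_swap]) with e | e
      · left; exact ⟨w, mem_filter.2 ⟨mem_univ _, hw', h⟩, by rw [e, Sym2.eq_swap]⟩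
      · right; exact ⟨w, mem_filter.2 ⟨mem_univ _, hw', h⟩, by rw [e, Sym2.eq_swap]⟩
  have hcard : (univ.filter (S.bad (S.fin φ P C))).card ≤ A1.card + (A2.card + (A3.card + A3.card)) :=
    (Finset.card_le_card hsub).trans <| (Finset.card_union_le _ _).trans <| Nat.add_le_add Finset.card_image_le <|
      (Finset.card_union_le _ _).trans <| Nat.add_le_add Finset.card_image_le <|
      (Finset.card_union_le _ _).trans <| Nat.add_le_add Finset.card_image_le Finset.card_image_le
  have hf : ∑ v ∈ univ.filter (fun v => S.pend P v), S.fcost (P \ D) (S.lab φ) C v = A2.card + A1.card := by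
    unfold fcost
    rw [Finset.sum_add_distrib, ← Finset.card_filter, ← Finset.card_filter, Finset.filter_filter, Finset.filter_filter]
  have hw : ∑ v ∈ univ.filter (fun v => S.pend P v), S.wt φ g P D v ≤
      (univ.filter (fun v => S.pend P v ∧ S.t v = false)).card +
      2 * (univ.filter (fun v => S.pend P v ∧ S.hit φ g P v)).card + 4 * D.card := by
    unfold wt
    have m2 : ∀ (k : ℕ) (p : V → Prop) [DecidablePred p], (∑ v ∈ univ.filter (fun v => S.pend P v), if p v then k else 0) =
        k * (univ.filter (fun v => S.pend P v ∧ p v)).card := by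
      intro k p _
      rw [← Finset.filter_filter, Finset.card_filter, Finset.mul_sum]
      refine Finset.sum_congr rfl fun v _ => ?_
      split_ifs <;> simp
    rw [Finset.sum_add_distrib, Finset.sum_add_distrib, m2 2 (S.hit φ g P), m2 4 (fun v => v ∈ D), m2 1 (fun v => S.t v = false)]
    have : (univ.filter (fun v => S.pend P v ∧ v ∈ D)).card ≤ D.card :=
      Finset.card_le_card (fun v hv => (mem_filter.1 hv).2.2)
    omega
  have hh : (univ.filter (fun v => S.pend P v ∧ S.hit φ g P v)).card + A3.card ≤ S.hitN φ g P := by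
    unfold hitN
    rw [hA3, ← Finset.card_union_of_disjoint]
    · apply Finset.card_le_card
      intro v hv
      simp only [mem_union, mem_filter, mem_univ, true_and] at hv ⊢
      rcases hv with h | h <;> exact h.2
    · rw [Finset.disjoint_left]; intro v hv hv'
      exact (mem_filter.1 hv').2.1 (mem_filter.1 hv).2.1
  have := core_count hS.PT
  omega
end
end Sys
end SysSec9


section SysSec10
open scoped Classical
namespace Sys
variable {V : Type*} {S : Sys V}

structure Base (S : Sys V) (φ : Sym2 V → Fin 5) : Prop where
  low : S.LowP φ
  nc : ∀ v, ¬ S.core v → S.Full φ v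
  pσ : ∀ v, S.core v → ¬ φ s(v, S.σ v) < 3
  pm : ∀ v, S.core v → φ s(v, S.mt v) < 3
  te : ∀ v, S.t v = true → S.lab φ v = S.lab φ (S.σ v)

def badB (S : Sys V) [Fintype V] (φ : Sym2 V → Fin 5) (v : V) : Prop :=
  (S.nT v ∧ ¬ S.GoodAt (S.lab φ) v) ∨
  (S.isT v ∧ S.isT (S.mt v) ∧ (S.lab φ v = S.lab φ (S.σ v) ∨ S.lab φ v = S.lab φ (S.σ (S.mt v))))

theorem lab_self {φ} {v : V} {c} : S.lab (S.updE φ v c) v = c := updE_self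
theorem lab_self' {φ} {v : V} {c} (h : S.Vv v) : S.lab (S.updE φ v c) (S.mt v) = c := updE_self' (S.Vv_mt_mt h)
theorem lab_other {φ} {v : V} {c} {u : V} (h1 : u ≠ v) (h2 : u ≠ S.mt v) : S.lab (S.updE φ v c) u = S.lab φ u :=
  updE_other h1 h2
theorem lab_nV {φ} {v : V} {c} {u : V} (h : S.Vv v) (hu : ¬ S.Vv u) : S.lab (S.updE φ v c) u = S.lab φ u :=
  lab_other (fun e => hu (e ▸ h)) (fun e => hu (e ▸ S.Vv_mt h))

theorem updE_cases {φ} {v : V} {c : Fin 5} (h : S.Vv v) (u w : V) :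
    (S.core u ∧ w = S.mt u ∧ S.updE φ v c s(u,w) = c) ∨ S.updE φ v c s(u,w) = φ s(u,w) := by
  by_cases h1 : u = v ∨ u = S.mt v
  · by_cases h2 : w = S.mt u
    · left
      subst h2
      rcases h1 with rfl | rfl
      · exact ⟨h.1, rfl, updE_self⟩
      · exact ⟨(S.Vv_mt h).1, rfl, updE_self' (S.Vv_mt_mt h)⟩
    · right; exact updE_ne (S.Vv_mt_mt h) h1 h2
  · push Not at h1
    right; exact updE_other h1.1 h1.2

theorem Base.upd {φ} (hb : S.Base φ) {v : V} (hv : S.Vv v) {c : Fin 5} (hc : c < 3) : S.Base (S.updE φ v c) := by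
  have hnc : ∀ u w, ¬ S.core u → S.updE φ v c s(u,w) = φ s(u,w) := fun u w hu =>
    (updE_cases hv u w).resolve_left (fun h => hu h.1)
  have hσ : ∀ u w, w ≠ S.mt u → S.updE φ v c s(u,w) = φ s(u,w) := fun u w hu =>
    (updE_cases hv u w).resolve_left (fun h => hu h.2.1)
  have h3 : ∀ v, S.core v → ¬ S.updE φ _ c s(v, S.σ v) < 3 := fun u hu => by
    rw [hσ u _ (S.mne u hu).1.symm]; exact hb.pσ u hu
  have h4 : ∀ u, S.core u → S.updE φ v c s(u, S.mt u) < 3 := fun u hu => by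
    rcases updE_cases (φ := φ) (c := c) hv u (S.mt u) with h | h
    · rw [h.2.2]; exact hc
    · rw [h]; exact hb.pm u hu
  refine ⟨?_, ?_, h3, h4, ?_⟩
  · intro u w w' hw hw' hne hl
    by_cases hu : S.core u
    · have hul : S.ULow (S.updE φ v c) u (S.mt u) := by
        refine ⟨S.adj_mt hu, h4 u hu, ?_⟩
        intro w hw hne
        rcases (S.nb u hu w).1 hw with rfl | rfl | rfl
        · exact h3 u hu
        · have := h3 _ (S.core_symm hu)
          rwa [Equiv.apply_symm_apply, Sym2.eq_swap] at this
        · exact absurd rfl hne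
      exact hul.lowP hw hw' hne hl
    · rw [hnc u w hu] at hl ⊢
      rw [hnc u w' hu]
      exact hb.low u w w' hw hw' hne hl
  · intro u hu w hw
    rw [hnc u w hu]; exact hb.nc u hu w hw
  · intro u hu
    have h1 : ¬ S.Vv u := fun h => by rw [h.2.1] at hu; simp at hu
    have h2 : ¬ S.Vv (S.σ u) := fun h => by
      have := h.2.2; rw [Equiv.symm_apply_apply, hu] at this; simp at this
    rw [lab_nV hv h1, lab_nV hv h2]; exact hb.te u hu

theorem good_congr [Fintype V] {g g' : V → Fin 5} {v : V} (h : ∀ j, g' (S.σ^[j] v) = g (S.σ^[j] v))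
    (hg : S.GoodAt g v) : S.GoodAt g' v := by
  unfold GoodAt at hg ⊢
  simp only [h]; exact hg

theorem not_same_mt [Fintype V] {v : V} (hv : S.nT v) (ho : S.per v % 2 = 1) (h4 : S.ct v ≤ 4) :
    ∃ w, S.σ.SameCycle v w ∧ S.Vv w ∧ ¬ S.σ.SameCycle w (S.mt w) := by
  obtain ⟨k, hk, h1, h2⟩ := centralV (S.CSv hv.1) ho (S.ct3 hv ho) h4
  have hp := S.per_pos v
  have hpred : ∀ j, S.σ^[j + S.per v - 1] v = S.σ.symm (S.σ^[j] v) := by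
    intro j
    rw [Equiv.eq_symm_apply, ← Function.iterate_succ_apply' S.σ, show (j + S.per v - 1).succ = j + S.per v by omega, S.iter_per]
  have hVp : ∀ j, isVp (S.per v) (fun j => S.t (S.σ^[j] v)) j ↔ S.Vv (S.σ^[j] v) := by
    intro j
    unfold isVp Vv
    simp only [hpred]
    exact ⟨fun h => ⟨S.core_iter hv.1 j, h⟩, fun h => h.2⟩
  have hVw := (hVp k).1 h1
  refine ⟨S.σ^[k] v, same_iter v k, hVw, fun hs => ?_⟩
  obtain ⟨i, hi⟩ := exists_iter ((same_iter v k).trans hs)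
  rw [← iter_mod] at hi
  have hVm := S.Vv_mt hVw
  rw [← hi] at hVm
  have hm := S.mne _ hVw.1
  rcases h2 _ (Nat.mod_lt _ hp) ((hVp _).2 hVm) with e | e | e
  · rw [e] at hi
    exact S.mt_ne hVw.1 hi.symm
  · apply hm.2
    rw [← hi, Equiv.eq_symm_apply, ← Function.iterate_succ_apply' S.σ, ← e, iter_mod]
  · apply hm.1
    rw [← hi, ← Function.iterate_succ_apply' S.σ, e, iter_mod]

/-- effect of relabelling on the good cycles -/
theorem upd_good [Fintype V] {φ} {w : V} (hV : S.Vv w) (hs : ¬ S.σ.SameCycle w (S.mt w)) {c : Fin 5}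
    (h1 : S.nT w → S.GoodAt (updV (S.lab φ) w c) w)
    (h2 : S.nT (S.mt w) → S.GoodAt (updV (S.lab φ) (S.mt w) c) (S.mt w)) {u : V} (hu : S.nT u)
    (hg : S.σ.SameCycle u w ∨ S.GoodAt (S.lab φ) u) : S.GoodAt (S.lab (S.updE φ w c)) u := by
  by_cases e1 : S.σ.SameCycle u w
  · obtain ⟨k, hk⟩ := exists_iter e1
    refine S.good_of_iter hu.1 k ?_
    rw [hk]
    refine good_congr ?_ (h1 (by rw [← hk]; exact S.nT_iter hu k))
    intro j
    have : S.σ^[j] w ≠ S.mt w := fun h => hs (by rw [← h]; exact same_iter w j)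
    by_cases e : S.σ^[j] w = w
    · rw [e, updV_self, lab_self]
    · rw [updV_ne e, lab_other e this]
  by_cases e2 : S.σ.SameCycle u (S.mt w)
  · obtain ⟨k, hk⟩ := exists_iter e2
    refine S.good_of_iter hu.1 k ?_
    rw [hk]
    refine good_congr ?_ (h2 (by rw [← hk]; exact S.nT_iter hu k))
    intro j
    have : S.σ^[j] (S.mt w) ≠ w := fun h => hs (by
      have := same_iter (S := S) (S.mt w) j
      rw [h] at this; exact this.symm)
    by_cases e : S.σ^[j] (S.mt w) = S.mt w
    · rw [e, updV_self, lab_self' hV]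
    · rw [updV_ne e, lab_other this e]
  · refine good_congr ?_ (hg.resolve_left e1)
    intro j
    refine lab_other (fun h => e1 ?_) (fun h => e2 ?_)
    · rw [← h]; exact same_iter u j
    · rw [← h]; exact same_iter u j

theorem nV_σT {u : V} (h : S.isT u) : ¬ S.Vv (S.σ u) := fun hh => by
  have := hh.2.1; rw [h.2.2] at this; simp at this

theorem Base.step [Fintype V] {φ} (hb : S.Base φ) {v : V} (hv : S.badB φ v) :
    ∃ φ', S.Base φ' ∧ (∀ u, S.badB φ' u → S.badB φ u) ∧ ¬ S.badB φ' v := by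
  have hlo : ∀ u, S.nT u → S.lab φ u < 3 := fun u hu => hb.pm u hu.1
  have hte : ∀ u, S.nT u → S.t u = true → S.lab φ u = S.lab φ (S.σ u) := fun u _ h => hb.te u h
  rcases hv with ⟨hn, hbad⟩ | ⟨hT, hT', hbad⟩
  · have hodd : S.per v % 2 = 1 ∧ S.ct v ≤ 4 := by
      by_contra hc
      apply hbad
      refine good_big (S.CSv hn.1) (S.LSv (fun j => hlo _ (S.nT_iter hn j))) ?_ ?_
      · intro j hj
        show S.lab φ _ = S.lab φ (S.σ^[j+1] v)
        rw [Function.iterate_succ_apply']; exact hb.te _ hj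
      · show _ ∨ 5 ≤ S.ct v
        omega
    obtain ⟨w, hvw, hV, hs⟩ := not_same_mt hn hodd.1 hodd.2
    have hw : S.nT w := by
      obtain ⟨k, hk⟩ := exists_iter hvw
      rw [← hk]; exact S.nT_iter hn k
    obtain ⟨c, hc, h1, h2⟩ : ∃ c : Fin 5, c < 3 ∧ S.GoodAt (updV (S.lab φ) w c) w ∧
        (S.nT (S.mt w) → S.GoodAt (updV (S.lab φ) (S.mt w) c) (S.mt w)) := by
      have gw := fun c1 c2 h1 h2 hne => S.goodH hw hV hlo hte (c1 := c1) (c2 := c2) h1 h2 hne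
      have a01 := gw 0 1 (by decide) (by decide) (by decide)
      have a02 := gw 0 2 (by decide) (by decide) (by decide)
      have a12 := gw 1 2 (by decide) (by decide) (by decide)
      have l0 : (0 : Fin 5) < 3 := by decide
      have l1 : (1 : Fin 5) < 3 := by decide
      have l2 : (2 : Fin 5) < 3 := by decide
      by_cases hm : S.nT (S.mt w)
      · have gm := fun c1 c2 h1 h2 hne => S.goodH hm (S.Vv_mt hV) hlo hte (c1 := c1) (c2 := c2) h1 h2 hne
        have b01 := gm 0 1 (by decide) (by decide) (by decide)
        have b02 := gm 0 2 (by decide) (by decide) (by decide)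
        have b12 := gm 1 2 (by decide) (by decide) (by decide)
        by_contra hc
        push Not at hc
        have c0 := hc 0 l0
        have c1 := hc 1 l1
        have c2 := hc 2 l2
        clear hc gw gm
        generalize S.GoodAt (updV (S.lab φ) w 0) w = A0 at *
        generalize S.GoodAt (updV (S.lab φ) w 1) w = A1 at *
        generalize S.GoodAt (updV (S.lab φ) w 2) w = A2 at *
        generalize S.GoodAt (updV (S.lab φ) (S.mt w) 0) (S.mt w) = B0 at *
        generalize S.GoodAt (updV (S.lab φ) (S.mt w) 1) (S.mt w) = B1 at *
        generalize S.GoodAt (updV (S.lab φ) (S.mt w) 2) (S.mt w) = B2 at *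
        clear hbad hodd hs hV
        grind
      · rcases a01 with h | h
        · exact ⟨0, l0, h, fun h => absurd h hm⟩
        · exact ⟨1, l1, h, fun h => absurd h hm⟩
    have hgood := fun {u} => upd_good (φ := φ) hV hs (c := c) (fun _ => h1) h2 (u := u)
    refine ⟨_, hb.upd hV hc, ?_, ?_⟩
    · rintro u (⟨hu, hg⟩ | ⟨hT, hT', hx⟩)
      · left; refine ⟨hu, fun hh => hg (hgood hu (Or.inr hh))⟩
      · right
        refine ⟨hT, hT', ?_⟩
        have e1 : u ≠ w := by rintro rfl; exact hw.2 _ hT (Or.inl rfl)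
        have e2 : u ≠ S.mt w := by
          rintro rfl; rw [S.Vv_mt_mt hV] at hT'; exact hw.2 _ hT' (Or.inl rfl)
        rwa [lab_other e1 e2, lab_nV hV (nV_σT hT), lab_nV hV (nV_σT hT')] at hx
    · rintro (⟨hu, hg⟩ | ⟨hT, _⟩)
      · exact hg (hgood hu (Or.inl hvw))
      · exact hn.2 _ hT (Or.inl rfl)
  · have la : S.lab φ (S.σ v) < 3 := hb.pm _ (S.core_σ hT.1.1)
    have lb : S.lab φ (S.σ (S.mt v)) < 3 := hb.pm _ (S.core_σ hT'.1.1)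
    obtain ⟨hc, hc1, hc2⟩ := thirdC_spec _ _ la lb
    have hmm := S.Vv_mt_mt hT.1
    have hno : ∀ u, u = v ∨ u = S.mt v → ¬ S.badB (S.updE φ v (thirdC (S.lab φ (S.σ v)) (S.lab φ (S.σ (S.mt v))))) u := by
      rintro u hu (⟨hn, _⟩ | ⟨_, _, hx⟩)
      · rcases hu with rfl | rfl
        · exact hn.2 _ hT (Or.inl rfl)
        · exact hn.2 _ hT' (Or.inl rfl)
      · rcases hu with rfl | rfl
        · rw [lab_self, lab_nV hT.1 (nV_σT hT), lab_nV hT.1 (nV_σT hT')] at hx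
          exact hx.elim hc1 hc2
        · rw [hmm, lab_self' hT.1, lab_nV hT.1 (nV_σT hT), lab_nV hT.1 (nV_σT hT')] at hx
          exact hx.elim hc2 hc1
    refine ⟨_, hb.upd hT.1 hc, ?_, hno v (Or.inl rfl)⟩
    intro u hu
    by_cases e : u = v ∨ u = S.mt v
    · exact absurd hu (hno u e)
    push Not at e
    rcases hu with ⟨hn, hg⟩ | ⟨hTu, hTu', hx⟩
    · left
      refine ⟨hn, fun hh => hg (good_congr (fun j => ?_) hh)⟩
      refine lab_other (fun h => ?_) (fun h => ?_)
      · exact (S.nT_iter hn j).2 _ hT (Or.inl h)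
      · exact (S.nT_iter hn j).2 _ hT' (Or.inl h)
    · right
      refine ⟨hTu, hTu', ?_⟩
      rwa [lab_other e.1 e.2, lab_nV hT.1 (nV_σT hTu), lab_nV hT.1 (nV_σT hTu')] at hx

theorem Base.clean [Fintype V] (n : ℕ) : ∀ {φ}, S.Base φ → (univ.filter (S.badB φ)).card ≤ n →
    ∃ φ', S.Base φ' ∧ ∀ v, ¬ S.badB φ' v := by
  induction n with
  | zero =>
    intro φ hb hn
    refine ⟨φ, hb, fun v hv => ?_⟩
    have : v ∈ univ.filter (S.badB φ) := mem_filter.2 ⟨mem_univ _, hv⟩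
    rw [Finset.card_eq_zero.1 (Nat.le_zero.1 hn)] at this
    simp at this
  | succ n ih =>
    intro φ hb hn
    by_cases h : ∃ v, S.badB φ v
    · obtain ⟨v, hv⟩ := h
      obtain ⟨φ', h1, h2, h3⟩ := hb.step hv
      refine ih h1 ?_
      have : (univ.filter (S.badB φ')).card < (univ.filter (S.badB φ)).card := by
        apply Finset.card_lt_card
        refine ⟨fun u hu => mem_filter.2 ⟨mem_univ _, h2 u (mem_filter.1 hu).2⟩, fun hh => ?_⟩
        exact h3 (mem_filter.1 (hh (mem_filter.2 ⟨mem_univ _, hv⟩))).2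
      omega
    · push Not at h
      exact ⟨φ, hb, h⟩

theorem main [Fintype V] {φ} (hb : S.Base φ) :
    ∃ c : Sym2 V → Fin 5, (∀ v w w', S.G.Adj v w → S.G.Adj v w' → w ≠ w' → c s(v,w) ≠ c s(v,w')) ∧
      (univ.filter (S.bad c)).card ≤ (univ.filter (fun v => S.core v ∧ S.t v = false)).card := by
  obtain ⟨ψ, hψ, hgood⟩ := hb.clean _ le_rfl
  have hP : ∀ v, S.pend (univ.filter S.isT) v ↔ S.core v := fun v =>
    ⟨fun h => h.1, fun h => ⟨h, fun u hu _ => mem_filter.2 ⟨mem_univ _, hu⟩⟩⟩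
  have hst : S.St ψ (S.lab ψ) (univ.filter S.isT) ∅ := by
    refine ⟨fun v hv => (mem_filter.1 hv).2, by simp, hψ.low, fun v hv => hψ.pσ v hv.1, fun v hv => hψ.pm v hv.1, ?_,
      fun v hv => hψ.pm v hv.1, fun v _ h => hψ.te v h, ?_, ?_, ?_⟩
    · intro v hv; rw [hP] at hv; exact Or.inl (hψ.nc v hv)
    · intro v hv; by_contra hc; exact hgood v (Or.inl ⟨hv, hc⟩)
    · intro v hv _
      have hT : S.isT v := (mem_filter.1 hv).2
      rw [S.isT_symm hT]; exact hψ.te _ hT.2.2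
    · intro v hv _ hT'
      have hT : S.isT v := (mem_filter.1 hv).2
      refine ⟨mem_filter.2 ⟨mem_univ _, hT'⟩, by simp, fun hh => ?_⟩
      exact hgood v (Or.inr ⟨hT, hT', Or.inl hh⟩)
  have h0 : S.hitN ψ (S.lab ψ) (univ.filter S.isT) = 0 := by
    unfold hitN
    rw [Finset.card_eq_zero, Finset.filter_eq_empty_iff]
    rintro v _ ⟨_, m, hm, hne⟩
    by_cases hc : S.core v
    · have := hm.uniq (hst.ul ((hP v).2 hc))
      subst this; exact hne rfl
    · exact hm.not_full (hψ.nc v hc)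
  obtain ⟨φ', g', P', D', h1, h2, h3⟩ := hst.run _ le_rfl
  refine final h1 h2 (h3.trans ?_)
  rw [h0]; simp

end Sys
end SysSec10


section CycSec
open scoped Classical

theorem comp_list {V : Type*} [Fintype V] {H : SimpleGraph V} (hH : H.IsCycles) (c : H.ConnectedComponent) :
    ∃ L : List V, L.Nodup ∧ (∀ x ∈ L, x ∈ c.supp) ∧ (∀ x ∈ c.supp, (H.neighborSet x).Nonempty → x ∈ L) ∧
      ∀ x ∈ L, H.Adj x (L.formPerm x) ∧ L.formPerm (L.formPerm x) ≠ x := by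
  by_cases hn : ∃ v ∈ c.supp, (H.neighborSet v).Nonempty
  · obtain ⟨v, hv, hn⟩ := hn
    obtain ⟨p, hp, hs⟩ := hH.exists_cycle_toSubgraph_verts_eq_connectedComponentSupp hv hn
    have hlen : p.support.tail.length = p.length := by simp
    have h3 : 3 ≤ p.length := hp.three_le_length
    have hget : ∀ i (h : i < p.support.tail.length), p.support.tail[i] = p.getVert (i+1) := by
      intro i h
      rw [List.getElem_tail, p.support_getElem_eq_getVert]
    have hmem : ∀ x, x ∈ p.support.tail ↔ x ∈ c.supp := by
      intro x
      rw [← hs, p.mem_verts_toSubgraph]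
      constructor
      · exact List.mem_of_mem_tail
      · intro hx
        rw [p.mem_support_iff] at hx
        rcases hx with rfl | hx
        · exact SimpleGraph.Walk.end_mem_tail_support hp.not_nil
        · exact hx
    refine ⟨p.support.tail, hp.support_nodup, fun x hx => (hmem x).1 hx, fun x hx _ => (hmem x).2 hx, ?_⟩
    intro x hx
    obtain ⟨i, hi, rfl⟩ := List.getElem_of_mem hx
    have hi' : i < p.length := by rw [← hlen]; exact hi
    rw [List.formPerm_apply_getElem _ hp.support_nodup, List.formPerm_apply_getElem _ hp.support_nodup]
    constructor
    · rw [hget, hget]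
      by_cases h : i + 1 < p.length
      · rw [hlen, Nat.mod_eq_of_lt h]; exact p.adj_getVert_succ h
      · have : i + 1 = p.length := by omega
        rw [hlen, this, Nat.mod_self, p.getVert_length]
        have := p.adj_getVert_succ (i := 0) (by omega)
        rwa [p.getVert_zero] at this
    · intro he
      rw [hp.support_nodup.getElem_inj_iff] at he
      rw [hlen] at he
      have : ((i + 1) % p.length + 1) % p.length = (i + 2) % p.length := by
        rw [Nat.mod_add_mod]
      rw [this] at he
      by_cases h : i + 2 < p.length
      · rw [Nat.mod_eq_of_lt h] at he; omega
      · rw [Nat.mod_eq_sub_mod (by omega), Nat.mod_eq_of_lt (by omega)] at he; omega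
  · push Not at hn
    exact ⟨[], by simp, by simp, fun x hx h => absurd h (by rw [hn x hx]; simp), by simp⟩

theorem cyc_perm {V : Type*} [Fintype V] {H : SimpleGraph V} (hH : H.IsCycles) :
    ∃ σ : Equiv.Perm V, (∀ v, σ v ≠ v → σ (σ v) ≠ v) ∧
      (∀ v, σ v ≠ v → ∀ w, H.Adj v w ↔ (w = σ v ∨ w = σ.symm v)) ∧
      ∀ v, σ v = v → ∀ w, ¬ H.Adj v w := by
  choose L h1 h2 h3 h4 using comp_list hH
  have hsame : ∀ v (k : Equiv.Perm V), (∀ x, k x ∈ L (H.connectedComponentMk v) ↔ x ∈ L (H.connectedComponentMk v)) →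
      (∀ x, x ∉ L (H.connectedComponentMk v) → k x = x) →
      H.connectedComponentMk (k v) = H.connectedComponentMk v := by
    intro v k hk hk'
    by_cases h : v ∈ L (H.connectedComponentMk v)
    · exact h2 _ _ ((hk v).2 h)
    · rw [hk' v h]
  have k1 : ∀ (l : List V) x, l.formPerm x ∈ l ↔ x ∈ l := fun l x => List.formPerm_mem_iff_mem
  have k2 : ∀ (l : List V) x, l.formPerm.symm x ∈ l ↔ x ∈ l := fun l x => by
    rw [← k1 l]; simp
  have k3 : ∀ (l : List V) x, x ∉ l → l.formPerm x = x := fun l x h => List.formPerm_apply_of_notMem h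
  have k4 : ∀ (l : List V) x, x ∉ l → l.formPerm.symm x = x := fun l x h => by
    rw [Equiv.symm_apply_eq, k3 l x h]
  let σ : Equiv.Perm V :=
    { toFun := fun v => (L (H.connectedComponentMk v)).formPerm v
      invFun := fun v => (L (H.connectedComponentMk v)).formPerm.symm v
      left_inv := fun v => by
        show (L (H.connectedComponentMk ((L (H.connectedComponentMk v)).formPerm v))).formPerm.symm _ = v
        rw [hsame v _ (k1 _) (k3 _)]; simp
      right_inv := fun v => by
        show (L (H.connectedComponentMk ((L (H.connectedComponentMk v)).formPerm.symm v))).formPerm _ = v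
        rw [hsame v _ (k2 _) (k4 _)]; simp }
  have hσ : ∀ v, σ v = (L (H.connectedComponentMk v)).formPerm v := fun v => rfl
  have hL : ∀ v, σ v ≠ v → v ∈ L (H.connectedComponentMk v) := fun v hv => by
    by_contra h; exact hv (k3 _ _ h)
  have hadj : ∀ v, σ v ≠ v → H.Adj v (σ v) := fun v hv => (h4 _ v (hL v hv)).1
  have hσσ : ∀ v, σ v ≠ v → σ (σ v) ≠ v := by
    intro v hv
    rw [hσ (σ v), hσ v, hsame v _ (k1 _) (k3 _)]
    exact (h4 _ v (hL v hv)).2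
  refine ⟨σ, hσσ, ?_, ?_⟩
  · intro v hv w
    have hs : σ (σ.symm v) ≠ σ.symm v := fun h => hv (by
      have := congrArg σ h; simp only [Equiv.apply_symm_apply] at this; exact this)
    have a1 := hadj v hv
    have a2 : H.Adj v (σ.symm v) := by
      have := (hadj _ hs).symm
      rwa [Equiv.apply_symm_apply] at this
    have hne : σ v ≠ σ.symm v := fun h => hσσ v hv (by
      have := congrArg σ h; simpa using this)
    have h2 := hH ⟨_, a1⟩
    obtain ⟨x, y, hxy, he⟩ := Set.ncard_eq_two.1 h2
    have hm : ∀ w, H.Adj v w ↔ (w = x ∨ w = y) := fun w => by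
      rw [← SimpleGraph.mem_neighborSet, he]; simp
    have b1 := (hm _).1 a1
    have b2 := (hm _).1 a2
    rw [hm w]
    rcases b1 with b1 | b1 <;> rcases b2 with b2 | b2
    · exact absurd (b1.trans b2.symm) hne
    · rw [b1, b2]
    · rw [b1, b2]; exact or_comm
    · exact absurd (b1.trans b2.symm) hne
  · intro v hv w hw
    have := h3 _ v rfl ⟨w, hw⟩
    exact (h4 _ v this).1.ne hv.symm
end CycSec


section InitSec
open scoped Classical

/-- three perfect matchings of a cubic graph, given by the partner functions -/
structure Trip {V : Type*} (G : SimpleGraph V) (M : Fin 3 → Finset (Sym2 V)) where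
  f : Fin 3 → V → V
  adj : ∀ i v, G.Adj v (f i v)
  mem : ∀ i v w, s(v,w) ∈ M i ↔ w = f i v
  deg : ∀ v, ∃ p q r, p ≠ q ∧ p ≠ r ∧ q ≠ r ∧ ∀ w, G.Adj v w ↔ (w = p ∨ w = q ∨ w = r)

variable {V : Type*} {G : SimpleGraph V} {M : Fin 3 → Finset (Sym2 V)}

noncomputable def mul (M : Fin 3 → Finset (Sym2 V)) (v w : V) : ℕ :=
  (if s(v,w) ∈ M 0 then 1 else 0) + (if s(v,w) ∈ M 1 then 1 else 0) + (if s(v,w) ∈ M 2 then 1 else 0)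

theorem mul_symm (v w : V) : mul M v w = mul M w v := by
  unfold mul; rw [Sym2.eq_swap]

theorem mul_sum (T : Trip G M) {v p q r : V} (h1 : p ≠ q) (h2 : p ≠ r) (h3 : q ≠ r)
    (h4 : ∀ w, G.Adj v w ↔ (w = p ∨ w = q ∨ w = r)) : mul M v p + mul M v q + mul M v r = 3 := by
  have key : ∀ i, (if s(v,p) ∈ M i then 1 else 0) + (if s(v,q) ∈ M i then 1 else 0) + (if s(v,r) ∈ M i then 1 else 0) = 1 := by
    intro i
    simp only [T.mem]
    rcases (h4 _).1 (T.adj i v) with e | e | e <;> rw [e] <;> simp [h1, h2, h3, h1.symm, h2.symm, h3.symm]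
  have k0 := key 0
  have k1 := key 1
  have k2 := key 2
  unfold mul
  omega

theorem pattern (T : Trip G M) (v : V) : ∃ p q m, p ≠ q ∧ p ≠ m ∧ q ≠ m ∧ (∀ w, G.Adj v w ↔ (w = p ∨ w = q ∨ w = m)) ∧
    ((mul M v p = 1 ∧ mul M v q = 1 ∧ mul M v m = 1) ∨ (mul M v p = 0 ∧ mul M v q = 0 ∧ mul M v m = 3) ∨
      (mul M v p = 2 ∧ mul M v q = 0 ∧ mul M v m = 1)) := by
  obtain ⟨p, q, r, h1, h2, h3, h4⟩ := T.deg v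
  have hs := mul_sum T h1 h2 h3 h4
  have P1 : ∀ w, G.Adj v w ↔ (w = p ∨ w = r ∨ w = q) := fun w => by rw [h4 w, or_comm (a := w = q)]
  have P2 : ∀ w, G.Adj v w ↔ (w = q ∨ w = p ∨ w = r) := fun w => by rw [h4 w]; exact or_left_comm
  have P3 : ∀ w, G.Adj v w ↔ (w = q ∨ w = r ∨ w = p) := fun w => by rw [P2 w, or_comm (a := w = p)]
  have P4 : ∀ w, G.Adj v w ↔ (w = r ∨ w = p ∨ w = q) := fun w => by rw [P1 w]; exact or_left_comm
  have P5 : ∀ w, G.Adj v w ↔ (w = r ∨ w = q ∨ w = p) := fun w => by rw [P4 w, or_comm (a := w = p)]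
  by_cases c0 : (mul M v p = 1 ∧ mul M v q = 1 ∧ mul M v r = 1) ∨ mul M v r = 3 ∨ (mul M v p = 2 ∧ mul M v r = 1)
  · exact ⟨p, q, r, h1, h2, h3, h4, by omega⟩
  by_cases c1 : mul M v q = 3 ∨ (mul M v p = 2 ∧ mul M v q = 1)
  · exact ⟨p, r, q, h2, h1, h3.symm, P1, by omega⟩
  by_cases c2 : mul M v p = 3 ∨ (mul M v q = 2 ∧ mul M v p = 1)
  · exact ⟨q, r, p, h3, h1.symm, h2.symm, P3, by omega⟩
  by_cases c3 : mul M v q = 2 ∧ mul M v r = 1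
  · exact ⟨q, p, r, h1.symm, h3, h2, P2, by omega⟩
  by_cases c4 : mul M v r = 2 ∧ mul M v p = 1
  · exact ⟨r, q, p, h3.symm, h2.symm, h1.symm, P5, by omega⟩
  · exact ⟨r, p, q, h2.symm, h3.symm, h1, P4, by omega⟩

def HG (G : SimpleGraph V) (M : Fin 3 → Finset (Sym2 V)) : SimpleGraph V where
  Adj v w := G.Adj v w ∧ (mul M v w = 0 ∨ mul M v w = 2)
  symm := ⟨fun v w h => ⟨h.1.symm, by rw [mul_symm]; exact h.2⟩⟩
  loopless := ⟨fun v h => h.1.ne rfl⟩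

theorem HG_cyc (T : Trip G M) : (HG G M).IsCycles := by
  intro v ⟨x, hx⟩
  obtain ⟨p, q, m, h1, h2, h3, h4, h5⟩ := pattern T v
  rw [Set.ncard_eq_two]
  have hno : ¬ (mul M v p = 1 ∧ mul M v q = 1 ∧ mul M v m = 1) := by
    rintro ⟨a, b, c⟩
    obtain ⟨hx1, hx2⟩ := hx
    rcases (h4 x).1 hx1 with rfl | rfl | rfl <;> omega
  refine ⟨p, q, h1, ?_⟩
  ext w
  simp only [SimpleGraph.mem_neighborSet, Set.mem_insert_iff, Set.mem_singleton_iff]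
  constructor
  · rintro ⟨a, b⟩
    rcases (h4 w).1 a with rfl | rfl | rfl
    · simp
    · simp
    · omega
  · rintro (rfl | rfl)
    · exact ⟨(h4 w).2 (by simp), by omega⟩
    · exact ⟨(h4 w).2 (by simp), by omega⟩

noncomputable def phi0 (M : Fin 3 → Finset (Sym2 V)) (e : Sym2 V) : Fin 5 :=
  if e ∈ M 0 then (if e ∈ M 1 then (if e ∈ M 2 then 0 else 3) else (if e ∈ M 2 then 3 else 0))
  else (if e ∈ M 1 then (if e ∈ M 2 then 3 else 1) else (if e ∈ M 2 then 2 else 3))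

theorem phi0_low (v w : V) : phi0 M s(v,w) < 3 ↔ (mul M v w = 1 ∨ mul M v w = 3) := by
  unfold phi0 mul
  by_cases h0 : s(v,w) ∈ M 0 <;> by_cases h1 : s(v,w) ∈ M 1 <;> by_cases h2 : s(v,w) ∈ M 2 <;> simp [h0, h1, h2]

theorem phi0_one {v w w' : V} (h : mul M v w = 1) (h' : mul M v w' = 1) (he : phi0 M s(v,w) = phi0 M s(v,w')) :
    ∃ i, s(v,w) ∈ M i ∧ s(v,w') ∈ M i := by
  have key : ∀ w, mul M v w = 1 → (phi0 M s(v,w) = 0 ∧ s(v,w) ∈ M 0) ∨ (phi0 M s(v,w) = 1 ∧ s(v,w) ∈ M 1) ∨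
      (phi0 M s(v,w) = 2 ∧ s(v,w) ∈ M 2) := by
    intro w h
    unfold mul at h
    unfold phi0
    by_cases h0 : s(v,w) ∈ M 0 <;> by_cases h1 : s(v,w) ∈ M 1 <;> by_cases h2 : s(v,w) ∈ M 2 <;> simp [h0, h1, h2] at h ⊢
  rcases key w h with ⟨a, b⟩ | ⟨a, b⟩ | ⟨a, b⟩ <;> rcases key w' h' with ⟨a', b'⟩ | ⟨a', b'⟩ | ⟨a', b'⟩ <;>
    rw [a, a'] at he <;> first | exact ⟨_, b, b'⟩ | exact absurd he (by decide)

theorem phi0_congr {e e' : Sym2 V} (h : ∀ i, e ∈ M i ↔ e' ∈ M i) : phi0 M e = phi0 M e' := by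
  unfold phi0; simp only [h]

theorem init_sys [Fintype V] (T : Trip G M) : ∃ S : Sys V, S.G = G ∧ S.Base (phi0 M) ∧
    ∀ v, S.core v → S.t v = false → G.Adj v (S.σ v) ∧ mul M v (S.σ v) = 0 := by
  obtain ⟨σ, hσσ, hσ1, hσ2⟩ := cyc_perm (HG_cyc T)
  have pat : ∀ v, ∃ m, σ v ≠ v → (∀ w, G.Adj v w ↔ (w = σ v ∨ w = σ.symm v ∨ w = m)) ∧ m ≠ σ v ∧ m ≠ σ.symm v ∧
      ((mul M v (σ v) = 0 ∧ mul M v (σ.symm v) = 0 ∧ mul M v m = 3) ∨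
      (mul M v (σ v) = 2 ∧ mul M v (σ.symm v) = 0 ∧ mul M v m = 1) ∨
      (mul M v (σ v) = 0 ∧ mul M v (σ.symm v) = 2 ∧ mul M v m = 1)) := by
    intro v
    obtain ⟨p, q, m, h1, h2, h3, h4, h5⟩ := pattern T v
    refine ⟨m, fun hv => ?_⟩
    have hH := hσ1 v hv
    have a1 := (hH (σ v)).2 (Or.inl rfl)
    have a2 := (hH (σ.symm v)).2 (Or.inr rfl)
    have hne : σ v ≠ σ.symm v := fun h => hσσ v hv (by
      have := congrArg σ h; simpa using this)
    rcases (h4 _).1 a1.1 with e1 | e1 | e1 <;> rcases (h4 _).1 a2.1 with e2 | e2 | e2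
    · exact absurd (e1.trans e2.symm) hne
    · rw [e1, e2]; exact ⟨h4, h2.symm, h3.symm, by have := a1.2; rw [e1] at this; omega⟩
    · have b1 := a1.2
      have b2 := a2.2
      rw [e1] at b1; rw [e2] at b2; omega
    · rw [e1, e2]; refine ⟨fun w => by rw [h4]; exact or_left_comm, h3.symm, h2.symm, by have := a1.2; rw [e1] at this; omega⟩
    · exact absurd (e1.trans e2.symm) hne
    · have b1 := a1.2
      have b2 := a2.2
      rw [e1] at b1; rw [e2] at b2; omega
    · have b1 := a1.2
      have b2 := a2.2
      rw [e1] at b1; rw [e2] at b2; omega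
    · have b1 := a1.2
      have b2 := a2.2
      rw [e1] at b1; rw [e2] at b2; omega
    · exact absurd (e1.trans e2.symm) hne
  choose mt hmt using pat
  have hsm : ∀ v, σ v ≠ v → σ (σ.symm v) ≠ σ.symm v := fun v hv h => hv (by
      have := congrArg σ h; simp only [Equiv.apply_symm_apply] at this; exact this)
  have tf : ∀ v, σ v ≠ v → (decide (σ v ≠ v ∧ mul M v (σ v) = 2) = false ↔ mul M v (σ v) = 0) := by
    intro v hv
    have := (hmt v hv).2.2.2
    simp only [decide_eq_false_iff_not, not_and]
    constructor
    · intro h; have := h hv; omega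
    · intro h _; omega
  have tf' : ∀ v, σ v ≠ v → (decide (σ (σ.symm v) ≠ σ.symm v ∧ mul M (σ.symm v) (σ (σ.symm v)) = 2) = false ↔ mul M v (σ.symm v) = 0) := by
    intro v hv
    rw [tf _ (hsm v hv), Equiv.apply_symm_apply, mul_symm]
  let S : Sys V :=
    { G := G
      σ := σ
      t := fun v => decide (σ v ≠ v ∧ mul M v (σ v) = 2)
      mt := mt
      σσ := hσσ
      nb := fun v hv => (hmt v hv).1
      mne := fun v hv => ⟨(hmt v hv).2.1, (hmt v hv).2.2.1⟩
      deg := T.deg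
      tc := fun v h => (of_decide_eq_true h).1
      tt := fun v h => by
        obtain ⟨hv, h2⟩ := of_decide_eq_true h
        have hv' : σ (σ v) ≠ σ v := fun h => hv (σ.injective h)
        rw [tf _ hv']
        have := (hmt _ hv').2.2.2
        rw [Equiv.symm_apply_apply, mul_symm (σ v) v] at this
        omega
      Vm := fun v hv h1 h2 => by
        rw [tf v hv] at h1
        rw [tf' v hv] at h2
        have h3 : mul M v (mt v) = 3 := by have := (hmt v hv).2.2.2; omega
        have hc : σ (mt v) ≠ mt v := by
          intro hc
          obtain ⟨p, q, r, _, _, _, g4, g5⟩ := pattern T (mt v)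
          have ha : G.Adj (mt v) v := ((hmt v hv).1 _).2 (Or.inr (Or.inr rfl)) |>.symm
          rw [mul_symm] at h3
          have hp : G.Adj (mt v) p := (g4 p).2 (by simp)
          have : (HG G M).Adj (mt v) p := by
            refine ⟨hp, ?_⟩
            have h3' : ∀ x, v = x → mul M (mt v) x = 3 := fun x e => by rw [← e]; exact h3
            rcases (g4 v).1 ha with e | e | e <;> have := h3' _ e <;> omega
          exact hσ2 _ hc _ this
        refine ⟨hc, ?_⟩
        rw [tf _ hc, tf' _ hc]
        obtain ⟨g1, _, _, g4⟩ := hmt _ hc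
        have ha : G.Adj (mt v) v := ((hmt v hv).1 _).2 (Or.inr (Or.inr rfl)) |>.symm
        rw [mul_symm] at h3
        have h3' : ∀ x, v = x → mul M (mt v) x = 3 := fun x e => by rw [← e]; exact h3
        rcases (g1 v).1 ha with e | e | e <;> have := h3' _ e <;> omega }
  refine ⟨S, rfl, ?_, ?_⟩
  · have hpσ : ∀ v, S.core v → ¬ phi0 M s(v, S.σ v) < 3 := by
      intro v hv
      rw [phi0_low]
      have := (hmt v hv).2.2.2
      show ¬ (mul M v (σ v) = 1 ∨ mul M v (σ v) = 3)
      omega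
    have hpm : ∀ v, S.core v → phi0 M s(v, S.mt v) < 3 := by
      intro v hv
      rw [phi0_low]
      have := (hmt v hv).2.2.2
      show (mul M v (mt v) = 1 ∨ mul M v (mt v) = 3)
      omega
    have hnc : ∀ v, ¬ S.core v → ∀ w, G.Adj v w → mul M v w = 1 := by
      intro v hv w hw
      have hno := hσ2 v (not_not.1 hv)
      obtain ⟨p, q, m, _, _, _, g4, g5⟩ := pattern T v
      have hp : G.Adj v p := (g4 p).2 (by simp)
      have := hno p
      have h1 : ¬ (mul M v p = 0 ∨ mul M v p = 2) := fun h => this ⟨hp, h⟩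
      rcases (g4 w).1 hw with e | e | e <;> rw [e] <;> omega
    refine ⟨?_, ?_, hpσ, hpm, ?_⟩
    · intro v w w' hw hw' hne hl
      by_cases hv : S.core v
      · have hul : S.ULow (phi0 M) v (S.mt v) := by
          refine ⟨S.adj_mt hv, hpm v hv, ?_⟩
          intro w hw hne
          rcases (S.nb v hv w).1 hw with rfl | rfl | rfl
          · exact hpσ v hv
          · have := hpσ _ (S.core_symm hv)
            rwa [Equiv.apply_symm_apply, Sym2.eq_swap] at this
          · exact absurd rfl hne
        exact hul.lowP hw hw' hne hl
      · intro he
        obtain ⟨i, h1, h2⟩ := phi0_one (hnc v hv w hw) (hnc v hv w' hw') he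
        rw [T.mem] at h1 h2
        exact hne (h1.trans h2.symm)
    · intro v hv w hw
      rw [phi0_low]; left; exact hnc v hv w hw
    · intro v hv
      obtain ⟨hc, h2⟩ := of_decide_eq_true hv
      have hc' : σ (σ v) ≠ σ v := fun h => hc (σ.injective h)
      have z0 : ∀ {v w : V}, mul M v w = 0 → ∀ i, s(v,w) ∉ M i := by
        intro v w h i
        unfold mul at h
        by_cases h0 : s(v,w) ∈ M 0 <;> by_cases h1 : s(v,w) ∈ M 1 <;> by_cases h2 : s(v,w) ∈ M 2 <;> simp [h0, h1, h2] at h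
        fin_cases i <;> assumption
      have e1 : ∀ i, s(v, mt v) ∈ M i ↔ ¬ s(v, σ v) ∈ M i := by
        intro i
        obtain ⟨g1, g2, g3, g4⟩ := hmt v hc
        have z := z0 (show mul M v (σ.symm v) = 0 by omega) i
        rw [T.mem] at z ⊢
        rw [T.mem]
        rcases (g1 _).1 (T.adj i v) with e | e | e
        · rw [e]; simp [g2]
        · exact absurd e.symm z
        · rw [e]; simp [g2.symm]
      have e2 : ∀ i, s(σ v, mt (σ v)) ∈ M i ↔ ¬ s(v, σ v) ∈ M i := by
        intro i
        obtain ⟨g1, g2, g3, g4⟩ := hmt _ hc'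
        rw [Equiv.symm_apply_apply, mul_symm (σ v) v] at g4
        rw [Equiv.symm_apply_apply] at g1 g3
        have z := z0 (show mul M (σ v) (σ (σ v)) = 0 by omega) i
        rw [T.mem] at z ⊢
        rw [Sym2.eq_swap, T.mem]
        rcases (g1 _).1 (T.adj i (σ v)) with e | e | e
        · exact absurd e.symm z
        · rw [e]; simp [g3]
        · rw [e]; simp [g3.symm]
      exact phi0_congr fun i => (e1 i).trans (e2 i).symm
  · intro v hv ht
    exact ⟨((hmt v hv).1 _).2 (Or.inl rfl), (tf v hv).1 ht⟩
end InitSec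


section AsmSec

theorem trip_of {V : Type*} [Fintype V] [DecidableEq V] (G : SimpleGraph V) [DecidableRel G.Adj]
    (hcubic : ∀ v : V, G.degree v = 3) {M : Fin 3 → Finset (Sym2 V)}
    (hM : ∀ i, IsPerfectMatchingFinset G (M i)) : Nonempty (Trip G M) := by
  have h1 : ∀ i v, ∃ w, G.Adj v w ∧ ∀ x, s(v,x) ∈ M i ↔ x = w := by
    intro i v
    obtain ⟨e, he⟩ := Finset.card_eq_one.1 ((hM i).2 v)
    have hm : e ∈ (M i).filter (fun e => v ∈ e) := by rw [he]; simp
    rw [Finset.mem_filter] at hm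
    obtain ⟨w, rfl⟩ := Sym2.mem_iff_exists.1 hm.2
    refine ⟨w, (hM i).1 _ hm.1, fun x => ⟨fun hx => ?_, fun hx => hx ▸ hm.1⟩⟩
    have : s(v,x) ∈ (M i).filter (fun e => v ∈ e) := by simp [hx]
    rw [he, Finset.mem_singleton] at this
    exact Sym2.congr_right.1 this
  choose f hf1 hf2 using h1
  refine ⟨⟨f, hf1, hf2, fun v => ?_⟩⟩
  have := hcubic v
  rw [← SimpleGraph.card_neighborFinset_eq_degree, Finset.card_eq_three] at this
  obtain ⟨p, q, r, a, b, c, h⟩ := this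
  refine ⟨p, q, r, a, b, c, fun w => ?_⟩
  rw [← SimpleGraph.mem_neighborFinset, h]
  simp

theorem edgeMult_eq {V : Type*} [DecidableEq V] (M : Fin 3 → Finset (Sym2 V)) (v w : V) :
    edgeMult M s(v,w) = mul M v w := by
  unfold edgeMult mul
  rw [Finset.card_filter, Fin.sum_univ_three]
  congr

theorem exists_pm {V : Type*} [Fintype V] [DecidableEq V] (G : SimpleGraph V) [DecidableRel G.Adj]
    (hcubic : ∀ v : V, G.degree v = 3)
    (hb : ∀ e ∈ G.edgeSet, ¬ G.IsBridge e) : ∃ M, IsPerfectMatchingFinset G M := by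
  classical
  obtain ⟨P, hP⟩ := petersen G hcubic hb
  refine ⟨P.edgeSet.toFinset, fun e he => P.edgeSet_subset (by simpa using he), fun v => ?_⟩
  obtain ⟨w, hw, hu⟩ := SimpleGraph.Subgraph.isPerfectMatching_iff.1 hP v
  rw [Finset.card_eq_one]
  refine ⟨s(v,w), ?_⟩
  ext e
  simp only [Finset.mem_filter, Set.mem_toFinset, Finset.mem_singleton]
  constructor
  · rintro ⟨h1, h2⟩
    obtain ⟨x, rfl⟩ := Sym2.mem_iff_exists.1 h2
    rw [hu x h1]
  · rintro rfl
    exact ⟨hw, by simp⟩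

theorem normal_of {V : Type*} [Fintype V] [DecidableEq V] (S : Sys V) [DecidableRel S.G.Adj]
    (c : Sym2 V → Fin 5) {v w : V} (h : S.G.Adj v w) (hE : S.EN c v w) :
    IsNormalEdge S.G c s(v,w) := by
  have : (edgeNbhd S.G s(v,w)).image c = S.cols c v ∪ S.cols c w := by
    ext k
    simp only [edgeNbhd, Sys.cols, Finset.mem_image, Finset.mem_filter, Finset.mem_union,
      SimpleGraph.mem_edgeFinset, Finset.mem_univ, true_and]
    constructor
    · rintro ⟨e, ⟨he, x, hx, hxe⟩, rfl⟩
      obtain ⟨y, rfl⟩ := Sym2.mem_iff_exists.1 hxe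
      rcases Sym2.mem_iff.1 hx with rfl | rfl
      · exact Or.inl ⟨y, he, rfl⟩
      · exact Or.inr ⟨y, he, rfl⟩
    · rintro (⟨y, he, rfl⟩ | ⟨y, he, rfl⟩)
      · exact ⟨_, ⟨he, v, by simp, by simp⟩, rfl⟩
      · exact ⟨_, ⟨he, w, by simp, by simp⟩, rfl⟩
  unfold IsNormalEdge IsPoorEdge IsRichEdge
  rw [this]
  exact hE

open scoped Classical in
theorem triple_col {V : Type*} [Fintype V] [DecidableEq V]
    (G : SimpleGraph V) [DecidableRel G.Adj]
    (hcubic : ∀ v : V, G.degree v = 3) (M : Fin 3 → Finset (Sym2 V))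
    (hM : ∀ i, IsPerfectMatchingFinset G (M i)) :
    ∃ c : Sym2 V → Fin 5, IsProperEdgeColoring G c ∧
      G.edgeFinset.card ≤ (G.edgeFinset.filter fun e => IsNormalEdge G c e).card +
        (matchClass G M 0).card := by
  obtain ⟨T⟩ := trip_of G hcubic hM
  obtain ⟨S, hSG, hB, hS⟩ := init_sys T
  subst hSG
  obtain ⟨c, hc, hcard⟩ := Sys.main hB
  refine ⟨c, ?_, ?_⟩
  · rintro e he f hf hef ⟨v, hv1, hv2⟩
    obtain ⟨x, rfl⟩ := Sym2.mem_iff_exists.1 hv1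
    obtain ⟨y, rfl⟩ := Sym2.mem_iff_exists.1 hv2
    exact hc v x y he hf (fun h => hef (by rw [h]))
  · have h1 : (univ.filter (fun v => S.core v ∧ S.t v = false)).card ≤ (matchClass S.G M 0).card := by
      apply Finset.card_le_card_of_injOn (fun v => s(v, S.σ v))
      · intro v hv
        simp only [Finset.coe_filter, Finset.mem_univ, true_and, Set.mem_setOf_eq] at hv
        obtain ⟨a, b⟩ := hS v hv.1 hv.2
        simp only [matchClass, Finset.coe_filter, Set.mem_setOf_eq, SimpleGraph.mem_edgeFinset]
        exact ⟨a, by rw [edgeMult_eq]; exact b⟩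
      · intro u hu v hv h
        simp only [Finset.coe_filter, Finset.mem_univ, true_and, Set.mem_setOf_eq] at hu
        exact Sys.σ_edge_inj hu.1 h
    have h2 : S.G.edgeFinset ⊆ (S.G.edgeFinset.filter fun e => IsNormalEdge S.G c e) ∪ univ.filter (S.bad c) := by
      intro e he
      rw [Finset.mem_union, Finset.mem_filter, Finset.mem_filter]
      by_cases hb : S.bad c e
      · exact Or.inr ⟨Finset.mem_univ _, hb⟩
      · left
        refine ⟨he, ?_⟩
        induction e with
        | _ v w =>
          have ha : S.G.Adj v w := by simpa using he
          apply normal_of S c ha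
          by_contra hE
          exact hb ⟨v, w, rfl, ha, hE⟩
    have h3 := (Finset.card_le_card h2).trans (Finset.card_union_le _ _)
    have h4 : (univ.filter (S.bad c)).card ≤ (matchClass S.G M 0).card := by
      refine le_trans (le_of_eq ?_) (hcard.trans (le_trans (le_of_eq ?_) h1))
      · congr
      · congr
    omega

end AsmSec

open scoped Classical in
/-- Main theorem: every bridgeless cubic graph `G` has a proper 5-edge-coloring
in which at least `|E(G)| − μ₃(G)` edges are normal. -/
theorem stmt12 {V : Type*} [Fintype V] [DecidableEq V]
    (G : SimpleGraph V) [DecidableRel G.Adj]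
    (hcubic : ∀ v : V, G.degree v = 3)
    (hbridgeless : ∀ e ∈ G.edgeSet, ¬ G.IsBridge e) :
    ∃ c : Sym2 V → Fin 5, IsProperEdgeColoring G c ∧
      G.edgeFinset.card -
          sInf {k : ℕ | ∃ M : Fin 3 → Finset (Sym2 V),
            (∀ i, IsPerfectMatchingFinset G (M i)) ∧ (matchClass G M 0).card = k} ≤
        (G.edgeFinset.filter fun e => IsNormalEdge G c e).card := by
  have hne : {k : ℕ | ∃ M : Fin 3 → Finset (Sym2 V),
            (∀ i, IsPerfectMatchingFinset G (M i)) ∧ (matchClass G M 0).card = k}.Nonempty := by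
    obtain ⟨P, hP⟩ := exists_pm G hcubic hbridgeless
    exact ⟨_, fun _ => P, fun _ => hP, rfl⟩
  obtain ⟨M, hM, hk⟩ := Nat.sInf_mem hne
  rw [← hk]
  obtain ⟨c, h1, h2⟩ := triple_col G hcubic M hM
  exact ⟨c, h1, by omega⟩
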